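/- Let 0 < R ≤ ∞ and let f be a (0,1)-form of class C¹ on the ball B(R) ⊆ l¹ which is Lipschitz continuous on every ball B(r) with 0 < r < R. If f is ∂̄-closed, then there exists a continuously (real Fréchet) differentiable function u : B(R) → ℂ such that ∂̄u = f on B(R). -/

import Mathlib

open Set
open scoped ENNReal NNReal

noncomputable section

/-- `l¹`: the space of absolutely summable sequences of complex numbers. -/
abbrev L1 : Type := lp (fun _ : ℕ => ℂ) 1

/-- `ℂ^N` equipped with the `l¹` norm. -/
abbrev EN (N : ℕ) : Type := PiLp 1 (fun _ : Fin N => ℂ)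

/-- The `(0,1)`-part of the real Fréchet derivative of `u` at `z`, applied to `ξ`:
`∂̄u(z)(ξ) = (Du(z)(ξ) + i·Du(z)(iξ))/2`. -/
noncomputable def dbar {V : Type*} [NormedAddCommGroup V] [NormedSpace ℂ V]
    (u : V → ℂ) (z ξ : V) : ℂ :=
  (fderiv ℝ u z ξ + Complex.I * fderiv ℝ u z (Complex.I • ξ)) / 2

/-- `f` is a `(0,1)`-form of class `C^m` on `Ω`: each `f z` is (continuous) conjugate-linear
and `(z,ξ) ↦ f z ξ` is `m` times continuously differentiable in the real sense on `Ω × V`. -/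
def IsForm01 {V : Type*} [NormedAddCommGroup V] [NormedSpace ℂ V]
    (m : ℕ) (Ω : Set V) (f : V → V → ℂ) : Prop :=
  (∀ z ∈ Ω, ∀ ξ η : V, f z (ξ + η) = f z ξ + f z η) ∧
  (∀ z ∈ Ω, ∀ (a : ℂ) (ξ : V), f z (a • ξ) = (starRingEnd ℂ) a * f z ξ) ∧
  ContDiffOn ℝ m (fun p : V × V => f p.1 p.2) (Ω ×ˢ (univ : Set V))

/-- A `(0,1)`-form `f` is `∂̄`-closed on `Ω`. -/
def DbarClosed {V : Type*} [NormedAddCommGroup V] [NormedSpace ℂ V]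
    (Ω : Set V) (f : V → V → ℂ) : Prop :=
  ∀ z ∈ Ω, ∀ ξ η : V, dbar (fun w => f w ξ) z η = dbar (fun w => f w η) z ξ

/-- The set of values `‖f z ξ‖`, `z ∈ A`, `‖ξ‖ ≤ 1`; its sup is `|f|_{0,A}`. -/
def formSet0 {V : Type*} [NormedAddCommGroup V]
    (f : V → V → ℂ) (A : Set V) : Set ℝ :=
  {x | ∃ z ∈ A, ∃ ξ : V, ‖ξ‖ ≤ 1 ∧ x = ‖f z ξ‖}

/-- The set of difference quotients `‖f z ξ - f w ξ‖/‖z-w‖`; its sup is `|f|_{1,A}`. -/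
def formSet1 {V : Type*} [NormedAddCommGroup V]
    (f : V → V → ℂ) (A : Set V) : Set ℝ :=
  {x | ∃ z ∈ A, ∃ w ∈ A, z ≠ w ∧ ∃ ξ : V, ‖ξ‖ ≤ 1 ∧ x = ‖f z ξ - f w ξ‖ / ‖z - w‖}

/-- `|f|_{0,A}`. -/
noncomputable def formNorm0 {V : Type*} [NormedAddCommGroup V]
    (f : V → V → ℂ) (A : Set V) : ℝ := sSup (formSet0 f A)

/-- `|f|_{1,A}`. -/
noncomputable def formNorm1 {V : Type*} [NormedAddCommGroup V]
    (f : V → V → ℂ) (A : Set V) : ℝ := sSup (formSet1 f A)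

/-- `f` is Lipschitz continuous on `A`: `|f|_{0,A} < ∞` and `|f|_{1,A} < ∞`. -/
def LipschitzForm {V : Type*} [NormedAddCommGroup V]
    (f : V → V → ℂ) (A : Set V) : Prop :=
  BddAbove (formSet0 f A) ∧ BddAbove (formSet1 f A)

/-- `‖k‖ = ∑_ν k_ν` for a multiindex `k`. -/
def knormN (k : ℕ →₀ ℕ) : ℕ := k.sum fun _ m => m

/-- `k^k = ∏_ν k_ν^{k_ν}` (with `0^0 = 1`). -/
noncomputable def kk (k : ℕ →₀ ℕ) : ℝ := ∏ ν ∈ k.support, (k ν : ℝ) ^ k ν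

/-- `‖k‖^{‖k‖}` (with `0^0 = 1`). -/
noncomputable def nn (k : ℕ →₀ ℕ) : ℝ := ((knormN k : ℝ)) ^ knormN k

/-- The monomial `z^k = ∏_ν z_ν^{k_ν}` (with `0^0 = 1`). -/
noncomputable def monom (k : ℕ →₀ ℕ) (z : ℕ → ℂ) : ℂ := ∏ ν ∈ k.support, z ν ^ k ν

/-- The term of the series defining `Δ(q,z)` corresponding to the multiindex `k`:
`(‖k‖^{‖k‖}/k^k)·|q|^{#k}·|z^k|`. -/
noncomputable def DeltaTerm (q : ℂ) (z : ℕ → ℂ) (k : ℕ →₀ ℕ) : ℝ :=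
  (nn k / kk k) * ‖q‖ ^ k.support.card * ∏ ν ∈ k.support, ‖z ν‖ ^ k ν

/-- `Δ(q,z) = ∑_k (‖k‖^{‖k‖}/k^k)·|q|^{#k}·|z^k|`. -/
noncomputable def Delta (q : ℂ) (z : ℕ → ℂ) : ℝ := ∑' k, DeltaTerm q z k

section Helpers
open Filter Topology MeasureTheory intervalIntegral



section parametric
variable {X : Type*} [NormedAddCommGroup X] [NormedSpace ℝ X]
variable {W : Type*} [NormedAddCommGroup W]

lemma tube_bound {X : Type*} [NormedAddCommGroup X] {D : X × ℝ → W} {z : X} (h : ∀ φ : ℝ, ContinuousAt D (z, φ)) (a b : ℝ) :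
    ∃ K : ℝ, ∀ᶠ y in 𝓝 z, ∀ φ ∈ uIcc a b, ‖D (y, φ)‖ ≤ K := by
  have hc : ContinuousOn (fun φ : ℝ => ‖D (z, φ)‖) (uIcc a b) := by
    intro φ _
    apply ContinuousAt.continuousWithinAt
    have : ContinuousAt (fun φ : ℝ => ((z, φ) : X × ℝ)) φ := by fun_prop
    exact (ContinuousAt.comp (f := fun φ : ℝ => ((z, φ) : X × ℝ)) (h φ) this).norm
  obtain ⟨K, hK⟩ := (isCompact_uIcc.image_of_continuousOn hc).bddAbove
  refine ⟨K + 1, ?_⟩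
  apply isCompact_uIcc.eventually_forall_of_forall_eventually
  intro φ hφ
  have h1 : ‖D (z, φ)‖ < K + 1 := by
    have := hK (mem_image_of_mem _ hφ); linarith
  exact ((h φ).norm.eventually_lt_const h1).mono (fun p hp => hp.le)

lemma P_main {U : Set X} (hU : IsOpen U) {H : X → ℝ → ℂ}
    (hH : ∀ z ∈ U, ∀ φ : ℝ, ContDiffAt ℝ 1 (fun p : X × ℝ => H p.1 p.2) (z, φ)) (a b : ℝ)
    {z : X} (hz : z ∈ U) :
    ContDiffAt ℝ 1 (fun y => ∫ φ in a..b, H y φ) z ∧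
    HasFDerivAt (fun y => ∫ φ in a..b, H y φ) (∫ φ in a..b, fderiv ℝ (fun y => H y φ) z) z ∧
    IntervalIntegrable (fun φ => fderiv ℝ (fun y => H y φ) z) volume a b := by
  set Hu : X × ℝ → ℂ := fun p => H p.1 p.2 with hHu
  set D : X × ℝ → (X →L[ℝ] ℂ) :=
    fun p => (fderiv ℝ Hu p).comp (ContinuousLinearMap.inl ℝ X ℝ) with hD
  have hDc : ∀ y ∈ U, ∀ φ : ℝ, ContinuousAt D (y, φ) := by
    intro y hy φ
    have h1 : ContinuousAt (fderiv ℝ Hu) (y, φ) :=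
      ((hH y hy φ).fderiv_right (m := 0) (by norm_num)).continuousAt
    exact h1.clm_comp continuousAt_const
  have hDd : ∀ y ∈ U, ∀ φ : ℝ, HasFDerivAt (fun y => H y φ) (D (y, φ)) y := by
    intro y hy φ
    have h1 : HasFDerivAt Hu (fderiv ℝ Hu (y, φ)) (y, φ) :=
      ((hH y hy φ).differentiableAt (by norm_num)).hasFDerivAt
    have h2 : HasFDerivAt (fun y : X => (y, φ)) (ContinuousLinearMap.inl ℝ X ℝ) y :=
      hasFDerivAt_prodMk_left y φ
    exact HasFDerivAt.comp (g := Hu) (f := fun y : X => (y, φ)) y h1 h2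
  have hDe : ∀ y ∈ U, ∀ φ : ℝ, fderiv ℝ (fun y => H y φ) y = D (y, φ) :=
    fun y hy φ => (hDd y hy φ).fderiv
  have hcont : ∀ y ∈ U, Continuous (fun φ => H y φ) := by
    intro y hy
    rw [continuous_iff_continuousAt]
    intro φ
    have : ContinuousAt (fun φ : ℝ => ((y, φ) : X × ℝ)) φ := by fun_prop
    exact ContinuousAt.comp (g := Hu) (f := fun φ : ℝ => ((y, φ) : X × ℝ)) (hH y hy φ).continuousAt this
  have hDcont : ∀ y ∈ U, Continuous (fun φ => D (y, φ)) := by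
    intro y hy
    rw [continuous_iff_continuousAt]
    intro φ
    have : ContinuousAt (fun φ : ℝ => ((y, φ) : X × ℝ)) φ := by fun_prop
    exact ContinuousAt.comp (g := D) (f := fun φ : ℝ => ((y, φ) : X × ℝ)) (hDc y hy φ) this
  have hder : ∀ y ∈ U, HasFDerivAt (fun y => ∫ φ in a..b, H y φ) (∫ φ in a..b, D (y, φ)) y := by
    intro y hy
    obtain ⟨K, hK⟩ := tube_bound (hDc y hy) a b
    have hs : {x | (∀ φ ∈ uIcc a b, ‖D (x, φ)‖ ≤ K) ∧ x ∈ U} ∈ 𝓝 y :=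
      hK.and (hU.mem_nhds hy)
    refine intervalIntegral.hasFDerivAt_integral_of_dominated_of_fderiv_le
      (F' := fun y φ => D (y, φ)) (bound := fun _ => K) hs ?_ ?_ ?_ ?_ ?_ ?_
    · filter_upwards [hU.mem_nhds hy] with x hx
      exact (hcont x hx).aestronglyMeasurable
    · exact (hcont y hy).intervalIntegrable _ _
    · exact (hDcont y hy).aestronglyMeasurable
    · refine Eventually.of_forall fun t ht x hx => hx.1 t (uIoc_subset_uIcc ht)
    · simp
    · refine Eventually.of_forall fun t ht x hx => hDd x hx.2 t
  have heq : (∫ φ in a..b, fderiv ℝ (fun y => H y φ) z) = ∫ φ in a..b, D (z, φ) := by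
    congr 1; ext φ; rw [hDe z hz φ]
  refine ⟨?_, ?_, ?_⟩
  · rw [contDiffAt_one_iff]
    refine ⟨fun y => ∫ φ in a..b, D (y, φ), U, hU.mem_nhds hz, ?_, hder⟩
    intro y hy
    apply ContinuousAt.continuousWithinAt
    obtain ⟨K, hK⟩ := tube_bound (hDc y hy) a b
    refine intervalIntegral.continuousAt_of_dominated_interval (bound := fun _ => K) ?_ ?_ ?_ ?_
    · filter_upwards [hU.mem_nhds hy] with x hx
      exact (hDcont x hx).aestronglyMeasurable
    · filter_upwards [hK] with x hx
      exact Eventually.of_forall fun t ht => hx t (uIoc_subset_uIcc ht)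
    · simp
    · refine Eventually.of_forall fun t ht => ?_
      have : ContinuousAt (fun x : X => ((x, t) : X × ℝ)) y := by fun_prop
      exact ContinuousAt.comp (g := D) (f := fun x : X => ((x, t) : X × ℝ)) (hDc y hy t) this
  · rw [heq]; exact hder z hz
  · have : (fun φ => fderiv ℝ (fun y => H y φ) z) = fun φ => D (z, φ) := by
      ext1 φ; exact hDe z hz φ
    rw [this]; exact (hDcont z hz).intervalIntegrable _ _

end parametric

section dbarcalc
variable {V : Type*} [NormedAddCommGroup V] [NormedSpace ℂ V]

lemma dbar_eq_of_hasFDerivAt {u : V → ℂ} {z : V} {L : V →L[ℝ] ℂ} (h : HasFDerivAt u L z) (ξ : V) :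
    dbar u z ξ = (L ξ + Complex.I * L (Complex.I • ξ)) / 2 := by
  rw [dbar, h.fderiv]

lemma P_dbar {U : Set V} (hU : IsOpen U) {H : V → ℝ → ℂ}
    (hH : ∀ z ∈ U, ∀ φ : ℝ, ContDiffAt ℝ 1 (fun p : V × ℝ => H p.1 p.2) (z, φ)) (a b : ℝ)
    {z : V} (hz : z ∈ U) (ξ : V) :
    dbar (fun y => ∫ φ in a..b, H y φ) z ξ = ∫ φ in a..b, dbar (fun y => H y φ) z ξ := by
  obtain ⟨_, h2, h3⟩ := P_main hU hH a b hz
  rw [dbar_eq_of_hasFDerivAt h2]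
  rw [ContinuousLinearMap.intervalIntegral_apply h3, ContinuousLinearMap.intervalIntegral_apply h3]
  simp only [dbar]
  have i1 : ∀ v : V, IntervalIntegrable (fun φ => fderiv ℝ (fun y => H y φ) z v) volume a b :=
    fun v => ⟨h3.1.apply_continuousLinearMap v, h3.2.apply_continuousLinearMap v⟩
  rw [intervalIntegral.integral_div, intervalIntegral.integral_add (i1 _) ((i1 _).const_mul _),
    intervalIntegral.integral_const_mul]

lemma dbar_add_dir {u : V → ℂ} (z ξ η : V) : dbar u z (ξ + η) = dbar u z ξ + dbar u z η := by
  simp only [dbar, smul_add, map_add]; ring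

lemma dbar_zero_dir {u : V → ℂ} (z : V) : dbar u z 0 = 0 := by
  simp [dbar]

lemma dbar_smul_dir {u : V → ℂ} (z : V) (a : ℂ) (ξ : V) :
    dbar u z (a • ξ) = (starRingEnd ℂ) a * dbar u z ξ := by
  have key : ∀ v : V, fderiv ℝ u z (a • v) = a.re * fderiv ℝ u z v + a.im * fderiv ℝ u z (Complex.I • v) := by
    intro v
    have : a • v = a.re • v + a.im • (Complex.I • v) := by
      conv_lhs => rw [← Complex.re_add_im a]
      rw [add_smul, mul_smul]; simp
    rw [this, map_add, map_smul, map_smul]; simp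
  have h2 : Complex.I • a • ξ = a • Complex.I • ξ := smul_comm _ _ _
  simp only [dbar]
  rw [h2, key ξ, key (Complex.I • ξ), smul_smul, Complex.I_mul_I]
  have h3 : (starRingEnd ℂ) a = a.re - a.im * Complex.I := by
    apply Complex.ext <;> simp
  rw [h3]; simp only [neg_smul, one_smul, map_neg]
  ring_nf; rw [Complex.I_sq]; ring

lemma dbar_sum_dir {u : V → ℂ} {ι : Type*} (s : Finset ι) (z : V) (v : ι → V) :
    dbar u z (∑ i ∈ s, v i) = ∑ i ∈ s, dbar u z (v i) := by
  classical
  induction s using Finset.induction_on with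
  | empty => simp [dbar_zero_dir]
  | insert a s ha ih => rw [Finset.sum_insert ha, Finset.sum_insert ha, dbar_add_dir, ih]

lemma fderiv_eq_dbar {u : V → ℂ} (z v : V) :
    fderiv ℝ u z v = 2 * dbar u z v - Complex.I * fderiv ℝ u z (Complex.I • v) := by
  simp only [dbar]; ring

lemma dbar_congr {u v : V → ℂ} {z : V} (h : u =ᶠ[𝓝 z] v) (ξ : V) : dbar u z ξ = dbar v z ξ := by
  simp only [dbar, h.fderiv_eq]

lemma dbar_add {u v : V → ℂ} {z : V} (hu : DifferentiableAt ℝ u z) (hv : DifferentiableAt ℝ v z)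
    (ξ : V) : dbar (fun y => u y + v y) z ξ = dbar u z ξ + dbar v z ξ := by
  rw [dbar_eq_of_hasFDerivAt (hu.hasFDerivAt.fun_add hv.hasFDerivAt)]; simp [dbar]; ring

lemma dbar_sub {u v : V → ℂ} {z : V} (hu : DifferentiableAt ℝ u z) (hv : DifferentiableAt ℝ v z)
    (ξ : V) : dbar (fun y => u y - v y) z ξ = dbar u z ξ - dbar v z ξ := by
  rw [dbar_eq_of_hasFDerivAt (hu.hasFDerivAt.fun_sub hv.hasFDerivAt)]; simp [dbar]; ring

lemma dbar_mul {u v : V → ℂ} {z : V} (hu : DifferentiableAt ℝ u z) (hv : DifferentiableAt ℝ v z)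
    (ξ : V) : dbar (fun y => u y * v y) z ξ = u z * dbar v z ξ + dbar u z ξ * v z := by
  rw [dbar_eq_of_hasFDerivAt (hu.hasFDerivAt.fun_mul hv.hasFDerivAt)]; simp [dbar]; ring

lemma dbar_const (c : ℂ) (z ξ : V) : dbar (fun _ : V => c) z ξ = 0 := by
  simp [dbar]

lemma dbar_const_mul {u : V → ℂ} {z : V} (hu : DifferentiableAt ℝ u z) (c : ℂ)
    (ξ : V) : dbar (fun y => c * u y) z ξ = c * dbar u z ξ := by
  rw [dbar_mul (by fun_prop) hu, dbar_const]; ring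

lemma dbar_sum {ι : Type*} (s : Finset ι) {u : ι → V → ℂ} {z : V}
    (hu : ∀ i ∈ s, DifferentiableAt ℝ (u i) z) (ξ : V) :
    dbar (fun y => ∑ i ∈ s, u i y) z ξ = ∑ i ∈ s, dbar (u i) z ξ := by
  classical
  induction s using Finset.induction_on with
  | empty => simp [dbar_const]
  | insert a s ha ih =>
    simp only [Finset.sum_insert ha]
    rw [dbar_add (hu a (by simp)) (DifferentiableAt.fun_sum fun i hi => hu i (by simp [hi])),
      ih (fun i hi => hu i (by simp [hi]))]

/-- holomorphic functions have zero dbar -/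
lemma dbar_holo {u : V → ℂ} {z : V} (hu : DifferentiableAt ℂ u z) (ξ : V) : dbar u z ξ = 0 := by
  rw [dbar_eq_of_hasFDerivAt (hu.hasFDerivAt.restrictScalars ℝ)]
  simp only [ContinuousLinearMap.coe_restrictScalars', map_smul, smul_eq_mul]
  rw [← mul_assoc, Complex.I_mul_I]; ring

lemma dbar_comp {u : V → ℂ} {z : V} (L : V →L[ℂ] V) (c : V)
    (hu : DifferentiableAt ℝ u (L z + c)) (ξ : V) :
    dbar (fun y => u (L y + c)) z ξ = dbar u (L z + c) (L ξ) := by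
  have h1 : HasFDerivAt (fun y => L y + c) (L.restrictScalars ℝ) z :=
    (L.restrictScalars ℝ).hasFDerivAt.add_const c
  have := HasFDerivAt.comp (g := u) (f := fun y => L y + c) z hu.hasFDerivAt h1
  rw [dbar_eq_of_hasFDerivAt (u := fun y => u (L y + c)) this]
  simp [dbar]

lemma continuousAt_dbar {u : V → ℂ} {z : V} (hu : ContDiffAt ℝ 1 u z) (ξ : V) :
    ContinuousAt (fun y => dbar u y ξ) z := by
  have h1 : ContinuousAt (fderiv ℝ u) z :=
    (hu.fderiv_right (m := 0) (by norm_num)).continuousAt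
  unfold dbar
  have h2 : ∀ v : V, ContinuousAt (fun y => fderiv ℝ u y v) z := fun v => h1.clm_apply continuousAt_const
  exact ((h2 _).add (continuousAt_const.mul (h2 _))).div_const _

end dbarcalc

section circle

/-- MV helper -/
lemma mv_bound {f : ℝ → ℂ} {a b K : ℝ} (hab : a ≤ b) (hc : ContinuousOn f (Icc a b))
    {f' : ℝ → ℂ} (hd : ∀ t ∈ Ioo a b, HasDerivAt f (f' t) t) (hb : ∀ t ∈ Ioo a b, ‖f' t‖ ≤ K) :
    ‖f b - f a‖ ≤ K * (b - a) := by
  rcases hab.eq_or_lt with rfl | hlt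
  · simp
  -- interior estimate then limit
  have hint : ∀ c ∈ Ioo a b, ∀ d ∈ Ioo a b, c ≤ d → ‖f d - f c‖ ≤ K * (d - c) := by
    intro c hc' d hd' hcd
    have hsub : Icc c d ⊆ Ioo a b := fun t ht => ⟨hc'.1.trans_le ht.1, ht.2.trans_lt hd'.2⟩
    exact norm_image_sub_le_of_norm_deriv_le_segment' (f' := f')
      (fun x hx => (hd x (hsub hx)).hasDerivWithinAt)
      (fun x hx => hb x (hsub (Ico_subset_Icc_self hx))) d ⟨hcd, le_rfl⟩
  have hfb : Tendsto f (𝓝[Ioo a b] b) (𝓝 (f b)) :=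
    (hc b ⟨hab, le_rfl⟩).mono_left (nhdsWithin_mono _ Ioo_subset_Icc_self)
  have hfa : Tendsto f (𝓝[Ioo a b] a) (𝓝 (f a)) :=
    (hc a ⟨le_rfl, hab⟩).mono_left (nhdsWithin_mono _ Ioo_subset_Icc_self)
  have hnb : (𝓝[Ioo a b] b).NeBot := by
    rw [← mem_closure_iff_nhdsWithin_neBot, closure_Ioo hlt.ne]; exact ⟨hab, le_rfl⟩
  have hna : (𝓝[Ioo a b] a).NeBot := by
    rw [← mem_closure_iff_nhdsWithin_neBot, closure_Ioo hlt.ne]; exact ⟨le_rfl, hab⟩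
  have hstep : ∀ c ∈ Ioo a b, ‖f b - f c‖ ≤ K * (b - c) := by
    intro c hc'
    have h1 : Tendsto (fun d => ‖f d - f c‖) (𝓝[Ioo a b] b) (𝓝 ‖f b - f c‖) :=
      (hfb.sub tendsto_const_nhds).norm
    have h2 : Tendsto (fun d => K * (d - c)) (𝓝[Ioo a b] b) (𝓝 (K * (b - c))) :=
      Tendsto.mono_left (Continuous.tendsto (by fun_prop) b) nhdsWithin_le_nhds
    refine le_of_tendsto_of_tendsto h1 h2 ?_
    have h3 : ∀ᶠ d in 𝓝[Ioo a b] b, c < d :=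
      (eventually_gt_nhds hc'.2).filter_mono nhdsWithin_le_nhds
    filter_upwards [self_mem_nhdsWithin, h3] with d hd' hcd
    exact hint c hc' d hd' hcd.le
  have h1 : Tendsto (fun c => ‖f b - f c‖) (𝓝[Ioo a b] a) (𝓝 ‖f b - f a‖) :=
    (tendsto_const_nhds.sub hfa).norm
  have h2 : Tendsto (fun c => K * (b - c)) (𝓝[Ioo a b] a) (𝓝 (K * (b - a))) :=
    Tendsto.mono_left (Continuous.tendsto (by fun_prop) a) nhdsWithin_le_nhds
  refine le_of_tendsto_of_tendsto h1 h2 ?_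
  filter_upwards [self_mem_nhdsWithin] with c hc' using hstep c hc'

/-- unit circle -/
def cE (φ : ℝ) : ℂ := Complex.exp (φ * Complex.I)

lemma cE_zero : cE 0 = 1 := by simp [cE]
lemma cE_add (a b : ℝ) : cE (a + b) = cE a * cE b := by
  simp only [cE]; rw [← Complex.exp_add]; push_cast; ring_nf
@[simp] lemma norm_cE (a : ℝ) : ‖cE a‖ = 1 := Complex.norm_exp_ofReal_mul_I a
lemma cE_ne_zero (a : ℝ) : cE a ≠ 0 := Complex.exp_ne_zero _
lemma cE_neg (a : ℝ) : cE (-a) = (cE a)⁻¹ := by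
  simp only [cE]; rw [← Complex.exp_neg]; push_cast; ring_nf
lemma cE_mul_neg (a : ℝ) : cE a * cE (-a) = 1 := by
  rw [cE_neg, mul_inv_cancel₀ (cE_ne_zero a)]
lemma cE_nat (n : ℕ) (a : ℝ) : cE (n * a) = cE a ^ n := by
  simp only [cE]; rw [← Complex.exp_nat_mul]; push_cast; ring_nf
lemma conj_cE (a : ℝ) : (starRingEnd ℂ) (cE a) = cE (-a) := by
  simp only [cE]; rw [← Complex.exp_conj]; simp
lemma cE_two_pi : cE (2 * Real.pi) = 1 := by
  simp only [cE]; push_cast; exact Complex.exp_two_pi_mul_I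
lemma cE_periodic (a : ℝ) : cE (a + 2 * Real.pi) = cE a := by rw [cE_add, cE_two_pi, mul_one]
lemma cE_contDiff : ContDiff ℝ 1 cE := by
  unfold cE
  exact (Complex.ofRealCLM.contDiff.mul contDiff_const).cexp
@[fun_prop] lemma cE_continuous : Continuous cE := cE_contDiff.continuous
lemma cE_hasDerivAt (φ : ℝ) : HasDerivAt cE (Complex.I * cE φ) φ := by
  have h : HasDerivAt (fun t : ℝ => (t : ℂ) * Complex.I) (1 * Complex.I) φ :=
    (Complex.ofRealCLM.hasDerivAt (x := φ)).mul_const _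
  have := h.cexp
  unfold cE; convert this using 1; ring
lemma cE_neg_nat_periodic (m : ℕ) (a : ℝ) : cE (-(m * (a + 2 * Real.pi))) = cE (-(m * a)) := by
  rw [cE_neg, cE_neg, cE_nat, cE_nat, cE_periodic]

def avg (g : ℝ → ℂ) : ℂ := (2 * Real.pi : ℝ)⁻¹ * ∫ φ in (0:ℝ)..(2 * Real.pi), g φ

lemma avg_const (c : ℂ) : avg (fun _ => c) = c := by
  have : (Real.pi : ℂ) ≠ 0 := by exact_mod_cast Real.pi_ne_zero
  simp [avg]; field_simp

lemma avg_add {f g : ℝ → ℂ} (hf : Continuous f) (hg : Continuous g) :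
    avg (fun φ => f φ + g φ) = avg f + avg g := by
  unfold avg
  rw [intervalIntegral.integral_add (hf.intervalIntegrable _ _) (hg.intervalIntegrable _ _), mul_add]

lemma avg_sub {f g : ℝ → ℂ} (hf : Continuous f) (hg : Continuous g) :
    avg (fun φ => f φ - g φ) = avg f - avg g := by
  unfold avg
  rw [intervalIntegral.integral_sub (hf.intervalIntegrable _ _) (hg.intervalIntegrable _ _), mul_sub]

lemma avg_const_mul (c : ℂ) (f : ℝ → ℂ) : avg (fun φ => c * f φ) = c * avg f := by
  unfold avg; rw [intervalIntegral.integral_const_mul]; ring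

lemma avg_mul_const (c : ℂ) (f : ℝ → ℂ) : avg (fun φ => f φ * c) = avg f * c := by
  unfold avg; rw [intervalIntegral.integral_mul_const]; ring

lemma norm_avg_le {f : ℝ → ℂ} {K : ℝ} (h : ∀ φ, ‖f φ‖ ≤ K) : ‖avg f‖ ≤ K := by
  unfold avg
  have hp : (0:ℝ) < 2 * Real.pi := Real.two_pi_pos
  have := intervalIntegral.norm_integral_le_of_norm_le_const (a := 0) (b := 2 * Real.pi) (f := f) (C := K)
    (fun x _ => h x)
  rw [norm_mul, Complex.norm_real, Real.norm_of_nonneg (inv_nonneg.2 hp.le)]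
  rw [sub_zero, abs_of_pos hp] at this
  calc (2 * Real.pi)⁻¹ * _ ≤ (2 * Real.pi)⁻¹ * (K * (2 * Real.pi)) := by gcongr
    _ = K := by field_simp

lemma avg_shift {f : ℝ → ℂ} (h : ∀ φ, f (φ + 2 * Real.pi) = f φ) (ψ : ℝ) :
    avg (fun φ => f (φ + ψ)) = avg f := by
  unfold avg
  rw [intervalIntegral.integral_comp_add_right]
  congr 1
  have := Function.Periodic.intervalIntegral_add_eq (f := f) (T := 2 * Real.pi) h ψ 0
  rw [zero_add] at this ⊢
  rw [add_comm]; exact this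

lemma avg_deriv {G g : ℝ → ℂ} (h : ∀ φ, HasDerivAt G (g φ) φ) (hg : Continuous g)
    (hp : G (2 * Real.pi) = G 0) : avg g = 0 := by
  unfold avg
  rw [intervalIntegral.integral_eq_sub_of_hasDerivAt (fun x _ => h x) (hg.intervalIntegrable _ _), hp]
  simp

lemma cE_negnat_hasDerivAt (m : ℕ) (φ : ℝ) :
    HasDerivAt (fun φ : ℝ => cE (-(m * φ))) (-(m * Complex.I) * cE (-(m * φ))) φ := by
  have h1 : HasDerivAt (fun φ : ℝ => -((m:ℝ) * φ)) (-((m : ℝ) * 1)) φ :=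
    ((hasDerivAt_id' φ).const_mul (m : ℝ)).fun_neg
  have h2 := HasDerivAt.scomp φ (cE_hasDerivAt (-(m * φ))) h1
  refine h2.congr_deriv ?_
  rw [Complex.real_smul]; push_cast; ring

lemma avg_cE_neg {m : ℕ} (hm : m ≠ 0) : avg (fun φ => cE (-(m * φ))) = 0 := by
  have hmc : (m : ℂ) ≠ 0 := by exact_mod_cast hm
  refine avg_deriv (G := fun φ => (-(m * Complex.I))⁻¹ * cE (-(m * φ))) ?_ ?_ ?_
  · intro φ
    have h3 := (cE_negnat_hasDerivAt m φ).const_mul (-(m * Complex.I))⁻¹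
    have hne : (-(m * Complex.I) : ℂ) ≠ 0 := by simp [hmc]
    rwa [inv_mul_cancel_left₀ hne] at h3
  · fun_prop
  · have := cE_neg_nat_periodic m 0
    simp only [zero_add] at this
    rw [this]
end circle

section Adisc
lemma hasSum_congr' {ι : Type*} {f g : ι → ℂ} {a b : ℂ} (h : HasSum f a) (h1 : ∀ i, g i = f i) (h2 : b = a) :
    HasSum g b := by
  have : g = f := funext h1
  rw [this, h2]; exact h
variable {V : Type*} [NormedAddCommGroup V] [NormedSpace ℂ V]

lemma cont_fderiv_comp {C : V → ℂ} {γ v : ℝ → V} (hγ : Continuous γ) (hv : Continuous v)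
    (hC : ∀ φ, ContDiffAt ℝ 1 C (γ φ)) : Continuous (fun φ => fderiv ℝ C (γ φ) (v φ)) := by
  rw [continuous_iff_continuousAt]
  intro φ
  have h1 : ContinuousAt (fderiv ℝ C) (γ φ) :=
    ((hC φ).fderiv_right (m := 0) (by norm_num)).continuousAt
  exact (ContinuousAt.comp (g := fderiv ℝ C) h1 hγ.continuousAt).clm_apply hv.continuousAt

lemma cont_dbar_comp {C : V → ℂ} {γ v : ℝ → V} (hγ : Continuous γ) (hv : Continuous v)
    (hC : ∀ φ, ContDiffAt ℝ 1 C (γ φ)) : Continuous (fun φ => dbar C (γ φ) (v φ)) := by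
  unfold dbar
  have h1 := cont_fderiv_comp hγ hv hC
  have h2 := cont_fderiv_comp hγ (hv.const_smul Complex.I) hC
  fun_prop

lemma cont_comp {C : V → ℂ} {γ : ℝ → V} (hγ : Continuous γ)
    (hC : ∀ φ, ContDiffAt ℝ 1 C (γ φ)) : Continuous (fun φ => C (γ φ)) := by
  rw [continuous_iff_continuousAt]
  intro φ
  exact ContinuousAt.comp (g := C) (hC φ).continuousAt hγ.continuousAt

lemma avg_hasDerivAt {C : V → ℂ} {p v : ℝ → V} (hp : ContDiff ℝ 1 p) (hv : ContDiff ℝ 1 v)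
    {w : ℝ → ℂ} (hw : ContDiff ℝ 1 w) {U : Set ℝ} (hU : IsOpen U)
    (hC : ∀ t ∈ U, ∀ φ, ContDiffAt ℝ 1 C (p φ + t • v φ)) {t : ℝ} (ht : t ∈ U) :
    HasDerivAt (fun t : ℝ => avg (fun φ => C (p φ + t • v φ) * w φ))
      (avg (fun φ => fderiv ℝ C (p φ + t • v φ) (v φ) * w φ)) t := by
  have hH : ∀ s ∈ U, ∀ φ : ℝ, ContDiffAt ℝ 1
      (fun x : ℝ × ℝ => C (p x.2 + x.1 • v x.2) * w x.2) (s, φ) := by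
    intro s hs φ
    have h1 : ContDiffAt ℝ 1 (fun x : ℝ × ℝ => p x.2 + x.1 • v x.2) (s, φ) := by
      apply ContDiff.contDiffAt
      exact (hp.comp contDiff_snd).add (contDiff_fst.smul (hv.comp contDiff_snd))
    have h2 : ContDiffAt ℝ 1 (fun x : ℝ × ℝ => w x.2) (s, φ) :=
      (hw.comp contDiff_snd).contDiffAt
    exact (ContDiffAt.comp (g := C) (f := fun x : ℝ × ℝ => p x.2 + x.1 • v x.2) (s, φ)
      (hC s hs φ) h1).mul h2
  obtain ⟨_, h2, h3⟩ := P_main (X := ℝ) hU (H := fun t φ => C (p φ + t • v φ) * w φ) hH 0 (2 * Real.pi) ht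
  have h4 := h2.hasDerivAt
  rw [ContinuousLinearMap.intervalIntegral_apply h3] at h4
  have h5 := h4.const_mul (((2 * Real.pi : ℝ)⁻¹ : ℝ) : ℂ)
  unfold avg
  refine h5.congr_deriv ?_
  congr 2
  ext φ
  have h6 : HasDerivAt (fun s : ℝ => p φ + s • v φ) (v φ) t := by
    simpa using ((hasDerivAt_id t).smul_const (v φ)).const_add (p φ)
  have h7 := (((hC t ht φ).differentiableAt (by norm_num)).hasFDerivAt.comp_hasDerivAt t h6).mul_const (w φ)
  have h8 := h7.deriv
  simp only [Function.comp_def] at h8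
  exact h8

lemma avg_contOn {C : V → ℂ} {p v : ℝ → V} (hp : Continuous p) (hv : Continuous v)
    {w : ℝ → ℂ} (hw : Continuous w) {a b : ℝ} (hab : a ≤ b)
    (hC : ∀ t ∈ Icc a b, ∀ φ, ContDiffAt ℝ 1 C (p φ + t • v φ)) :
    ContinuousOn (fun t : ℝ => avg (fun φ => C (p φ + t • v φ) * w φ)) (Icc a b) := by
  have hcl : ∀ t : ℝ, max a (min b t) ∈ Icc a b :=
    fun t => ⟨le_max_left _ _, max_le hab (min_le_left _ _)⟩
  have h1 : Continuous (fun x : ℝ × ℝ => C (p x.2 + (max a (min b x.1)) • v x.2) * w x.2) := by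
    apply Continuous.mul _ (by fun_prop)
    rw [continuous_iff_continuousAt]
    intro x
    have : Continuous (fun x : ℝ × ℝ => p x.2 + (max a (min b x.1)) • v x.2) := by fun_prop
    exact ContinuousAt.comp (g := C) (hC _ (hcl x.1) x.2).continuousAt this.continuousAt
  have h2 : Continuous (fun t : ℝ => avg (fun φ => C (p φ + (max a (min b t)) • v φ) * w φ)) := by
    unfold avg
    apply Continuous.mul continuous_const
    exact intervalIntegral.continuous_parametric_intervalIntegral_of_continuous' h1 0 (2 * Real.pi)
  refine h2.continuousOn.congr ?_
  intro t ht
  have : max a (min b t) = t := by rw [min_eq_right ht.2, max_eq_right ht.1]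
  simp only [this]

/-- mode lemma -/
lemma modeA1 {C : V → ℂ} {q e : V} {t : ℝ} (m : ℕ)
    (hC : ∀ φ, ContDiffAt ℝ 1 C (q + (t * cE φ) • e)) :
    t * avg (fun φ => fderiv ℝ C (q + (t * cE φ) • e) (cE φ • e) * cE (-(m * φ))) =
    t * avg (fun φ => 2 * dbar C (q + (t * cE φ) • e) (cE φ • e) * cE (-(m * φ))) +
      m * avg (fun φ => C (q + (t * cE φ) • e) * cE (-(m * φ))) := by
  set γ : ℝ → V := fun φ => q + (t * cE φ) • e with hγ
  have hγc : Continuous γ := by fun_prop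
  have hwc : Continuous (fun φ : ℝ => cE (-(m * φ))) := by fun_prop
  have hvc : Continuous (fun φ : ℝ => cE φ • e) := by fun_prop
  have hD1 : Continuous (fun φ => fderiv ℝ C (γ φ) (Complex.I • cE φ • e)) :=
    cont_fderiv_comp hγc (hvc.const_smul Complex.I) hC
  have hD2 := cont_dbar_comp hγc hvc hC
  have hD3 : Continuous (fun φ => C (γ φ)) := cont_comp hγc hC
  have hder : ∀ φ, HasDerivAt (fun φ => C (γ φ) * cE (-(m * φ)))
      (t * (fderiv ℝ C (γ φ) (Complex.I • cE φ • e) * cE (-(m * φ))) -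
        m * Complex.I * (C (γ φ) * cE (-(m * φ)))) φ := by
    intro φ
    have h1 : HasDerivAt γ ((t * (Complex.I * cE φ)) • e) φ :=
      (((cE_hasDerivAt φ).const_mul (t:ℂ)).smul_const e).const_add q
    have h2 := ((hC φ).differentiableAt (by norm_num)).hasFDerivAt.comp_hasDerivAt φ h1
    have h3 := h2.mul (cE_negnat_hasDerivAt m φ)
    refine h3.congr_deriv ?_
    have : ((t * (Complex.I * cE φ)) • e) = t • (Complex.I • cE φ • e) := by
      rw [mul_smul, mul_smul, Complex.coe_smul]
    rw [this, map_smul, Complex.real_smul]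
    simp only [Function.comp]
    ring
  have hz := avg_deriv hder ((continuous_const.mul (hD1.mul hwc)).sub (continuous_const.mul (hD3.mul hwc))) (by
    simp only [hγ]
    have := cE_neg_nat_periodic m 0
    simp only [zero_add] at this
    rw [this, cE_two_pi, cE_zero])
  rw [avg_sub (by exact continuous_const.mul (hD1.mul hwc)) (by exact continuous_const.mul (hD3.mul hwc)),
    avg_const_mul, avg_const_mul] at hz
  have hsplit : avg (fun φ => fderiv ℝ C (γ φ) (cE φ • e) * cE (-(m * φ))) =
      avg (fun φ => 2 * dbar C (γ φ) (cE φ • e) * cE (-(m * φ))) -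
      Complex.I * avg (fun φ => fderiv ℝ C (γ φ) (Complex.I • cE φ • e) * cE (-(m * φ))) := by
    rw [← avg_const_mul, ← avg_sub (by fun_prop) (by fun_prop)]
    congr 1; ext φ
    rw [fderiv_eq_dbar (γ φ) (cE φ • e)]; ring
  rw [hsplit]
  linear_combination (-Complex.I) * hz -
    m * avg (fun φ => C (γ φ) * cE (-(m * φ))) * Complex.I_sq

lemma geom_kernel_hasSum {T : ℝ} {w : ℂ} (hw : ‖w‖ < T) {g : ℝ → ℂ} (hg : Continuous g) :
    HasSum (fun m : ℕ => w ^ m * ((T : ℂ) ^ m)⁻¹ * avg (fun φ => g φ * cE (-(m * φ))))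
      (avg (fun φ => g φ * (T * cE φ / (T * cE φ - w)))) := by
  have hT : 0 < T := (norm_nonneg w).trans_lt hw
  have hTc : (T : ℂ) ≠ 0 := by exact_mod_cast hT.ne'
  have hr : ‖w‖ / T < 1 := by rw [div_lt_one hT]; exact hw
  have hr0 : 0 ≤ ‖w‖ / T := by positivity
  obtain ⟨M, hM⟩ := (isCompact_uIcc (a := (0:ℝ)) (b := 2 * Real.pi)).exists_bound_of_continuousOn hg.continuousOn
  have key := intervalIntegral.hasSum_integral_of_dominated_convergence (μ := volume) (a := 0) (b := 2 * Real.pi)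
    (F := fun (m : ℕ) φ => g φ * (w ^ m * ((T : ℂ) ^ m)⁻¹ * cE (-(m * φ))))
    (f := fun φ => g φ * (T * cE φ / (T * cE φ - w)))
    (fun m _ => M * (‖w‖ / T) ^ m) ?_ ?_ ?_ ?_ ?_
  · have := key.mul_left (((2 * Real.pi : ℝ)⁻¹ : ℝ) : ℂ)
    unfold avg
    refine hasSum_congr' this (fun m => ?_) rfl
    rw [← mul_assoc, mul_comm (w ^ m * _), mul_assoc, ← intervalIntegral.integral_const_mul]
    congr 2; ext φ; ring
  · intro m
    apply Continuous.aestronglyMeasurable; fun_prop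
  · intro m
    refine Eventually.of_forall fun φ hφ => ?_
    rw [norm_mul, norm_mul, norm_mul, norm_cE, norm_inv, norm_pow, norm_pow, Complex.norm_real,
      Real.norm_of_nonneg hT.le, mul_one, div_pow, div_eq_mul_inv]
    gcongr
    exact hM φ (uIoc_subset_uIcc hφ)
  · exact Eventually.of_forall fun φ _ => (summable_geometric_of_lt_one hr0 hr).mul_left M
  · simp
  · refine Eventually.of_forall fun φ _ => ?_
    have h1 : ‖w * (T * cE φ)⁻¹‖ < 1 := by
      rw [norm_mul, norm_inv, norm_mul, norm_cE, mul_one, Complex.norm_real, Real.norm_of_nonneg hT.le,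
        ← div_eq_mul_inv]; exact hr
    have h2 := (hasSum_geometric_of_norm_lt_one h1).mul_left (g φ)
    have hc := cE_ne_zero φ
    refine hasSum_congr' h2 (fun m => ?_) ?_
    · rw [cE_neg, cE_nat, mul_pow, inv_pow, mul_pow, mul_inv]; ring
    · have h3 : T * cE φ ≠ 0 := mul_ne_zero hTc hc
      have h4 : T * cE φ - w ≠ 0 := by
        intro h
        have : ‖w‖ = T := by
          rw [← sub_eq_zero.1 h]; simp [hT.le]
        linarith
      have h5 : 1 - w * (T * cE φ)⁻¹ = (T * cE φ - w) / (T * cE φ) := by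
        field_simp
      rw [h5, inv_div]

lemma disc_kernel_ne {T : ℝ} {w : ℂ} (hw : ‖w‖ < T) (φ : ℝ) : T * cE φ - w ≠ 0 := by
  have hT : 0 < T := (norm_nonneg w).trans_lt hw
  intro h
  have : ‖w‖ = T := by
    rw [← sub_eq_zero.1 h]; simp [hT.le]
  linarith

/-- disc estimate -/
lemma discA2 {C : V → ℂ} {q e : V} {T K : ℝ} {w : ℂ} (hw : ‖w‖ < T)
    (hC : ∀ ζ : ℂ, ‖ζ‖ ≤ T → ContDiffAt ℝ 1 C (q + ζ • e))
    (hK : ∀ ζ : ℂ, ‖ζ‖ ≤ T → ‖dbar C (q + ζ • e) e‖ ≤ K) :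
    ‖C (q + w • e) - avg (fun φ => C (q + (T * cE φ) • e) * (T * cE φ / (T * cE φ - w)))‖
      ≤ 2 * T * K := by
  have hT : 0 < T := (norm_nonneg w).trans_lt hw
  set η : ℝ → ℂ := fun φ => T * cE φ - w with hη
  have hηne : ∀ φ, η φ ≠ 0 := disc_kernel_ne hw
  have hηc : ContDiff ℝ 1 η := (contDiff_const.mul cE_contDiff).sub contDiff_const
  have hηcc : Continuous η := hηc.continuous
  set W : ℝ → ℂ := fun φ => T * cE φ / η φ with hW
  have hWc : ContDiff ℝ 1 W := by
    simp only [hW, div_eq_mul_inv]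
    exact (contDiff_const.mul cE_contDiff).mul (hηc.inv hηne)
  have hWcc := hWc.continuous
  set p : ℝ → V := fun _ => q + w • e with hp
  set v : ℝ → V := fun φ => η φ • e with hv
  have hvc : ContDiff ℝ 1 v := hηc.smul contDiff_const
  have hpt : ∀ (t φ : ℝ), p φ + t • v φ = q + (w + t * η φ) • e := by
    intro t φ
    simp only [hp, hv]; rw [add_smul, mul_smul, Complex.coe_smul, add_assoc]
  have hnorm : ∀ t ∈ Icc (0:ℝ) 1, ∀ φ, ‖w + t * η φ‖ ≤ T := by
    intro t ht φ
    have : w + t * η φ = ((1 - t : ℝ) : ℂ) * w + (t : ℂ) * (T * cE φ) := by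
      simp only [hη]; push_cast; ring
    rw [this]
    refine (norm_add_le _ _).trans ?_
    rw [norm_mul, norm_mul, norm_mul, norm_cE, Complex.norm_real, Complex.norm_real, Complex.norm_real,
      Real.norm_of_nonneg (by linarith [ht.2]), Real.norm_of_nonneg ht.1, Real.norm_of_nonneg hT.le]
    nlinarith [ht.1, ht.2]
  have hC' : ∀ t ∈ Icc (0:ℝ) 1, ∀ φ, ContDiffAt ℝ 1 C (p φ + t • v φ) := by
    intro t ht φ; rw [hpt]; exact hC _ (hnorm t ht φ)
  have hK0 : 0 ≤ K := (norm_nonneg _).trans (hK 0 (by simp [hT.le]))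
  have hmv := mv_bound (f := fun t : ℝ => avg (fun φ => C (p φ + t • v φ) * W φ)) (a := 0) (b := 1)
    (K := 2 * T * K) zero_le_one
    (avg_contOn continuous_const hvc.continuous hWcc zero_le_one hC')
    (fun t ht => avg_hasDerivAt contDiff_const hvc hWc isOpen_Ioo
      (fun t ht φ => hC' t (Ioo_subset_Icc_self ht) φ) ht) ?_
  · have h1 : avg (fun φ => C (p φ + (1:ℝ) • v φ) * W φ) =
        avg (fun φ => C (q + (T * cE φ) • e) * (T * cE φ / (T * cE φ - w))) := by
      congr 1; ext φ; rw [hpt]; simp only [hW, hη]; congr 4; push_cast; ring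
    have h0 : avg (fun φ => C (p φ + (0:ℝ) • v φ) * W φ) = C (q + w • e) := by
      have h2 := geom_kernel_hasSum hw (g := fun _ => (1:ℂ)) continuous_const
      have h3 : HasSum (fun m : ℕ => w ^ m * ((T : ℂ) ^ m)⁻¹ * avg (fun φ => 1 * cE (-(m * φ)))) 1 := by
        have h4 := hasSum_single (f := fun m : ℕ => w ^ m * ((T : ℂ) ^ m)⁻¹ * avg (fun φ => 1 * cE (-(m * φ)))) 0 ?_
        · refine hasSum_congr' h4 (fun _ => rfl) ?_
          simp [cE_zero, avg_const]
        · intro m hm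
          simp only [one_mul]
          rw [avg_cE_neg hm, mul_zero]
      have h5 := h2.unique h3
      simp only [one_mul] at h5
      simp only [zero_smul, add_zero, hp]
      rw [avg_const_mul, h5, mul_one]
    rw [h1, h0, norm_sub_rev] at hmv
    simpa using hmv
  · intro t ht
    have htc := Ioo_subset_Icc_self ht
    set γ : ℝ → V := fun φ => p φ + t • v φ with hγ
    have hγc : Continuous γ := continuous_const.add (hvc.continuous.const_smul t)
    have hCγ : ∀ φ, ContDiffAt ℝ 1 C (γ φ) := hC' t htc
    have hec : Continuous (fun _ : ℝ => e) := continuous_const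
    -- directional derivative in φ
    have hder : ∀ φ, HasDerivAt (fun φ => C (γ φ))
        (t * fderiv ℝ C (γ φ) ((Complex.I * (T * cE φ)) • e)) φ := by
      intro φ
      have h1 : HasDerivAt γ (t • ((T * (Complex.I * cE φ)) • e)) φ := by
        have h2 : HasDerivAt v ((T * (Complex.I * cE φ)) • e) φ :=
          (((cE_hasDerivAt φ).const_mul (T:ℂ)).sub_const w).smul_const e
        exact (h2.const_smul t).const_add (q + w • e)
      have h2 := ((hCγ φ).differentiableAt (by norm_num)).hasFDerivAt.comp_hasDerivAt φ h1
      refine h2.congr_deriv ?_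
      rw [map_smul, Complex.real_smul]
      have : (T * (Complex.I * cE φ)) = (Complex.I * (T * cE φ)) := by ring
      rw [this]
    have hc1 : Continuous (fun φ => fderiv ℝ C (γ φ) ((Complex.I * (T * cE φ)) • e)) :=
      cont_fderiv_comp hγc (by fun_prop) hCγ
    have hz := avg_deriv hder (by fun_prop) (by
      simp only [hγ, hpt, hη, cE_two_pi, cE_zero])
    rw [avg_const_mul] at hz
    have ht0 : (t : ℂ) ≠ 0 := by exact_mod_cast ht.1.ne'
    have hz' := (mul_eq_zero.1 hz).resolve_left ht0
    -- decompose
    have hdec : ∀ φ (a : ℂ), fderiv ℝ C (γ φ) (a • e) =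
        a * (fderiv ℝ C (γ φ) e - dbar C (γ φ) e) + (starRingEnd ℂ) a * dbar C (γ φ) e := by
      intro φ a
      have key : fderiv ℝ C (γ φ) (a • e) =
          a.re * fderiv ℝ C (γ φ) e + a.im * fderiv ℝ C (γ φ) (Complex.I • e) := by
        have : a • e = a.re • e + a.im • (Complex.I • e) := by
          conv_lhs => rw [← Complex.re_add_im a]
          rw [add_smul, mul_smul]; simp
        rw [this, map_add, map_smul, map_smul]; simp
      have h3 : (starRingEnd ℂ) a = a.re - a.im * Complex.I := by
        apply Complex.ext <;> simp
      rw [key, h3, dbar]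
      conv_rhs => rw [← Complex.re_add_im a]
      simp only [Complex.add_re, Complex.ofReal_re, Complex.mul_re, Complex.I_re, mul_zero, Complex.ofReal_im, Complex.I_im, mul_one, sub_self, add_zero, Complex.add_im, Complex.mul_im, zero_add]
      linear_combination ((a.im:ℂ)) * fderiv ℝ C (γ φ) (Complex.I • e) * Complex.I_sq
    have hc2 : Continuous (fun φ => dbar C (γ φ) e) := cont_dbar_comp hγc hec hCγ
    have hc3 : Continuous (fun φ => fderiv ℝ C (γ φ) e) := cont_fderiv_comp hγc hec hCγ
    have hconjc : Continuous (fun z : ℂ => (starRingEnd ℂ) z) := Complex.continuous_conj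
    have heq : avg (fun φ => fderiv ℝ C (γ φ) (v φ) * W φ) =
        avg (fun φ => dbar C (γ φ) e * (T * (starRingEnd ℂ) (cE φ) + (starRingEnd ℂ) (η φ) * W φ)) := by
      have hsub : avg (fun φ => fderiv ℝ C (γ φ) (v φ) * W φ) -
          (-Complex.I) * avg (fun φ => fderiv ℝ C (γ φ) ((Complex.I * (T * cE φ)) • e)) =
        avg (fun φ => dbar C (γ φ) e * (T * (starRingEnd ℂ) (cE φ) + (starRingEnd ℂ) (η φ) * W φ)) := by
        rw [← avg_const_mul, ← avg_sub (by exact (cont_fderiv_comp hγc hvc.continuous hCγ).mul hWcc) (by fun_prop)]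
        congr 1; ext φ
        simp only [hv]
        rw [hdec φ (η φ), hdec φ (Complex.I * (T * cE φ))]
        simp only [map_mul, Complex.conj_I, Complex.conj_ofReal]
        have hWη : η φ * W φ = T * cE φ := by
          simp only [hW]; field_simp [hηne φ]
        linear_combination (fderiv ℝ C (γ φ) e - dbar C (γ φ) e) * hWη +
          ((fderiv ℝ C (γ φ) e - dbar C (γ φ) e) * T * cE φ -
            T * (starRingEnd ℂ) (cE φ) * dbar C (γ φ) e) * Complex.I_sq
      rw [hz', mul_zero, sub_zero] at hsub
      exact hsub
    change ‖avg (fun φ => fderiv ℝ C (γ φ) (v φ) * W φ)‖ ≤ _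
    rw [heq]
    apply norm_avg_le
    intro φ
    rw [norm_mul]
    have h1 : ‖dbar C (γ φ) e‖ ≤ K := by
      simp only [hγ, hpt]; exact hK _ (hnorm t htc φ)
    have h2 : ‖T * (starRingEnd ℂ) (cE φ) + (starRingEnd ℂ) (η φ) * W φ‖ ≤ 2 * T := by
      refine (norm_add_le _ _).trans ?_
      rw [norm_mul, norm_mul, RCLike.norm_conj, RCLike.norm_conj, norm_cE]
      simp only [hW]
      rw [norm_div, norm_mul, norm_cE, Complex.norm_real, Real.norm_of_nonneg hT.le,
        mul_div_cancel₀ _ (norm_ne_zero_iff.2 (hηne φ))]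
      linarith
    calc _ ≤ K * (2 * T) := by gcongr
      _ = 2 * T * K := by ring

end Adisc

section TVsec
variable {V : Type*} [NormedAddCommGroup V] [NormedSpace ℂ V]

lemma logconv {a b t σ : ℝ} (n j : ℕ) (ha : 0 < a) (hat : a ≤ t) (htb : t ≤ b) (hb : b < σ) :
    (t ^ n)⁻¹ * ((σ - t) ^ j)⁻¹ ≤ (a ^ n)⁻¹ * ((σ - a) ^ j)⁻¹ + (b ^ n)⁻¹ * ((σ - b) ^ j)⁻¹ := by
  have hconc : ConcaveOn ℝ (Ioo 0 σ) (fun t => n * Real.log t + j * Real.log (σ - t)) := by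
    have h1 : ConcaveOn ℝ (Ioo 0 σ) (fun t => Real.log t) :=
      strictConcaveOn_log_Ioi.concaveOn.subset (fun x hx => hx.1) (convex_Ioo 0 σ)
    have h2 : ConcaveOn ℝ (Ioo 0 σ) (fun t => Real.log (σ - t)) := by
      refine ⟨convex_Ioo 0 σ, ?_⟩
      intro x hx y hy α β hα hβ hαβ
      have := strictConcaveOn_log_Ioi.concaveOn.2 (x := σ - x) (y := σ - y)
        (by simp; exact hx.2) (by simp; exact hy.2) hα hβ hαβ
      simp only [smul_eq_mul] at this ⊢
      convert this using 2
      linear_combination (1 - α - β) * 0 + (-σ) * hαβ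
    exact (h1.smul (Nat.cast_nonneg n)).add (h2.smul (Nat.cast_nonneg j))
  have ht : 0 < t := ha.trans_le hat
  have hbp : 0 < b := ht.trans_le htb
  have hmin := hconc.min_le_of_mem_Icc (x := a) (y := b) (z := t) ⟨ha, by linarith⟩ ⟨hbp, hb⟩ ⟨hat, htb⟩
  have hexp : ∀ x, 0 < x → x < σ → Real.exp (-(n * Real.log x + j * Real.log (σ - x))) =
      (x ^ n)⁻¹ * ((σ - x) ^ j)⁻¹ := by
    intro x hx hxs
    rw [Real.exp_neg, Real.exp_add, mul_inv, ← Real.log_pow, ← Real.log_pow, Real.exp_log (by positivity),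
      Real.exp_log (pow_pos (by linarith) _)]
  have hpa : 0 < (a ^ n)⁻¹ * ((σ - a) ^ j)⁻¹ := by
    have : 0 < σ - a := by linarith
    positivity
  have hpb : 0 < (b ^ n)⁻¹ * ((σ - b) ^ j)⁻¹ := by
    have : 0 < σ - b := by linarith
    positivity
  rw [← hexp t ht (by linarith)]
  rcases min_le_iff.1 hmin with h | h
  · have := Real.exp_le_exp.2 (neg_le_neg h)
    rw [hexp a ha (by linarith)] at this; linarith
  · have := Real.exp_le_exp.2 (neg_le_neg h)
    rw [hexp b hbp hb] at this; linarith

lemma hasDerivAt_inv_pow (m : ℕ) {t : ℝ} (ht : t ≠ 0) :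
    HasDerivAt (fun t : ℝ => ((t : ℂ) ^ m)⁻¹) (-(m / t) * ((t : ℂ) ^ m)⁻¹) t := by
  have h0 : (t : ℂ) ≠ 0 := by exact_mod_cast ht
  have h1 : HasDerivAt (fun t : ℝ => (t : ℂ)) 1 t := Complex.ofRealCLM.hasDerivAt
  have h2 := (h1.fun_pow m).fun_inv (pow_ne_zero m h0)
  refine h2.congr_deriv ?_
  cases m with
  | zero => simp
  | succ k => simp; field_simp; ring

lemma hasDerivAt_inv_pow_sub (j : ℕ) {t σ : ℝ} (ht : σ - t ≠ 0) :
    HasDerivAt (fun t : ℝ => (((σ - t : ℝ) : ℂ) ^ j)⁻¹) ((j / (σ - t : ℝ)) * (((σ - t : ℝ) : ℂ) ^ j)⁻¹) t := by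
  have h1 : HasDerivAt (fun t : ℝ => σ - t) (-1) t := by
    simpa using (hasDerivAt_id t).const_sub σ
  have h2 := HasDerivAt.scomp t (hasDerivAt_inv_pow j ht) h1
  refine h2.congr_deriv ?_
  simp

def qq (j m : ℕ) : ℝ := ((j + m : ℕ) : ℝ) ^ (j + m) / ((j : ℝ) ^ j * (m : ℝ) ^ m)

lemma qq_pos (j m : ℕ) : 0 < qq j m := by
  have h : ∀ n : ℕ, (0:ℝ) < (n : ℝ) ^ n := by
    intro n
    rcases Nat.eq_zero_or_pos n with rfl | h
    · simp
    · positivity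
  exact div_pos (h _) (mul_pos (h _) (h _))

def theta (j m : ℕ) : ℝ := (m : ℝ) / (m + j)

lemma theta_nonneg (j m : ℕ) : 0 ≤ theta j m := by unfold theta; positivity
lemma theta_le_one (j m : ℕ) : theta j m ≤ 1 := by
  unfold theta
  apply div_le_one_of_le₀ <;> [simp; positivity]

lemma theta_pow (j m : ℕ) (hm : m ≠ 0) {σ : ℝ} (hσ : 0 < σ) :
    ((theta j m * σ) ^ m)⁻¹ * ((σ - theta j m * σ) ^ j)⁻¹ = qq j m * (σ ^ (j + m))⁻¹ := by
  have hm' : (0:ℝ) < m := by exact_mod_cast Nat.pos_of_ne_zero hm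
  have hs : (0:ℝ) < m + j := by positivity
  have h1 : σ - theta j m * σ = (j / (m + j)) * σ := by unfold theta; field_simp; ring
  rw [h1]; unfold theta qq
  have hj : (0:ℝ) < (j:ℝ) ^ j := by
    rcases Nat.eq_zero_or_pos j with rfl | h
    · simp
    · positivity
  rw [mul_pow, mul_pow, div_pow, div_pow]
  push_cast
  rw [pow_add, pow_add]
  field_simp
  rw [add_comm (m:ℝ) j]; ring

structure TVhyp (C : V → ℂ) (p e e' : V) (σ K : ℝ) (j : ℕ) : Prop where
  hσ : 0 < σ
  hC : ∀ w y : ℂ, ‖w‖ + ‖y‖ ≤ σ → ContDiffAt ℝ 1 C (p + w • e + y • e')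
  hK : ∀ w y : ℂ, ‖w‖ + ‖y‖ ≤ σ → ‖dbar C (p + w • e + y • e') e‖ ≤ K
  hK' : ∀ w y : ℂ, ‖w‖ + ‖y‖ ≤ σ → ‖dbar C (p + w • e + y • e') e'‖ ≤ K
  hL : ∀ w y : ℂ, ‖w‖ + ‖y‖ ≤ σ → ‖dbar C (p + w • e + y • e') e - dbar C (p + y • e') e‖ ≤ K * ‖w‖
  hL' : ∀ w y : ℂ, ‖w‖ + ‖y‖ ≤ σ → ‖dbar C (p + w • e + y • e') e' - dbar C (p + y • e') e'‖ ≤ K * ‖w‖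
  hmode : ∀ (w y : ℂ) (ψ : ℝ), C (p + w • e + (cE ψ * y) • e') = cE (j * ψ) * C (p + w • e + y • e')

lemma mode_dir {C : V → ℂ} {Q e' : V} {j : ℕ} {y : ℝ} (hC : ContDiffAt ℝ 1 C (Q + (y : ℂ) • e'))
    (hmode : ∀ ψ : ℝ, C (Q + (cE ψ * y) • e') = cE (j * ψ) * C (Q + (y : ℂ) • e')) :
    y * fderiv ℝ C (Q + (y : ℂ) • e') e' = 2 * y * dbar C (Q + (y : ℂ) • e') e' + j * C (Q + (y : ℂ) • e') := by
  have h1 : HasDerivAt (fun ψ : ℝ => Q + (cE ψ * y) • e') ((Complex.I * cE 0 * y) • e') 0 :=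
    (((cE_hasDerivAt 0).mul_const (y:ℂ)).smul_const e').const_add Q
  have hC' : HasFDerivAt C (fderiv ℝ C (Q + (y : ℂ) • e')) (Q + (cE 0 * y) • e') := by
    rw [cE_zero, one_mul]; exact (hC.differentiableAt (by norm_num)).hasFDerivAt
  have h2 := hC'.comp_hasDerivAt 0 h1
  have h3 : HasDerivAt (fun ψ : ℝ => cE (j * ψ) * C (Q + (y : ℂ) • e'))
      ((j * Complex.I) * C (Q + (y : ℂ) • e')) 0 := by
    have h4 : HasDerivAt (fun φ : ℝ => ((j:ℝ) * φ)) ((j : ℝ) * 1) 0 :=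
      ((hasDerivAt_id' (0:ℝ)).const_mul (j : ℝ))
    have h5 := (HasDerivAt.scomp (0:ℝ) (cE_hasDerivAt (j * 0)) h4).mul_const (C (Q + (y : ℂ) • e'))
    refine h5.congr_deriv ?_
    simp [cE_zero]
  have h6 : (C ∘ fun ψ : ℝ => Q + (cE ψ * y) • e') = (fun ψ : ℝ => cE (j * ψ) * C (Q + (y : ℂ) • e')) := by
    ext ψ; exact hmode ψ
  rw [h6] at h2
  have h7 := h2.unique h3
  have h8 : (Complex.I * cE 0 * y) • e' = y • (Complex.I • e') := by
    rw [cE_zero, mul_one, mul_comm, mul_smul, Complex.coe_smul]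
  rw [h8, map_smul, Complex.real_smul] at h7
  rw [fderiv_eq_dbar (Q + (y : ℂ) • e') e']
  linear_combination (-Complex.I) * h7 - j * C (Q + (y : ℂ) • e') * Complex.I_sq

variable {C : V → ℂ} {p e e' : V} {σ K : ℝ} {j : ℕ}

/-- the m-th mode along the path -/
def gm (C : V → ℂ) (p e e' : V) (σ : ℝ) (j m : ℕ) (t : ℝ) : ℂ :=
  ((t : ℂ) ^ m)⁻¹ * (((σ - t : ℝ) : ℂ) ^ j)⁻¹ *
    avg (fun φ => C (p + (t * cE φ) • e + ((σ - t : ℝ) : ℂ) • e') * cE (-(m * φ)))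

lemma gm_pt (p e e' : V) (σ t φ : ℝ) : p + (t * cE φ) • e + ((σ - t : ℝ) : ℂ) • e' =
    (p + (σ : ℂ) • e') + t • (cE φ • e - e') := by
  rw [mul_smul, Complex.coe_smul, Complex.coe_smul, Complex.coe_smul, sub_smul, smul_sub]; abel

lemma TVhyp.norm_pt {t : ℝ} (ht : t ∈ Icc 0 σ) (φ : ℝ) : ‖(t * cE φ : ℂ)‖ + ‖((σ - t : ℝ) : ℂ)‖ ≤ σ := by
  rw [norm_mul, norm_cE, Complex.norm_real, Complex.norm_real, Real.norm_of_nonneg ht.1,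
    Real.norm_of_nonneg (by linarith [ht.2])]; linarith

lemma TVhyp.contOn (h : TVhyp C p e e' σ K j) (m : ℕ) :
    ContinuousOn (fun t : ℝ => avg (fun φ => C (p + (t * cE φ) • e + ((σ - t : ℝ) : ℂ) • e') * cE (-(m * φ))))
      (Icc 0 σ) := by
  simp only [gm_pt]
  refine avg_contOn (V := V) (by fun_prop) (by fun_prop) (by fun_prop) h.hσ.le ?_
  intro t ht φ
  rw [← gm_pt]; exact h.hC _ _ (TVhyp.norm_pt ht φ)

lemma TVhyp.hasDerivAt (h : TVhyp C p e e' σ K j) (m : ℕ) {t : ℝ} (ht : t ∈ Ioo 0 σ) :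
    HasDerivAt (gm C p e e' σ j m)
      (((t : ℂ) ^ m)⁻¹ * (((σ - t : ℝ) : ℂ) ^ j)⁻¹ *
        avg (fun φ => 2 * (dbar C (p + (t * cE φ) • e + ((σ - t : ℝ) : ℂ) • e') (cE φ • e) -
          dbar C (p + (t * cE φ) • e + ((σ - t : ℝ) : ℂ) • e') e') * cE (-(m * φ)))) t := by
  have htc := Ioo_subset_Icc_self ht
  set y : ℝ := σ - t with hy
  have hy0 : y ≠ 0 := by have := ht.2; simp only [hy]; linarith
  have ht0 : t ≠ 0 := ht.1.ne'
  set γ : ℝ → V := fun φ => p + (t * cE φ) • e + (y : ℂ) • e' with hγ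
  have hCγ : ∀ φ, ContDiffAt ℝ 1 C (γ φ) := fun φ => h.hC _ _ (TVhyp.norm_pt htc φ)
  have hγc : Continuous γ := by fun_prop
  have hwc : Continuous (fun φ : ℝ => cE (-(m * φ))) := by fun_prop
  have hwC : ContDiff ℝ 1 (fun φ : ℝ => cE (-(m * φ))) :=
    cE_contDiff.comp (contDiff_const.mul contDiff_id).neg
  have hvC : ContDiff ℝ 1 (fun φ : ℝ => cE φ • e - e') :=
    (cE_contDiff.smul contDiff_const).sub contDiff_const
  have hG := avg_hasDerivAt (C := C) (p := fun _ => p + (σ : ℂ) • e') (v := fun φ => cE φ • e - e')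
    contDiff_const hvC hwC isOpen_Ioo (U := Ioo 0 σ)
    (fun s hs φ => by rw [← gm_pt]; exact h.hC _ _ (TVhyp.norm_pt (Ioo_subset_Icc_self hs) φ)) ht
  simp only [← gm_pt] at hG
  have hprod := ((hasDerivAt_inv_pow m ht0).mul (hasDerivAt_inv_pow_sub j hy0)).mul hG
  refine hprod.congr_deriv ?_
  simp only [Pi.mul_apply]
  change _ * avg (fun φ => C (γ φ) * cE (-(m * φ))) + _ * avg (fun φ => fderiv ℝ C (γ φ) (cE φ • e - e') * cE (-(m * φ)))
    = _ * avg (fun φ => 2 * (dbar C (γ φ) (cE φ • e) - dbar C (γ φ) e') * cE (-(m * φ)))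
  have hA1 := modeA1 (C := C) (q := p + (y : ℂ) • e') (e := e) (t := t) m (by
    intro φ
    have := hCγ φ
    simp only [hγ] at this
    rwa [add_right_comm] at this)
  have hγ' : ∀ φ, p + (y : ℂ) • e' + (t * cE φ) • e = γ φ := fun φ => by simp only [hγ]; abel
  simp only [hγ'] at hA1
  have hc1 : Continuous (fun φ => fderiv ℝ C (γ φ) (cE φ • e)) := cont_fderiv_comp hγc (by fun_prop) hCγ
  have hc2 : Continuous (fun φ => fderiv ℝ C (γ φ) e') := cont_fderiv_comp hγc (by fun_prop) hCγ
  have hc3 : Continuous (fun φ => dbar C (γ φ) (cE φ • e)) := cont_dbar_comp hγc (by fun_prop) hCγ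
  have hc4 : Continuous (fun φ => dbar C (γ φ) e') := cont_dbar_comp hγc (by fun_prop) hCγ
  have hc5 : Continuous (fun φ => C (γ φ)) := cont_comp hγc hCγ
  have hs1 : avg (fun φ => fderiv ℝ C (γ φ) (cE φ • e - e') * cE (-(m * φ))) =
      avg (fun φ => fderiv ℝ C (γ φ) (cE φ • e) * cE (-(m * φ))) -
      avg (fun φ => fderiv ℝ C (γ φ) e' * cE (-(m * φ))) := by
    rw [← avg_sub (by exact hc1.mul hwc) (by exact hc2.mul hwc)]
    congr 1; ext φ; rw [map_sub]; ring
  have hs2 : avg (fun φ => 2 * (dbar C (γ φ) (cE φ • e) - dbar C (γ φ) e') * cE (-(m * φ))) =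
      avg (fun φ => 2 * dbar C (γ φ) (cE φ • e) * cE (-(m * φ))) -
      2 * avg (fun φ => dbar C (γ φ) e' * cE (-(m * φ))) := by
    rw [← avg_const_mul, ← avg_sub (by exact (continuous_const.mul hc3).mul hwc) (by exact continuous_const.mul (hc4.mul hwc))]
    congr 1; ext φ; ring
  have hs3 : y * avg (fun φ => fderiv ℝ C (γ φ) e' * cE (-(m * φ))) =
      2 * y * avg (fun φ => dbar C (γ φ) e' * cE (-(m * φ))) + j * avg (fun φ => C (γ φ) * cE (-(m * φ))) := by
    rw [← avg_const_mul, ← avg_const_mul, ← avg_const_mul,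
      ← avg_add (by exact continuous_const.mul (hc4.mul hwc)) (by exact continuous_const.mul (hc5.mul hwc))]
    congr 1; ext φ
    have := mode_dir (hCγ φ) (fun ψ => h.hmode _ _ ψ) (j := j)
    linear_combination cE (-(m * φ)) * this
  rw [hs1, hs2]
  have htC : (t : ℂ) ≠ 0 := by exact_mod_cast ht0
  have hyC : (y : ℂ) ≠ 0 := by exact_mod_cast hy0
  set A1 := avg (fun φ => fderiv ℝ C (γ φ) (cE φ • e) * cE (-(m * φ)))
  set A2 := avg (fun φ => fderiv ℝ C (γ φ) e' * cE (-(m * φ)))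
  set A3 := avg (fun φ => 2 * dbar C (γ φ) (cE φ • e) * cE (-(m * φ)))
  set A4 := avg (fun φ => dbar C (γ φ) e' * cE (-(m * φ)))
  set A5 := avg (fun φ => C (γ φ) * cE (-(m * φ)))
  have e1 : A1 = A3 + m / t * A5 := by field_simp; linear_combination hA1
  have e2 : A2 = 2 * A4 + j / y * A5 := by field_simp; linear_combination hs3
  rw [e1, e2]; ring

lemma TVhyp.bound0 (h : TVhyp C p e e' σ K j) (m : ℕ) {t : ℝ} (ht : t ∈ Ioo 0 σ) :
    ‖avg (fun φ => 2 * (dbar C (p + (t * cE φ) • e + ((σ - t : ℝ) : ℂ) • e') (cE φ • e) -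
          dbar C (p + (t * cE φ) • e + ((σ - t : ℝ) : ℂ) • e') e') * cE (-(m * φ)))‖ ≤ 4 * K := by
  apply norm_avg_le
  intro φ
  have hn := TVhyp.norm_pt (Ioo_subset_Icc_self ht) φ
  rw [dbar_smul_dir, norm_mul, norm_cE, mul_one, norm_mul]
  have h1 := h.hK _ _ hn
  have h2 := h.hK' _ _ hn
  have := norm_sub_le ((starRingEnd ℂ) (cE φ) * dbar C (p + (t * cE φ) • e + ((σ - t : ℝ) : ℂ) • e') e)
    (dbar C (p + (t * cE φ) • e + ((σ - t : ℝ) : ℂ) • e') e')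
  rw [norm_mul, RCLike.norm_conj, norm_cE, one_mul] at this
  simp only [Complex.norm_ofNat]
  linarith

lemma TVhyp.boundm (h : TVhyp C p e e' σ K j) {m : ℕ} (hm : m ≠ 0) {t : ℝ} (ht : t ∈ Ioo 0 σ) :
    ‖avg (fun φ => 2 * (dbar C (p + (t * cE φ) • e + ((σ - t : ℝ) : ℂ) • e') (cE φ • e) -
          dbar C (p + (t * cE φ) • e + ((σ - t : ℝ) : ℂ) • e') e') * cE (-(m * φ)))‖ ≤ 4 * K * t := by
  have htc := Ioo_subset_Icc_self ht
  set y : ℝ := σ - t with hy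
  set γ : ℝ → V := fun φ => p + (t * cE φ) • e + (y : ℂ) • e' with hγ
  have hCγ : ∀ φ, ContDiffAt ℝ 1 C (γ φ) := fun φ => h.hC _ _ (TVhyp.norm_pt htc φ)
  have hγc : Continuous γ := by fun_prop
  have hc3 : Continuous (fun φ => dbar C (γ φ) (cE φ • e)) := cont_dbar_comp hγc (by fun_prop) hCγ
  have hc4 : Continuous (fun φ => dbar C (γ φ) e') := cont_dbar_comp hγc (by fun_prop) hCγ
  set d1 := dbar C (p + (y : ℂ) • e') e with hd1
  set d2 := dbar C (p + (y : ℂ) • e') e' with hd2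
  have hz1 : avg (fun φ => 2 * d1 * cE (-((m + 1 : ℕ) * φ))) = 0 := by
    rw [avg_const_mul, avg_cE_neg (Nat.succ_ne_zero m), mul_zero]
  have hz2 : avg (fun φ => 2 * d2 * cE (-(m * φ))) = 0 := by
    rw [avg_const_mul, avg_cE_neg hm, mul_zero]
  have heq : avg (fun φ => 2 * (dbar C (γ φ) (cE φ • e) - dbar C (γ φ) e') * cE (-(m * φ))) =
      avg (fun φ => 2 * (dbar C (γ φ) (cE φ • e) - dbar C (γ φ) e') * cE (-(m * φ)) -
        (2 * d1 * cE (-((m + 1 : ℕ) * φ)) - 2 * d2 * cE (-(m * φ)))) := by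
    rw [avg_sub (f := fun φ => 2 * (dbar C (γ φ) (cE φ • e) - dbar C (γ φ) e') * cE (-(m * φ)))
      (by exact ((continuous_const.mul (hc3.sub hc4)).mul (by fun_prop))) (by fun_prop),
      avg_sub (by fun_prop) (by fun_prop), hz1, hz2]
    simp
  change ‖avg (fun φ => 2 * (dbar C (γ φ) (cE φ • e) - dbar C (γ φ) e') * cE (-(m * φ)))‖ ≤ _
  rw [heq]
  apply norm_avg_le
  intro φ
  have hn := TVhyp.norm_pt htc φ
  have h1 := h.hL _ _ hn
  have h2 := h.hL' _ _ hn
  rw [norm_mul, norm_cE, mul_one, Complex.norm_real, Real.norm_of_nonneg htc.1] at h1 h2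
  have hsp : cE (-((m + 1 : ℕ) * φ)) = cE (-φ) * cE (-(m * φ)) := by
    rw [← cE_add]; congr 1; push_cast; ring
  have hrew : 2 * (dbar C (γ φ) (cE φ • e) - dbar C (γ φ) e') * cE (-(m * φ)) -
        (2 * d1 * cE (-((m + 1 : ℕ) * φ)) - 2 * d2 * cE (-(m * φ))) =
      2 * (cE (-φ) * (dbar C (γ φ) e - d1) - (dbar C (γ φ) e' - d2)) * cE (-(m * φ)) := by
    rw [hsp, dbar_smul_dir, conj_cE]; ring
  rw [hrew, norm_mul, norm_cE, mul_one, norm_mul]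
  have := norm_sub_le (cE (-φ) * (dbar C (γ φ) e - d1)) (dbar C (γ φ) e' - d2)
  rw [norm_mul, norm_cE, one_mul] at this
  simp only [Complex.norm_ofNat]
  have h1' : ‖dbar C (γ φ) e - d1‖ ≤ K * t := h1
  have h2' : ‖dbar C (γ φ) e' - d2‖ ≤ K * t := h2
  linarith

end TVsec

section TVsec2
variable {V : Type*} [NormedAddCommGroup V] [NormedSpace ℂ V]

lemma radial {C : V → ℂ} {Q e' : V} {j : ℕ} {y1 y2 K : ℝ} (h1 : 0 < y1) (h12 : y1 ≤ y2)
    (hC : ∀ y ∈ Icc y1 y2, ContDiffAt ℝ 1 C (Q + (y : ℂ) • e'))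
    (hK : ∀ y ∈ Icc y1 y2, ‖dbar C (Q + (y : ℂ) • e') e'‖ ≤ K)
    (hmode : ∀ (y : ℂ) (ψ : ℝ), C (Q + (cE ψ * y) • e') = cE (j * ψ) * C (Q + y • e')) :
    ‖((y2 : ℂ) ^ j)⁻¹ * C (Q + (y2 : ℂ) • e') - ((y1 : ℂ) ^ j)⁻¹ * C (Q + (y1 : ℂ) • e')‖ ≤
      2 * K * (y1 ^ j)⁻¹ * (y2 - y1) := by
  have hder : ∀ y ∈ Icc y1 y2, HasDerivAt (fun y : ℝ => ((y : ℂ) ^ j)⁻¹ * C (Q + (y : ℂ) • e'))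
      (((y : ℂ) ^ j)⁻¹ * (2 * dbar C (Q + (y : ℂ) • e') e')) y := by
    intro y hy
    have hy0 : y ≠ 0 := (h1.trans_le hy.1).ne'
    have hyc : (y : ℂ) ≠ 0 := by exact_mod_cast hy0
    have ha : HasDerivAt (fun y : ℝ => Q + (y : ℂ) • e') ((1 : ℂ) • e') y :=
      ((Complex.ofRealCLM.hasDerivAt (x := y)).smul_const e').const_add Q
    have hb := ((hC y hy).differentiableAt (by norm_num)).hasFDerivAt.comp_hasDerivAt y ha
    have hc := (hasDerivAt_inv_pow j hy0).mul hb
    refine hc.congr_deriv ?_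
    have hm := mode_dir (hC y hy) (fun ψ => hmode _ ψ) (j := j)
    simp only [Function.comp, one_smul]
    have e1 : fderiv ℝ C (Q + (y : ℂ) • e') e' = 2 * dbar C (Q + (y : ℂ) • e') e' + j / y * C (Q + (y : ℂ) • e') := by
      field_simp; linear_combination hm
    rw [e1]; ring
  refine mv_bound h12 (fun y hy => (hder y hy).continuousAt.continuousWithinAt)
    (fun y hy => hder y (Ioo_subset_Icc_self hy)) ?_
  intro y hy
  have hyc := Ioo_subset_Icc_self hy
  have hy0 : 0 < y := (h1.trans_le hyc.1)
  rw [norm_mul, norm_inv, norm_pow, Complex.norm_real, Real.norm_of_nonneg hy0.le, norm_mul, Complex.norm_ofNat]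
  have h3 : (y ^ j)⁻¹ ≤ (y1 ^ j)⁻¹ := by
    apply inv_anti₀ (by positivity)
    exact pow_le_pow_left₀ h1.le hyc.1 j
  have h4 := hK y hyc
  have hK0 := (norm_nonneg _).trans h4
  have h5 : 0 ≤ (y ^ j)⁻¹ := by positivity
  calc (y ^ j)⁻¹ * (2 * ‖dbar C (Q + (y : ℂ) • e') e'‖) ≤ (y1 ^ j)⁻¹ * (2 * K) := by gcongr
    _ = _ := by ring

variable {C : V → ℂ} {p e e' : V} {σ K : ℝ} {j : ℕ}

/-- the limit coefficient -/
def bm (C : V → ℂ) (p e e' : V) (σ : ℝ) (j m : ℕ) : ℂ :=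
  ((σ : ℂ) ^ (j + m))⁻¹ * (qq j m * avg (fun φ => C (p + ((theta j m * σ : ℝ) * cE φ) • e +
    ((σ - theta j m * σ : ℝ) : ℂ) • e') * cE (-(m * φ))))

lemma gm_theta {m : ℕ} (hm : m ≠ 0) (hσ : 0 < σ) :
    gm C p e e' σ j m (theta j m * σ) = bm C p e e' σ j m := by
  unfold gm bm
  have := theta_pow j m hm hσ
  have h2 : (((theta j m * σ : ℝ) : ℂ) ^ m)⁻¹ * (((σ - theta j m * σ : ℝ) : ℂ) ^ j)⁻¹ =
      qq j m * ((σ : ℂ) ^ (j + m))⁻¹ := by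
    exact_mod_cast congrArg (fun x : ℝ => (x : ℂ)) this
  rw [h2]; ring

lemma TVhyp.K_nonneg (h : TVhyp C p e e' σ K j) : 0 ≤ K :=
  (norm_nonneg _).trans (h.hK 0 0 (by simpa using h.hσ.le))

lemma TVhyp.gm_cont (h : TVhyp C p e e' σ K j) (m : ℕ) {a b : ℝ} (ha : 0 ≤ a) (ham : 0 < a ∨ m = 0)
    (hb : b ≤ σ) (hbj : b < σ ∨ j = 0) : ContinuousOn (gm C p e e' σ j m) (Icc a b) := by
  unfold gm
  have h1 : ContinuousOn (fun t : ℝ => ((t : ℂ) ^ m)⁻¹) (Icc a b) := by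
    rcases ham with ha' | rfl
    · apply ContinuousOn.inv₀ (by fun_prop)
      intro t ht
      have : t ≠ 0 := (ha'.trans_le ht.1).ne'
      exact pow_ne_zero _ (by exact_mod_cast this)
    · simp only [pow_zero]; fun_prop
  have h2 : ContinuousOn (fun t : ℝ => (((σ - t : ℝ) : ℂ) ^ j)⁻¹) (Icc a b) := by
    rcases hbj with hb' | rfl
    · apply ContinuousOn.inv₀ (by fun_prop)
      intro t ht
      have : σ - t ≠ 0 := by have := ht.2; intro h; linarith
      exact pow_ne_zero _ (by exact_mod_cast this)
    · simp only [pow_zero]; fun_prop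
  exact (h1.mul h2).mul ((h.contOn m).mono (Icc_subset_Icc ha hb))

lemma TVhyp.diff0 (h : TVhyp C p e e' σ K j) {T : ℝ} (hT : 0 ≤ T) (hTσ : T < σ) :
    ‖gm C p e e' σ j 0 T - ((σ : ℂ) ^ j)⁻¹ * C (p + (σ : ℂ) • e')‖ ≤ 4 * K * T * ((σ - T) ^ j)⁻¹ := by
  have hK := h.K_nonneg
  have h0 : gm C p e e' σ j 0 0 = ((σ : ℂ) ^ j)⁻¹ * C (p + (σ : ℂ) • e') := by
    simp [gm, cE_zero, avg_const]
  have := mv_bound hT (h.gm_cont 0 le_rfl (Or.inr rfl) hTσ.le (Or.inl hTσ) (a := 0) (b := T))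
    (fun t ht => h.hasDerivAt 0 ⟨ht.1, ht.2.trans hTσ⟩) (K := ((σ - T) ^ j)⁻¹ * (4 * K)) ?_
  · rw [h0, sub_zero] at this
    refine this.trans (le_of_eq (by ring))
  · intro t ht
    have hb := h.bound0 0 ⟨ht.1, ht.2.trans hTσ⟩
    rw [norm_mul]
    have h1 : 0 < σ - T := by linarith
    have h2 : σ - T ≤ σ - t := by linarith [ht.2]
    have h3 : ((σ - t) ^ j)⁻¹ ≤ ((σ - T) ^ j)⁻¹ :=
      inv_anti₀ (by positivity) (pow_le_pow_left₀ h1.le h2 j)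
    rw [norm_mul, norm_inv, norm_inv, norm_pow, norm_pow, Complex.norm_real, Complex.norm_real, pow_zero, inv_one, one_mul,
      Real.norm_of_nonneg (h1.le.trans h2)]
    gcongr

lemma TVhyp.diffm (h : TVhyp C p e e' σ K j) {m : ℕ} (hm : m ≠ 0) {T : ℝ} (hT : 0 < T) (hTσ : T < σ) :
    ‖gm C p e e' σ j m T - bm C p e e' σ j m‖ ≤
      4 * K * σ * ((T ^ (m - 1))⁻¹ * ((σ - T) ^ j)⁻¹ + qq j m * σ * (σ ^ (j + m))⁻¹) := by
  have hK := h.K_nonneg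
  have hσ := h.hσ
  rw [← gm_theta hm hσ]
  set s := theta j m * σ with hs
  have hm' : (0:ℝ) < m := by exact_mod_cast Nat.pos_of_ne_zero hm
  have hth : 0 < theta j m := by unfold theta; positivity
  have hs0 : 0 < s := by positivity
  have hsσ : s ≤ σ := by have := theta_le_one j m; nlinarith
  have hsj : s < σ ∨ j = 0 := by
    rcases Nat.eq_zero_or_pos j with h0 | h0
    · exact Or.inr h0
    · left
      have : theta j m < 1 := by
        unfold theta; rw [div_lt_one (by positivity)]
        have : (0:ℝ) < j := by exact_mod_cast h0
        linarith
      nlinarith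
  set E := (T ^ (m - 1))⁻¹ * ((σ - T) ^ j)⁻¹ + qq j m * σ * (σ ^ (j + m))⁻¹ with hE
  have hTj : 0 < (T ^ (m - 1))⁻¹ * ((σ - T) ^ j)⁻¹ := by
    have : 0 < σ - T := by linarith
    positivity
  have hqp : 0 < qq j m * σ * (σ ^ (j + m))⁻¹ := by have := qq_pos j m; positivity
  have hEs : (s ^ (m-1))⁻¹ * ((σ - s) ^ j)⁻¹ ≤ qq j m * σ * (σ ^ (j + m))⁻¹ := by
    have h1 := theta_pow j m hm hσ
    rw [← hs] at h1
    have h2 : (s ^ (m-1))⁻¹ = s * (s ^ m)⁻¹ := by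
      obtain ⟨k, rfl⟩ := Nat.exists_eq_succ_of_ne_zero hm
      simp only [Nat.succ_eq_add_one, Nat.add_sub_cancel, pow_succ]; field_simp
    rw [h2, mul_assoc, h1]
    have := qq_pos j m
    calc s * (qq j m * (σ ^ (j+m))⁻¹) ≤ σ * (qq j m * (σ ^ (j+m))⁻¹) := by gcongr
      _ = _ := by ring
  -- pointwise bound
  have hpt : ∀ a b : ℝ, (a = T ∧ b = s ∨ a = s ∧ b = T) → a ≤ b → ∀ t ∈ Ioo a b,
      (t ^ (m-1))⁻¹ * ((σ - t) ^ j)⁻¹ ≤ E := by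
    intro a b hab hle t ht
    have ha : 0 < a := by rcases hab with ⟨rfl, -⟩ | ⟨rfl, -⟩ <;> assumption
    rcases hsj with hlt | rfl
    · have hb : b < σ := by rcases hab with ⟨-, rfl⟩ | ⟨-, rfl⟩ <;> assumption
      have := logconv (m-1) j ha ht.1.le ht.2.le hb
      rcases hab with ⟨rfl, rfl⟩ | ⟨rfl, rfl⟩ <;> simp only [hE] <;> linarith
    · have hs1 : s = σ := by
        simp only [hs, theta]; simp; field_simp
      rcases hab with ⟨hA, hB⟩ | ⟨hA, hB⟩
      · rw [hA] at ht
        have : (t ^ (m-1))⁻¹ ≤ (T ^ (m-1))⁻¹ := inv_anti₀ (by positivity) (pow_le_pow_left₀ hT.le ht.1.le _)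
        simp only [pow_zero, inv_one, mul_one] at *
        linarith
      · exfalso; linarith
  have key : ∀ a b : ℝ, (a = T ∧ b = s ∨ a = s ∧ b = T) → a ≤ b →
      ‖gm C p e e' σ j m b - gm C p e e' σ j m a‖ ≤ 4 * K * σ * E := by
    intro a b hab hle
    have ha : 0 < a := by rcases hab with ⟨rfl, -⟩ | ⟨rfl, -⟩ <;> assumption
    have hb : b ≤ σ := by rcases hab with ⟨-, rfl⟩ | ⟨-, rfl⟩ <;> [exact hsσ; exact hTσ.le]
    have hbj : b < σ ∨ j = 0 := by rcases hab with ⟨-, rfl⟩ | ⟨-, rfl⟩ <;> [exact hsj; exact Or.inl hTσ]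
    have := mv_bound hle (h.gm_cont m ha.le (Or.inl ha) hb hbj)
      (fun t ht => h.hasDerivAt m ⟨ha.trans ht.1, ht.2.trans_le hb⟩) (K := 4 * K * E) ?_
    · refine this.trans ?_
      have h1 : b - a ≤ σ := by linarith
      have hE0 : 0 < E := by positivity
      calc 4 * K * E * (b - a) ≤ 4 * K * E * σ := by gcongr
        _ = _ := by ring
    · intro t ht
      have hb := h.boundm hm ⟨ha.trans ht.1, ht.2.trans_le hb⟩
      have ht0 : 0 < t := ha.trans ht.1
      have ht1 : 0 < σ - t := by linarith [ht.2]
      rw [norm_mul]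
      rw [norm_mul, norm_inv, norm_inv, norm_pow, norm_pow, Complex.norm_real, Complex.norm_real,
        Real.norm_of_nonneg ht0.le, Real.norm_of_nonneg ht1.le]
      have h2 : (t ^ (m-1))⁻¹ = t * (t ^ m)⁻¹ := by
        obtain ⟨k, rfl⟩ := Nat.exists_eq_succ_of_ne_zero hm
        simp only [Nat.succ_eq_add_one, Nat.add_sub_cancel, pow_succ]; field_simp
      have h3 := hpt a b hab hle t ht
      rw [h2] at h3
      calc _ ≤ (t ^ m)⁻¹ * ((σ - t) ^ j)⁻¹ * (4 * K * t) := by gcongr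
        _ = 4 * K * (t * (t ^ m)⁻¹ * ((σ - t) ^ j)⁻¹) := by ring
        _ ≤ _ := by gcongr
  rcases le_total T s with hle | hle
  · rw [norm_sub_rev]; exact key T s (Or.inl ⟨rfl, rfl⟩) hle
  · exact key s T (Or.inr ⟨rfl, rfl⟩) hle

lemma gm_norm_le (m : ℕ) {T M : ℝ} (hT : 0 < T) (hTσ : T < σ)
    (hM : ∀ w y : ℂ, ‖w‖ + ‖y‖ ≤ σ → ‖C (p + w • e + y • e')‖ ≤ M) :
    ‖gm C p e e' σ j m T‖ ≤ (T ^ m)⁻¹ * ((σ - T) ^ j)⁻¹ * M := by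
  unfold gm
  have h1 : 0 < σ - T := by linarith
  rw [norm_mul, norm_mul, norm_inv, norm_inv, norm_pow, norm_pow, Complex.norm_real, Complex.norm_real,
        Real.norm_of_nonneg hT.le, Real.norm_of_nonneg h1.le]
  gcongr
  apply norm_avg_le
  intro φ
  rw [norm_mul, norm_cE, mul_one]
  exact hM _ _ (TVhyp.norm_pt ⟨hT.le, hTσ.le⟩ φ)

lemma TVhyp.sum (h : TVhyp C p e e' σ K j) {T : ℝ} {w : ℂ} (hw : ‖w‖ < T) (hTσ : T < σ) :
    ∃ S, HasSum (fun m : ℕ => w ^ m * gm C p e e' σ j m T) S ∧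
      ‖(((σ - ‖w‖ : ℝ) : ℂ) ^ j)⁻¹ * C (p + w • e + ((σ - ‖w‖ : ℝ) : ℂ) • e') - S‖ ≤
        4 * K * T * ((σ - T) ^ j)⁻¹ := by
  have hK := h.K_nonneg
  have hT : 0 < T := (norm_nonneg w).trans_lt hw
  have h1 : 0 < σ - T := by linarith
  have hnm : ‖((σ - T : ℝ) : ℂ)‖ = σ - T := by rw [Complex.norm_real, Real.norm_of_nonneg h1.le]
  set q := p + ((σ - T : ℝ) : ℂ) • e' with hq
  have hg : Continuous (fun φ : ℝ => C (q + (T * cE φ) • e)) := by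
    refine cont_comp (γ := fun φ : ℝ => q + (T * cE φ) • e) (by fun_prop) ?_
    intro φ
    rw [hq, add_right_comm]; exact h.hC _ _ (TVhyp.norm_pt ⟨hT.le, hTσ.le⟩ φ)
  have hs := (geom_kernel_hasSum hw hg).mul_left ((((σ - T : ℝ) : ℂ) ^ j)⁻¹)
  set S0 := avg (fun φ => C (q + (T * cE φ) • e) * (T * cE φ / (T * cE φ - w))) with hS0
  refine ⟨_, hasSum_congr' hs ?_ rfl, ?_⟩
  · intro m
    unfold gm
    have : ∀ φ : ℝ, p + (T * cE φ) • e + ((σ - T : ℝ) : ℂ) • e' = q + (T * cE φ) • e := fun φ => by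
      rw [hq]; abel
    simp only [this]; ring
  · have hA := discA2 (C := C) (q := q) (e := e) (K := K) hw
      (fun ζ hζ => by
        rw [hq, add_right_comm]; exact h.hC _ _ (by rw [hnm]; linarith))
      (fun ζ hζ => by
        rw [hq, add_right_comm]; exact h.hK _ _ (by rw [hnm]; linarith))
    have hB := radial (C := C) (Q := p + w • e) (e' := e') (j := j) (y1 := σ - T) (y2 := σ - ‖w‖) (K := K) h1 (by linarith)
      (fun y hy => h.hC _ _ (by
        rw [Complex.norm_real, Real.norm_of_nonneg (h1.le.trans hy.1)]; linarith [hy.2]))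
      (fun y hy => h.hK' _ _ (by
        rw [Complex.norm_real, Real.norm_of_nonneg (h1.le.trans hy.1)]; linarith [hy.2]))
      (fun y ψ => h.hmode w y ψ)
    have hqw : q + w • e = p + w • e + ((σ - T : ℝ) : ℂ) • e' := by rw [hq]; abel
    rw [← hqw] at hB
    have hsplit : (((σ - ‖w‖ : ℝ) : ℂ) ^ j)⁻¹ * C (p + w • e + ((σ - ‖w‖ : ℝ) : ℂ) • e') -
        (((σ - T : ℝ) : ℂ) ^ j)⁻¹ * S0 =
        ((((σ - ‖w‖ : ℝ) : ℂ) ^ j)⁻¹ * C (p + w • e + ((σ - ‖w‖ : ℝ) : ℂ) • e') -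
        (((σ - T : ℝ) : ℂ) ^ j)⁻¹ * C (q + w • e)) +
        (((σ - T : ℝ) : ℂ) ^ j)⁻¹ * (C (q + w • e) - S0) := by ring
    rw [hsplit]
    refine (norm_add_le _ _).trans ?_
    rw [norm_mul, norm_inv, norm_pow, hnm]
    have hw0 := norm_nonneg w
    have hp : 0 < ((σ - T) ^ j)⁻¹ := by positivity
    calc _ ≤ 2 * K * ((σ - T) ^ j)⁻¹ * (σ - ‖w‖ - (σ - T)) + ((σ - T) ^ j)⁻¹ * (2 * T * K) := by gcongr
      _ ≤ 2 * K * ((σ - T) ^ j)⁻¹ * T + ((σ - T) ^ j)⁻¹ * (2 * T * K) := by gcongr; linarith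
      _ = _ := by ring

end TVsec2

section Reg
variable {V : Type*} [NormedAddCommGroup V] [NormedSpace ℂ V]

/-- the (1,0) part -/
def del (u : V → ℂ) (z ξ : V) : ℂ :=
  (fderiv ℝ u z ξ - Complex.I * fderiv ℝ u z (Complex.I • ξ)) / 2

lemma fderiv_eq_del_add (u : V → ℂ) (z ξ : V) : fderiv ℝ u z ξ = del u z ξ + dbar u z ξ := by
  unfold del dbar; ring

lemma fderiv_cE (u : V → ℂ) (z ξ : V) (φ : ℝ) :
    fderiv ℝ u z (cE φ • ξ) = cE φ * del u z ξ + cE (-φ) * dbar u z ξ := by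
  rw [fderiv_eq_del_add, dbar_smul_dir, conj_cE]
  congr 1
  have h1 := fderiv_eq_del_add u z (cE φ • ξ)
  rw [dbar_smul_dir, conj_cE] at h1
  have h2 : cE φ • ξ = (cE φ).re • ξ + (cE φ).im • (Complex.I • ξ) := by
    conv_lhs => rw [← Complex.re_add_im (cE φ)]
    rw [add_smul, mul_smul]; simp
  have h3 : fderiv ℝ u z (cE φ • ξ) = (cE φ).re * fderiv ℝ u z ξ + (cE φ).im * fderiv ℝ u z (Complex.I • ξ) := by
    rw [h2, map_add, map_smul, map_smul]; simp
  have h4 : cE (-φ) = (cE φ).re - (cE φ).im * Complex.I := by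
    rw [← conj_cE]
    apply Complex.ext <;> simp
  have h5 : cE φ = (cE φ).re + (cE φ).im * Complex.I := (Complex.re_add_im _).symm
  have h6 : del u z (cE φ • ξ) = fderiv ℝ u z (cE φ • ξ) - cE (-φ) * dbar u z ξ := by rw [h1]; ring
  rw [h6, h3, h4]
  conv_rhs => rw [h5]
  unfold del dbar
  linear_combination ((cE φ).im * fderiv ℝ u z (Complex.I • ξ)) * (Complex.I_sq)

/-- interior estimate for the (1,0) part -/
lemma del_bound {u : V → ℂ} {z ξ : V} {ε S0 L : ℝ} (hε : 0 < ε)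
    (hC : ∀ c : ℂ, ‖c‖ ≤ ε → ContDiffAt ℝ 1 u (z + c • ξ))
    (h0 : ∀ c : ℂ, ‖c‖ ≤ ε → ‖u (z + c • ξ)‖ ≤ S0)
    (hL : ∀ c : ℂ, ‖c‖ ≤ ε → ‖dbar u (z + c • ξ) ξ - dbar u z ξ‖ ≤ L * ‖c‖) :
    ‖del u z ξ‖ ≤ S0 / ε + 2 * L * ε := by
  have hn : ∀ t ∈ Icc 0 ε, ∀ φ : ℝ, ‖(t * cE φ : ℂ)‖ ≤ ε := by
    intro t ht φ
    rw [norm_mul, norm_cE, Complex.norm_real, Real.norm_of_nonneg ht.1, mul_one]; exact ht.2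
  have hpt : ∀ t φ : ℝ, z + (t * cE φ) • ξ = z + t • (cE φ • ξ) := by
    intro t φ; rw [mul_smul, Complex.coe_smul]
  have hw1 : Continuous (fun φ : ℝ => cE (-((1:ℕ) * φ))) := by fun_prop
  set G : ℝ → ℂ := fun t => avg (fun φ => u (z + t • (cE φ • ξ)) * cE (-((1:ℕ) * φ))) with hG
  set G' : ℝ → ℂ := fun t => avg (fun φ => fderiv ℝ u (z + t • (cE φ • ξ)) (cE φ • ξ) * cE (-((1:ℕ) * φ))) with hG'
  have hder : ∀ t ∈ {t : ℝ | ∀ φ : ℝ, True} ∩ Ioo (-ε) ε, HasDerivAt G (G' t) t := by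
    intro t ht
    refine avg_hasDerivAt (C := u) (p := fun _ => z) (v := fun φ => cE φ • ξ) contDiff_const
      (cE_contDiff.smul contDiff_const) ?_ (U := Ioo (-ε) ε) isOpen_Ioo ?_ ht.2
    · exact cE_contDiff.comp (contDiff_const.mul contDiff_id).neg
    · intro t ht φ
      rw [← hpt]; apply hC
      rw [norm_mul, norm_cE, mul_one, Complex.norm_real]
      exact abs_le.2 ⟨ht.1.le, ht.2.le⟩
  have hG0 : G 0 = 0 := by
    simp only [hG, zero_smul, add_zero]
    rw [avg_const_mul, avg_cE_neg one_ne_zero, mul_zero]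
  have hG'0 : G' 0 = del u z ξ := by
    simp only [hG', zero_smul, add_zero]
    have : ∀ φ : ℝ, fderiv ℝ u z (cE φ • ξ) * cE (-((1:ℕ) * φ)) = del u z ξ + dbar u z ξ * cE (-((2:ℕ) * φ)) := by
      intro φ
      rw [fderiv_cE]
      have h1 : cE (-((2:ℕ) * φ)) = cE (-φ) * cE (-φ) := by rw [← cE_add]; congr 1; push_cast; ring
      have h2 : cE (-((1:ℕ) * φ)) = cE (-φ) := by congr 1; push_cast; ring
      rw [h1, h2]
      linear_combination del u z ξ * cE_mul_neg φ
    simp only [this]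
    rw [avg_add (by fun_prop) (by fun_prop), avg_const, avg_const_mul, avg_cE_neg two_ne_zero]; simp
  -- g(t) = G t / t
  set g : ℝ → ℂ := fun t => (t : ℂ)⁻¹ * G t with hg
  have hlim : Tendsto g (𝓝[>] 0) (𝓝 (del u z ξ)) := by
    have h1 := hder 0 ⟨fun _ => trivial, by simp [hε]⟩
    rw [hG'0] at h1
    have h2 := h1.tendsto_slope_zero_right
    simp only [zero_add, hG0, sub_zero] at h2
    refine h2.congr ?_
    intro t
    simp only [hg]
    rw [← Complex.ofReal_inv, Complex.real_smul]
  have hgder : ∀ t ∈ Ioo 0 ε, HasDerivAt g ((t : ℂ)⁻¹ * avg (fun φ => 2 * dbar u (z + (t * cE φ) • ξ) (cE φ • ξ) * cE (-((1:ℕ) * φ)))) t := by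
    intro t ht
    have h1 := hder t ⟨fun _ => trivial, by linarith [ht.1], ht.2⟩
    have h2 := (hasDerivAt_inv_pow 1 ht.1.ne').mul h1
    simp only [pow_one] at h2
    refine h2.congr_deriv ?_
    have hA1 := modeA1 (C := u) (q := z) (e := ξ) (t := t) 1 (fun φ => hC _ (hn t (Ioo_subset_Icc_self ht) φ))
    simp only [hpt] at hA1 ⊢
    have htc : (t : ℂ) ≠ 0 := by exact_mod_cast ht.1.ne'
    simp only [hG, hG']
    field_simp
    linear_combination hA1
  have hgb : ∀ t ∈ Ioo 0 ε, ‖((t : ℂ)⁻¹ * avg (fun φ => 2 * dbar u (z + (t * cE φ) • ξ) (cE φ • ξ) * cE (-((1:ℕ) * φ))))‖ ≤ 2 * L := by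
    intro t ht
    have heq : avg (fun φ => 2 * dbar u (z + (t * cE φ) • ξ) (cE φ • ξ) * cE (-((1:ℕ) * φ))) =
        avg (fun φ => 2 * (dbar u (z + (t * cE φ) • ξ) ξ - dbar u z ξ) * cE (-((2:ℕ) * φ))) := by
      have hc : Continuous (fun φ : ℝ => dbar u (z + (t * cE φ) • ξ) ξ) :=
        cont_dbar_comp (γ := fun φ : ℝ => z + (t * cE φ) • ξ) (v := fun _ => ξ) (by fun_prop) (by fun_prop)
          (fun φ => hC _ (hn t (Ioo_subset_Icc_self ht) φ))
      have hw2 : Continuous (fun φ : ℝ => cE (-((2:ℕ) * φ))) := by fun_prop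
      have h1 : ∀ φ : ℝ, 2 * dbar u (z + (t * cE φ) • ξ) (cE φ • ξ) * cE (-((1:ℕ) * φ)) =
          2 * (dbar u (z + (t * cE φ) • ξ) ξ - dbar u z ξ) * cE (-((2:ℕ) * φ)) + 2 * dbar u z ξ * cE (-((2:ℕ) * φ)) := by
        intro φ
        have h1 : cE (-((2:ℕ) * φ)) = cE (-φ) * cE (-φ) := by rw [← cE_add]; congr 1; push_cast; ring
        have h2 : cE (-((1:ℕ) * φ)) = cE (-φ) := by congr 1; push_cast; ring
        rw [h1, h2, dbar_smul_dir, conj_cE]; ring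
      simp only [h1]
      rw [avg_add (by exact (continuous_const.mul (hc.sub continuous_const)).mul hw2) (by fun_prop),
        avg_const_mul (2 * dbar u z ξ), avg_cE_neg two_ne_zero]; simp
    rw [heq, norm_mul, norm_inv, Complex.norm_real, Real.norm_of_nonneg ht.1.le]
    have h2 : ‖avg (fun φ => 2 * (dbar u (z + (t * cE φ) • ξ) ξ - dbar u z ξ) * cE (-((2:ℕ) * φ)))‖ ≤ 2 * L * t := by
      apply norm_avg_le
      intro φ
      have := hL _ (hn t (Ioo_subset_Icc_self ht) φ)
      rw [norm_mul (t : ℂ), norm_cE, Complex.norm_real, Real.norm_of_nonneg ht.1.le, mul_one] at this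
      rw [norm_mul, norm_cE, mul_one, norm_mul, Complex.norm_ofNat]; linarith
    have ht0 := ht.1
    calc t⁻¹ * _ ≤ t⁻¹ * (2 * L * t) := by gcongr
      _ = 2 * L := by field_simp
  have hgc : ContinuousOn g (Ioc 0 ε) := by
    have h1 : ContinuousOn G (Icc 0 ε) :=
      avg_contOn (C := u) (p := fun _ => z) (v := fun φ => cE φ • ξ) (by fun_prop) (by fun_prop) (by fun_prop) hε.le
        (fun t ht φ => by rw [← hpt]; exact hC _ (hn t ht φ))
    refine ContinuousOn.mul (ContinuousOn.inv₀ (by fun_prop) ?_) (h1.mono Ioc_subset_Icc_self)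
    intro t ht; exact_mod_cast ht.1.ne'
  have hfin : ∀ t ∈ Ioo 0 ε, ‖g t‖ ≤ S0 / ε + 2 * L * ε := by
    intro t ht
    have h1 := mv_bound ht.2.le (hgc.mono (fun s hs => ⟨ht.1.trans_le hs.1, hs.2⟩))
      (fun s hs => hgder s ⟨ht.1.trans hs.1, hs.2⟩) (fun s hs => hgb s ⟨ht.1.trans hs.1, hs.2⟩)
    have h2 : ‖g ε‖ ≤ S0 / ε := by
      simp only [hg]
      rw [norm_mul, norm_inv, Complex.norm_real, Real.norm_of_nonneg hε.le, div_eq_inv_mul]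
      gcongr
      apply norm_avg_le
      intro φ
      rw [norm_mul, norm_cE, mul_one, ← hpt]
      exact h0 _ (hn ε ⟨hε.le, le_rfl⟩ φ)
    have hL0 : 0 ≤ L := by
      have := (norm_nonneg _).trans (hgb t ht); linarith
    have h3 : ‖g t‖ ≤ ‖g ε‖ + ‖g ε - g t‖ := by
      have := norm_sub_le (g ε) (g ε - g t); simpa using this
    have h4 : 2 * L * (ε - t) ≤ 2 * L * ε := by have := ht.1; gcongr; linarith
    linarith
  refine le_of_tendsto hlim.norm ?_
  filter_upwards [Ioo_mem_nhdsGT hε] with t ht using hfin t ht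

structure LB (u : V → ℂ) (z0 : V) (r A : ℝ) : Prop where
  c1 : ∀ z ∈ Metric.ball z0 r, ContDiffAt ℝ 1 u z
  b0 : ∀ z ∈ Metric.ball z0 r, ‖u z‖ ≤ A
  b1 : ∀ z ∈ Metric.ball z0 r, ∀ ξ, ‖dbar u z ξ‖ ≤ A * ‖ξ‖
  b2 : ∀ z ∈ Metric.ball z0 r, ∀ z' ∈ Metric.ball z0 r, ∀ ξ, ‖dbar u z ξ - dbar u z' ξ‖ ≤ A * ‖z - z'‖ * ‖ξ‖

lemma LB.fderiv_bound {u : V → ℂ} {z0 : V} {r A : ℝ} (h : LB u z0 r A) (hr : 0 < r) (hA : 0 ≤ A) :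
    ∀ z ∈ Metric.ball z0 (r/2), ‖fderiv ℝ u z‖ ≤ A + (A / (r/4) + 2 * A * (r/4)) := by
  intro z hz
  rw [Metric.mem_ball, dist_eq_norm] at hz
  apply ContinuousLinearMap.opNorm_le_of_unit_norm (by positivity)
  intro ξ hξ
  have hmem : ∀ c : ℂ, ‖c‖ ≤ r/4 → z + c • ξ ∈ Metric.ball z0 r := by
    intro c hc
    rw [Metric.mem_ball, dist_eq_norm]
    have : z + c • ξ - z0 = (z - z0) + c • ξ := by abel
    rw [this]
    have := norm_add_le (z - z0) (c • ξ)
    rw [norm_smul, hξ, mul_one] at this; linarith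
  have hz' : z ∈ Metric.ball z0 r := by rw [Metric.mem_ball, dist_eq_norm]; linarith
  have h1 := del_bound (u := u) (z := z) (ξ := ξ) (ε := r/4) (S0 := A) (L := A) (by positivity)
    (fun c hc => h.c1 _ (hmem c hc)) (fun c hc => h.b0 _ (hmem c hc))
    (fun c hc => by
      have := h.b2 _ (hmem c hc) _ hz' ξ
      simpa [norm_smul, hξ] using this)
  have h2 := h.b1 z hz' ξ
  rw [hξ, mul_one] at h2
  rw [fderiv_eq_del_add]
  exact (norm_add_le _ _).trans (by linarith)

lemma LB.holder {z0 : V} {r A : ℝ} (hr : 0 < r) (hA : 0 ≤ A) : ∃ K : ℝ, 0 ≤ K ∧ ∀ u : V → ℂ, LB u z0 r A →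
    (∀ z ∈ Metric.ball z0 (r/2), ‖fderiv ℝ u z‖ ≤ K) ∧
    ∀ ε : ℝ, 0 < ε → ε ≤ r/8 → ∀ z ∈ Metric.ball z0 (r/8), ∀ z' ∈ Metric.ball z0 (r/8), ‖z - z'‖ ≤ ε^2 →
      ‖fderiv ℝ u z - fderiv ℝ u z'‖ ≤ K * ε := by
  set C1 := A + (A / (r/4) + 2 * A * (r/4)) with hC1
  have hC10 : 0 ≤ C1 := by positivity
  refine ⟨C1 + 4 * A + A * r, by positivity, fun u h => ⟨fun z hz => (h.fderiv_bound hr hA z hz).trans (by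
    have : 0 ≤ A * r := by positivity
    linarith), ?_⟩⟩
  intro ε hε hεr z hz z' hz' hzz
  rw [Metric.mem_ball, dist_eq_norm] at hz hz'
  set w := z' - z with hw
  have hwn : ‖w‖ ≤ ε^2 := by rw [hw, norm_sub_rev]; exact hzz
  have hwr : ‖w‖ < r/4 := by
    have : w = (z' - z0) - (z - z0) := by rw [hw]; abel
    rw [this]; have := norm_sub_le (z' - z0) (z - z0); linarith
  have hball : ∀ y ∈ Metric.ball z0 (r/4), y ∈ Metric.ball z0 (r/2) ∧ y + w ∈ Metric.ball z0 (r/2) ∧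
      y ∈ Metric.ball z0 r ∧ y + w ∈ Metric.ball z0 r := by
    intro y hy
    simp only [Metric.mem_ball, dist_eq_norm] at hy ⊢
    have h1 : y + w - z0 = (y - z0) + w := by abel
    have h2 := norm_add_le (y - z0) w
    rw [h1]; refine ⟨?_, ?_, ?_, ?_⟩ <;> linarith
  set δ : V → ℂ := fun y => u y - u (y + w) with hδ
  have hcu : ∀ y ∈ Metric.ball z0 (r/4), ContDiffAt ℝ 1 (fun y => u (y + w)) y := by
    intro y hy
    exact ContDiffAt.comp (g := u) y (h.c1 _ (hball y hy).2.2.2) (by fun_prop)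
  have hdb : ∀ y ∈ Metric.ball z0 (r/4), ∀ ξ, dbar δ y ξ = dbar u y ξ - dbar u (y + w) ξ := by
    intro y hy ξ
    have e1 := dbar_sub ((h.c1 _ (hball y hy).2.2.1).differentiableAt (by norm_num))
      ((hcu y hy).differentiableAt (by norm_num)) ξ
    rw [e1]
    have e2 := dbar_comp (u := u) (z := y) (ContinuousLinearMap.id ℂ V) w
      (by exact ((h.c1 _ (hball y hy).2.2.2).differentiableAt (by norm_num))) ξ
    simp only [ContinuousLinearMap.id_apply] at e2
    rw [e2]
  have hfd : ∀ y ∈ Metric.ball z0 (r/4), fderiv ℝ δ y = fderiv ℝ u y - fderiv ℝ u (y + w) := by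
    intro y hy
    have e1 : HasFDerivAt δ (fderiv ℝ u y - fderiv ℝ u (y + w)) y := by
      refine HasFDerivAt.fun_sub ((h.c1 _ (hball y hy).2.2.1).differentiableAt (by norm_num)).hasFDerivAt ?_
      have := ((h.c1 _ (hball y hy).2.2.2).differentiableAt (by norm_num)).hasFDerivAt
      have e0 : HasFDerivAt (fun y : V => y + w) (ContinuousLinearMap.id ℝ V) y := (hasFDerivAt_id y).add_const w
      exact HasFDerivAt.comp (g := u) (f := fun y => y + w) y this e0
    exact e1.fderiv
  have hδ0 : ∀ y ∈ Metric.ball z0 (r/4), ‖δ y‖ ≤ C1 * ε^2 := by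
    intro y hy
    have := (convex_ball z0 (r/2)).norm_image_sub_le_of_norm_fderiv_le (𝕜 := ℝ) (f := u)
      (fun x hx => (h.c1 x (Metric.ball_subset_ball (by linarith) hx)).differentiableAt (by norm_num))
      (fun x hx => h.fderiv_bound hr hA x hx) (hball y hy).2.1 (hball y hy).1
    refine this.trans ?_
    have e : ‖y - (y + w)‖ = ‖w‖ := by simp
    rw [e]; gcongr
  have hzb : z ∈ Metric.ball z0 (r/4) := by rw [Metric.mem_ball, dist_eq_norm]; linarith
  have hzz' : fderiv ℝ u z - fderiv ℝ u z' = fderiv ℝ δ z := by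
    rw [hfd z hzb, hw]; congr 2; abel
  rw [hzz']
  apply ContinuousLinearMap.opNorm_le_of_unit_norm (by positivity)
  intro ξ hξ
  have hmem : ∀ c : ℂ, ‖c‖ ≤ ε → z + c • ξ ∈ Metric.ball z0 (r/4) := by
    intro c hc
    rw [Metric.mem_ball, dist_eq_norm]
    have : z + c • ξ - z0 = (z - z0) + c • ξ := by abel
    rw [this]
    have := norm_add_le (z - z0) (c • ξ)
    rw [norm_smul, hξ, mul_one] at this; linarith
  have h1 := del_bound (u := δ) (z := z) (ξ := ξ) (ε := ε) (S0 := C1 * ε^2) (L := 2 * A) hε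
    (fun c hc => (h.c1 _ (hball _ (hmem c hc)).2.2.1).sub (hcu _ (hmem c hc))) (fun c hc => hδ0 _ (hmem c hc))
    (fun c hc => by
      rw [hdb _ (hmem c hc), hdb _ hzb]
      have e1 := h.b2 _ (hball _ (hmem c hc)).2.2.1 _ (hball _ hzb).2.2.1 ξ
      have e2 := h.b2 _ (hball _ (hmem c hc)).2.2.2 _ (hball _ hzb).2.2.2 ξ
      have e3 : z + c • ξ + w - (z + w) = c • ξ := by abel
      rw [e3, norm_smul, hξ] at e2
      rw [add_sub_cancel_left, norm_smul, hξ] at e1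
      have e4 : dbar u (z + c • ξ) ξ - dbar u (z + c • ξ + w) ξ - (dbar u z ξ - dbar u (z + w) ξ) =
        (dbar u (z + c • ξ) ξ - dbar u z ξ) - (dbar u (z + c • ξ + w) ξ - dbar u (z + w) ξ) := by ring
      rw [e4]; refine (norm_sub_le _ _).trans ?_
      linarith)
  have h2 : ‖dbar δ z ξ‖ ≤ A * ε^2 := by
    rw [hdb z hzb]
    refine (h.b2 _ (hball z hzb).2.2.1 _ (hball z hzb).2.2.2 ξ).trans ?_
    have e : ‖z - (z + w)‖ = ‖w‖ := by simp
    rw [e, hξ, mul_one]; gcongr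
  rw [fderiv_eq_del_add]
  refine (norm_add_le _ _).trans ?_
  have e1 : C1 * ε^2 / ε = C1 * ε := by field_simp
  rw [e1] at h1
  have e2 : A * ε^2 ≤ A * r * ε := by
    have : ε ≤ r := by linarith
    calc A * ε^2 = A * ε * ε := by ring
      _ ≤ A * r * ε := by gcongr
  linarith

end Reg

section LLsec
variable {V : Type*} [NormedAddCommGroup V] [NormedSpace ℂ V]

lemma ultra_lim {ι : Type*} (l : Ultrafilter ι) {a : ι → ℂ} {K : ℝ} (h : ∀ᶠ n in (l : Filter ι), ‖a n‖ ≤ K) :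
    ∃ b, Tendsto a l (𝓝 b) := by
  have h1 : ((l.map a : Ultrafilter ℂ) : Filter ℂ) ≤ 𝓟 (Metric.closedBall 0 K) := by
    rw [le_principal_iff]
    change a ⁻¹' _ ∈ (l : Filter ι)
    filter_upwards [h] with n hn
    simpa using hn
  obtain ⟨b, -, hb⟩ := (isCompact_closedBall (0:ℂ) K).ultrafilter_le_nhds _ h1
  exact ⟨b, hb⟩

lemma LL {ι : Type*} (l0 : Filter ι) [hl0 : l0.NeBot] {un : ι → V → ℂ} {u : V → ℂ} {f : V → V → ℂ} {z0 : V}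
    {r A : ℝ} (hr : 0 < r) (hA : 0 ≤ A) (hb : ∀ᶠ n in l0, LB (un n) z0 r A)
    (hu : ∀ z ∈ Metric.ball z0 r, Tendsto (fun n => un n z) l0 (𝓝 (u z)))
    (hf : ∀ ξ, Tendsto (fun n => dbar (un n) z0 ξ) l0 (𝓝 (f z0 ξ))) :
    ContDiffAt ℝ 1 u z0 ∧ ∀ ξ, dbar u z0 ξ = f z0 ξ := by
  set l := Ultrafilter.of l0
  have hl : (l : Filter ι) ≤ l0 := Ultrafilter.of_le l0
  obtain ⟨K, hK0, hK⟩ := LB.holder (z0 := z0) hr hA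
  have hev : ∀ᶠ n in (l : Filter ι), LB (un n) z0 r A := hl hb
  have hlim : ∀ z ∈ Metric.ball z0 (r/8), ∃ D : V →L[ℝ] ℂ, ∀ ξ,
      Tendsto (fun n => fderiv ℝ (un n) z ξ) l (𝓝 (D ξ)) := by
    intro z hz
    have hbd : ∀ᶠ n in (l : Filter ι), ‖fderiv ℝ (un n) z‖ ≤ K := by
      filter_upwards [hev] with n hn
      exact (hK _ hn).1 z (Metric.ball_subset_ball (by linarith) hz)
    have hbd' : ∀ ξ, ∀ᶠ n in (l : Filter ι), ‖fderiv ℝ (un n) z ξ‖ ≤ K * ‖ξ‖ := by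
      intro ξ
      filter_upwards [hbd] with n hn
      exact (ContinuousLinearMap.le_opNorm _ _).trans (by gcongr)
    choose D hD using fun ξ => ultra_lim l (hbd' ξ)
    let L : V →ₗ[ℝ] ℂ :=
      { toFun := D
        map_add' := fun x y => by
          refine tendsto_nhds_unique (hD (x + y)) ?_
          refine ((hD x).add (hD y)).congr (fun n => by rw [map_add])
        map_smul' := fun c x => by
          refine tendsto_nhds_unique (hD (c • x)) ?_
          refine ((hD x).const_smul c).congr (fun n => by rw [map_smul]) }
    refine ⟨L.mkContinuous K (fun x => le_of_tendsto (hD x).norm (hbd' x)), hD⟩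
  choose! D hD using hlim
  have hhold : ∀ ε : ℝ, 0 < ε → ε ≤ r/8 → ∀ z ∈ Metric.ball z0 (r/8), ∀ z' ∈ Metric.ball z0 (r/8), ‖z - z'‖ ≤ ε^2 →
      ‖D z - D z'‖ ≤ K * ε := by
    intro ε hε hεr z hz z' hz' hzz
    refine ContinuousLinearMap.opNorm_le_bound _ (by positivity) ?_
    intro ξ
    refine le_of_tendsto (((hD z hz ξ).sub (hD z' hz' ξ)).norm) ?_
    filter_upwards [hev] with n hn
    have := (hK _ hn).2 ε hε hεr z hz z' hz' hzz
    calc _ = ‖(fderiv ℝ (un n) z - fderiv ℝ (un n) z') ξ‖ := by simp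
      _ ≤ _ := (ContinuousLinearMap.le_opNorm _ _).trans (by gcongr)
  have hder : ∀ z ∈ Metric.ball z0 (r/8), HasFDerivAt u (D z) z := by
    intro z hz
    rw [hasFDerivAt_iff_isLittleO_nhds_zero, Asymptotics.isLittleO_iff]
    intro c hc
    have hrc : 0 < r/8 := by positivity
    set ε := min (r/8) (c / (K + 1)) with hε
    have hε0 : 0 < ε := lt_min hrc (by positivity)
    have hKc : K * ε ≤ c := by
      have h1 : ε ≤ c / (K+1) := min_le_right _ _
      calc K * ε ≤ (K + 1) * (c / (K + 1)) := by gcongr; linarith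
        _ = c := by field_simp
    have hmem : ∀ᶠ h in 𝓝 (0 : V), z + h ∈ Metric.ball z0 (r/8) := by
      have : ContinuousAt (fun h : V => z + h) 0 := by fun_prop
      apply this.eventually_mem
      rw [add_zero]; exact Metric.isOpen_ball.mem_nhds hz
    have hsm : ∀ᶠ h in 𝓝 (0 : V), ‖h‖ < ε^2 := by
      have : ContinuousAt (fun h : V => ‖h‖) 0 := by fun_prop
      apply this.eventually_lt continuousAt_const
      simp; positivity
    filter_upwards [hmem, hsm] with h hh1 hh2
    refine (le_of_tendsto (f := fun n => ‖un n (z + h) - un n z - fderiv ℝ (un n) z h‖) (x := (l : Filter ι)) (b := K * ε * ‖h‖) ?_ ?_).trans (by gcongr)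
    · have hsub : Metric.ball z0 (r/8) ⊆ Metric.ball z0 r := Metric.ball_subset_ball (by linarith)
      exact ((((hu _ (hsub hh1)).mono_left hl).sub ((hu _ (hsub hz)).mono_left hl)).sub (hD z hz h)).norm
    · filter_upwards [hev] with n hn
      have hconv : Convex ℝ (Metric.ball z0 (r/8) ∩ Metric.ball z (ε^2)) := (convex_ball _ _).inter (convex_ball _ _)
      have hsub : Metric.ball z0 (r/8) ⊆ Metric.ball z0 r := Metric.ball_subset_ball (by linarith)
      have := Convex.norm_image_sub_le_of_norm_fderiv_le' (𝕜 := ℝ) (f := un n) (φ := fderiv ℝ (un n) z) (C := K * ε) (x := z) (y := z + h)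
        (fun x hx => (hn.c1 x (hsub hx.1)).differentiableAt (by norm_num))
        (fun x hx => (hK _ hn).2 ε hε0 (min_le_left _ _) x hx.1 z hz (by
          have := hx.2; rw [Metric.mem_ball, dist_eq_norm] at this; exact this.le)) hconv
        ⟨hz, by simp; positivity⟩ ⟨hh1, by simp [Metric.mem_ball, dist_eq_norm]; exact hh2⟩
      simpa using this
  have hz0 : z0 ∈ Metric.ball z0 (r/8) := Metric.mem_ball_self (by positivity)
  refine ⟨contDiffAt_one_iff.2 ⟨D, Metric.ball z0 (r/8), Metric.isOpen_ball.mem_nhds hz0, ?_, hder⟩, ?_⟩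
  · intro z hz
    apply ContinuousAt.continuousWithinAt
    rw [Metric.continuousAt_iff']
    intro c hc
    set ε := min (r/8) (c / (2 * (K + 1))) with hε
    have hε0 : 0 < ε := lt_min (by positivity) (by positivity)
    have hKc : K * ε < c := by
      have h1 : ε ≤ c / (2 * (K+1)) := min_le_right _ _
      calc K * ε ≤ (K + 1) * (c / (2 * (K + 1))) := by gcongr; linarith
        _ = c / 2 := by field_simp
        _ < c := by linarith
    filter_upwards [Metric.isOpen_ball.mem_nhds hz, Metric.ball_mem_nhds z (show 0 < ε^2 by positivity)] with y hy1 hy2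
    rw [dist_eq_norm]
    rw [Metric.mem_ball, dist_eq_norm] at hy2
    exact (hhold ε hε0 (min_le_left _ _) y hy1 z hz hy2.le).trans_lt hKc
  · intro ξ
    rw [dbar_eq_of_hasFDerivAt (hder z0 hz0)]
    refine tendsto_nhds_unique ?_ ((hf ξ).mono_left hl)
    exact ((hD z0 hz0 ξ).add ((hD z0 hz0 (Complex.I • ξ)).const_mul _)).div_const _

lemma LLultra {ι : Type*} (l : Ultrafilter ι) {un : ι → V → ℂ} {f : V → V → ℂ} {Ω : Set V} (hΩ : IsOpen Ω)
    (hb : ∀ z0 ∈ Ω, ∃ r A : ℝ, 0 < r ∧ ∀ᶠ n in (l : Filter ι), LB (un n) z0 r A)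
    (hf : ∀ z ∈ Ω, ∀ ξ, Tendsto (fun n => dbar (un n) z ξ) l (𝓝 (f z ξ))) :
    ∃ u : V → ℂ, ∀ z ∈ Ω, ContDiffAt ℝ 1 u z ∧ ∀ ξ, dbar u z ξ = f z ξ := by
  have h1 : ∀ z ∈ Ω, ∃ b, Tendsto (fun n => un n z) l (𝓝 b) := by
    intro z hz
    obtain ⟨r, A, hr, hev⟩ := hb z hz
    refine ultra_lim l (K := A) ?_
    filter_upwards [hev] with n hn
    exact hn.b0 z (Metric.mem_ball_self hr)
  choose! u hu using h1
  refine ⟨u, fun z hz => ?_⟩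
  obtain ⟨r, A, hr, hev⟩ := hb z hz
  obtain ⟨r', hr', hsub⟩ := Metric.isOpen_iff.1 hΩ z hz
  have hm : Metric.ball z (min r r') ⊆ Metric.ball z r := Metric.ball_subset_ball (min_le_left _ _)
  obtain ⟨n, hn⟩ := hev.exists
  have hA : 0 ≤ A := (norm_nonneg _).trans (hn.b0 z (Metric.mem_ball_self hr))
  refine LL (l : Filter ι) (un := un) (u := u) (f := f) (z0 := z) (r := min r r') (A := A) (lt_min hr hr') hA ?_ ?_ (hf z hz)
  · filter_upwards [hev] with n hn
    exact ⟨fun z hz => hn.c1 z (hm hz), fun z hz => hn.b0 z (hm hz), fun z hz => hn.b1 z (hm hz),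
      fun z hz z' hz' => hn.b2 z (hm hz) z' (hm hz')⟩
  · intro y hy
    exact hu y (hsub (Metric.ball_subset_ball (min_le_right _ _) hy))

end LLsec

section Comb

def DD (j : ℕ) : ℝ := (j.factorial : ℝ) * Real.exp 1 ^ j / (j : ℝ) ^ j

lemma self_pow_pos (n : ℕ) : (0:ℝ) < (n : ℝ) ^ n := by
  rcases Nat.eq_zero_or_pos n with rfl | h
  · simp
  · positivity

lemma one_le_DD (j : ℕ) : 1 ≤ DD j := by
  unfold DD
  rw [le_div_iff₀ (self_pow_pos j), one_mul]
  have h := Real.pow_div_factorial_le_exp (j : ℝ) (Nat.cast_nonneg j) j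
  rw [div_le_iff₀ (by positivity)] at h
  have h2 : Real.exp 1 ^ j = Real.exp j := by rw [← Real.exp_nat_mul, mul_one]
  rw [h2]; linarith

lemma DD_le (m : ℕ) (hm : m ≠ 0) : DD m ≤ Real.exp 1 * m := by
  induction m with
  | zero => exact absurd rfl hm
  | succ k ih =>
    rcases Nat.eq_zero_or_pos k with rfl | hk
    · simp [DD]
    have ih := ih hk.ne'
    have hk' : (0:ℝ) < k := by exact_mod_cast hk
    have hkp := self_pow_pos k
    have h1 : DD (k+1) = DD k * (Real.exp 1 * ((k:ℝ) ^ k / (k+1) ^ k)) := by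
      unfold DD
      rw [Nat.factorial_succ]; push_cast
      rw [pow_succ, pow_succ]
      field_simp
    have h2 : (k / (k+1) : ℝ) ^ (k+1) ≤ (Real.exp 1)⁻¹ := by
      have e1 : (k / (k+1) : ℝ) ≤ Real.exp (-(1/(k+1))) := by
        have := Real.add_one_le_exp (-(1/((k:ℝ)+1)))
        refine le_trans (le_of_eq ?_) this
        field_simp; ring
      have e2 := pow_le_pow_left₀ (by positivity) e1 (k+1)
      refine e2.trans (le_of_eq ?_)
      rw [← Real.exp_nat_mul, ← Real.exp_neg]; congr 1; push_cast; field_simp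
    have h3 : Real.exp 1 * ((k:ℝ) ^ k / (k+1) ^ k) ≤ (k+1)/k := by
      have e3 : ((k:ℝ) ^ k / (k+1) ^ k) = (k / (k+1) : ℝ) ^ (k+1) * ((k+1)/k) := by
        rw [div_pow, pow_succ, pow_succ]; field_simp
      rw [e3]
      calc Real.exp 1 * ((k / (k+1) : ℝ) ^ (k+1) * ((k+1)/k)) ≤ Real.exp 1 * ((Real.exp 1)⁻¹ * ((k+1)/k)) := by gcongr
        _ = _ := by field_simp
    rw [h1]
    calc _ ≤ (Real.exp 1 * k) * ((k+1)/k) := by gcongr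
      _ = _ := by push_cast; field_simp

lemma qq_DD (j m : ℕ) : qq j m * DD (j + m) = DD j * ((m + j).choose j) * DD m := by
  unfold qq DD
  have h : (((m+j).choose j : ℕ) : ℝ) = ((j+m).factorial : ℝ) / (j.factorial * m.factorial) := by
    rw [add_comm m j, Nat.cast_add_choose]
  rw [h]
  have h1 := self_pow_pos j
  have h2 := self_pow_pos m
  have h3 := self_pow_pos (j+m)
  have h4 : (0:ℝ) < j.factorial := by positivity
  have h5 : (0:ℝ) < m.factorial := by positivity
  rw [pow_add (Real.exp 1)]
  field_simp

lemma qq_zero (j : ℕ) : qq j 0 = 1 := by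
  unfold qq
  have := self_pow_pos j
  simp only [add_zero, pow_zero, mul_one]
  exact div_self this.ne'

lemma theta_zero (j : ℕ) : theta j 0 = 0 := by simp [theta]

lemma negbinom (j : ℕ) {y l : ℝ} (hy : 0 ≤ y) (hl : y < l) :
    HasSum (fun m : ℕ => ((m + j).choose j : ℝ) * y ^ m * (l ^ (j + m + 1))⁻¹) (((l - y) ^ (j + 1))⁻¹) := by
  have hl0 : 0 < l := hy.trans_lt hl
  have hn : ‖y / l‖ < 1 := by
    rw [Real.norm_of_nonneg (by positivity), div_lt_one hl0]; exact hl
  have h := (hasSum_choose_mul_geometric_of_norm_lt_one j hn).mul_left ((l ^ (j+1))⁻¹)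
  have h1 : (l ^ (j+1))⁻¹ * (1 / (1 - y / l) ^ (j+1)) = ((l - y) ^ (j + 1))⁻¹ := by
    have : 1 - y / l = (l - y) / l := by field_simp
    have h2 : 0 < l - y := by linarith
    rw [this, div_pow]; field_simp
  rw [h1] at h
  have h2 : (fun m : ℕ => ((m + j).choose j : ℝ) * y ^ m * (l ^ (j + m + 1))⁻¹) =
      fun i => (l ^ (j+1))⁻¹ * (((i + j).choose j : ℝ) * (y / l) ^ i) := by
    ext m
    have : l ^ (j + m + 1) = l ^ (j+1) * l ^ m := by rw [← pow_add]; congr 1; ring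
    rw [this, div_pow]; field_simp
  rw [h2]; exact h

end Comb

structure Coord (V : Type*) [NormedAddCommGroup V] [NormedSpace ℂ V] where
  e : ℕ → V
  x : ℕ → V →L[ℂ] ℂ
  x_e : ∀ i k, x i (e k) = if i = k then 1 else 0
  norm_e : ∀ i, ‖e i‖ ≤ 1
  sum_le : ∀ N z, ∑ i ∈ Finset.range N, ‖x i z‖ ≤ ‖z‖

namespace Coord
variable {V : Type*} [NormedAddCommGroup V] [NormedSpace ℂ V] (X : Coord V)

def pr (N : ℕ) : V →L[ℂ] V := ∑ i ∈ Finset.range N, (X.x i).smulRight (X.e i)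

lemma pr_apply (N : ℕ) (z : V) : X.pr N z = ∑ i ∈ Finset.range N, X.x i z • X.e i := by
  simp [pr]

def nrm (N : ℕ) (z : V) : ℝ := ∑ i ∈ Finset.range N, ‖X.x i z‖

lemma nrm_nonneg (N : ℕ) (z : V) : 0 ≤ X.nrm N z := Finset.sum_nonneg (fun _ _ => norm_nonneg _)
lemma nrm_le (N : ℕ) (z : V) : X.nrm N z ≤ ‖z‖ := X.sum_le N z
lemma nrm_succ (N : ℕ) (z : V) : X.nrm (N+1) z = X.nrm N z + ‖X.x N z‖ := by
  simp [nrm, Finset.sum_range_succ]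
lemma nrm_zero (z : V) : X.nrm 0 z = 0 := by simp [nrm]
lemma pr_zero (z : V) : X.pr 0 z = 0 := by simp [pr]
lemma pr_succ (N : ℕ) (z : V) : X.pr (N+1) z = X.pr N z + X.x N z • X.e N := by
  rw [pr_apply, pr_apply, Finset.sum_range_succ]
lemma norm_pr_le (N : ℕ) (z : V) : ‖X.pr N z‖ ≤ X.nrm N z := by
  rw [pr_apply, nrm]
  refine (norm_sum_le _ _).trans (Finset.sum_le_sum fun i _ => ?_)
  rw [norm_smul]
  have := X.norm_e i
  nlinarith [norm_nonneg (X.x i z)]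
lemma x_pr (N i : ℕ) (z : V) : X.x i (X.pr N z) = if i < N then X.x i z else 0 := by
  rw [pr_apply, map_sum]
  simp only [map_smul, X.x_e, smul_eq_mul, mul_ite, mul_one, mul_zero]
  rw [Finset.sum_ite_eq]
  simp
lemma pr_pr (N M : ℕ) (h : N ≤ M) (z : V) : X.pr N (X.pr M z) = X.pr N z := by
  rw [pr_apply X N z, pr_apply X N (X.pr M z)]
  refine Finset.sum_congr rfl (fun i hi => ?_)
  rw [x_pr, if_pos ((Finset.mem_range.1 hi).trans_le h)]
lemma pr_pr' (N M : ℕ) (h : N ≤ M) (z : V) : X.pr M (X.pr N z) = X.pr N z := by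
  have h1 : ∑ i ∈ Finset.range N, X.x i (X.pr N z) • X.e i = ∑ i ∈ Finset.range M, X.x i (X.pr N z) • X.e i := by
    refine Finset.sum_subset ?_ ?_
    · intro i hi
      rw [Finset.mem_range] at hi ⊢; omega
    intro i _ hi
    rw [x_pr, if_neg (by simpa using hi), zero_smul]
  have h2 : ∑ i ∈ Finset.range N, X.x i (X.pr N z) • X.e i = X.pr N z := by
    conv_rhs => rw [pr_apply]
    refine Finset.sum_congr rfl (fun i hi => ?_)
    rw [x_pr, if_pos (Finset.mem_range.1 hi)]
  rw [pr_apply X M, ← h1, h2]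
lemma pr_e (N i : ℕ) : X.pr N (X.e i) = if i < N then X.e i else 0 := by
  rw [pr_apply]
  simp only [X.x_e, ite_smul, one_smul, zero_smul]
  rw [Finset.sum_ite_eq']
  simp
lemma nrm_pr (N : ℕ) (z : V) : X.nrm N (X.pr N z) = X.nrm N z := by
  unfold nrm
  refine Finset.sum_congr rfl (fun i hi => ?_)
  rw [x_pr, if_pos (Finset.mem_range.1 hi)]
lemma continuous_nrm (N : ℕ) : Continuous (X.nrm N) := by
  unfold nrm; fun_prop

lemma norm_pt (N : ℕ) (z : V) (w : ℂ) : ‖X.pr N z + w • X.e N‖ ≤ X.nrm N z + ‖w‖ := by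
  refine (norm_add_le _ _).trans ?_
  rw [norm_smul]
  have := X.norm_e N
  have := X.norm_pr_le N z
  nlinarith [norm_nonneg w]

lemma norm_pt2 (N : ℕ) (z : V) (w y : ℂ) : ‖X.pr N z + w • X.e N + y • X.e (N+1)‖ ≤ X.nrm N z + (‖w‖ + ‖y‖) := by
  refine (norm_add_le _ _).trans ?_
  rw [norm_smul]
  have := X.norm_e (N+1)
  have := X.norm_pt N z w
  nlinarith [norm_nonneg y]

/-- weighted norm -/
def Lw (γ : ℕ → ℝ) (N : ℕ) (z : V) : ℝ := ∑ i ∈ Finset.range N, γ i * ‖X.x i z‖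

lemma Lw_zero (γ : ℕ → ℝ) (z : V) : X.Lw γ 0 z = 0 := by simp [Lw]
lemma Lw_succ (γ : ℕ → ℝ) (N : ℕ) (z : V) : X.Lw γ (N+1) z = X.Lw γ N z + γ N * ‖X.x N z‖ := by
  simp [Lw, Finset.sum_range_succ]
lemma continuous_Lw (γ : ℕ → ℝ) (N : ℕ) : Continuous (X.Lw γ N) := by
  unfold Lw; fun_prop
lemma nrm_le_Lw {γ : ℕ → ℝ} (hγ : ∀ i, 1 ≤ γ i) (N : ℕ) (z : V) : X.nrm N z ≤ X.Lw γ N z := by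
  refine Finset.sum_le_sum fun i _ => ?_
  have := hγ i
  nlinarith [norm_nonneg (X.x i z)]

def aN (G : ℕ → ℝ) (β c : ℝ) : ℕ → V → ℝ
  | 0, _ => β
  | N+1, z => G N * aN G β c N z + c * ‖X.x N z‖

lemma continuous_aN (G : ℕ → ℝ) (β c : ℝ) (N : ℕ) : Continuous (X.aN G β c N) := by
  induction N with
  | zero => exact continuous_const
  | succ N ih => exact (continuous_const.mul ih).add (continuous_const.mul (X.x N).continuous.norm)

lemma le_aN {G : ℕ → ℝ} {β c : ℝ} (hG : ∀ i, 1 ≤ G i) (hβ : 0 ≤ β) (hc : 0 ≤ c) (N : ℕ) (z : V) :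
    β ≤ X.aN G β c N z := by
  induction N with
  | zero => exact le_rfl
  | succ N ih =>
    have h1 := hG N
    have h2 : 0 ≤ c * ‖X.x N z‖ := by positivity
    simp only [aN]
    nlinarith

end Coord

structure Par where
  r : ℝ
  s : ℝ
  A : ℝ → ℝ
  bs : ℕ → ℝ
  hs : 0 < s
  hsr : s < r
  hA : ∀ t, 0 ≤ A t
  hbs : ∀ j, 0 < bs j
  hbs' : ∀ j, bs j ≤ s

section ClassCsec
variable {V : Type*} [NormedAddCommGroup V] [NormedSpace ℂ V] (X : Coord V) (P : Par)

structure ClassC (N j : ℕ) (κ : ℝ) (C : V → ℂ) : Prop where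
  hκ : 0 ≤ κ
  c1 : ∀ z, ‖z‖ < P.r → ContDiffAt ℝ 1 C z
  bM : ∃ M, ∀ z, ‖z‖ < P.r → ‖C z‖ ≤ M
  b1 : ∀ ρ < P.r, ∀ z, ‖z‖ ≤ ρ → ∀ ξ, ‖dbar C z ξ‖ ≤ κ * P.A ρ * ‖ξ‖
  b2 : ∀ ρ < P.r, ∀ z, ‖z‖ ≤ ρ → ∀ z', ‖z'‖ ≤ ρ → ∀ ξ, ‖dbar C z ξ - dbar C z' ξ‖ ≤ κ * P.A ρ * ‖z - z'‖ * ‖ξ‖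
  mode : ∀ p (a : ℂ) (ψ : ℝ), C (X.pr N p + (cE ψ * a) • X.e N) = cE (j * ψ) * C (X.pr N p + a • X.e N)

/-- the linear map used for averaging -/
def lmap (N : ℕ) (θ φ : ℝ) : V →L[ℂ] V :=
  X.pr N + (X.x N).smulRight ((θ * cE φ) • X.e N + ((1 - θ : ℝ) : ℂ) • X.e (N+1))

lemma lmap_apply (N : ℕ) (θ φ : ℝ) (z : V) : lmap X N θ φ z = X.pr N z + (X.x N z * (θ * cE φ)) • X.e N +
    (X.x N z * ((1 - θ : ℝ) : ℂ)) • X.e (N+1) := by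
  simp only [lmap, ContinuousLinearMap.add_apply, ContinuousLinearMap.smulRight_apply, smul_add, smul_smul]
  rw [add_assoc]

lemma norm_lmap_le (N : ℕ) {θ : ℝ} (h0 : 0 ≤ θ) (h1 : θ ≤ 1) (φ : ℝ) (z : V) : ‖lmap X N θ φ z‖ ≤ ‖z‖ := by
  rw [lmap_apply]
  refine (X.norm_pt2 N z _ _).trans ?_
  refine le_trans (le_of_eq ?_) (X.nrm_le (N+1) z)
  rw [X.nrm_succ, norm_mul, norm_mul, norm_mul, norm_cE, Complex.norm_real, Complex.norm_real,
    Real.norm_of_nonneg h0, Real.norm_of_nonneg (by linarith : 0 ≤ 1 - θ)]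
  ring

def Cm (N j m : ℕ) (C : V → ℂ) (z : V) : ℂ :=
  qq j m * avg (fun φ => C (lmap X N (theta j m) φ z) * cE (-(m * φ)))

lemma lmap_contDiff (N : ℕ) (θ : ℝ) : ContDiff ℝ 1 (fun q : V × ℝ => lmap X N θ q.2 q.1) := by
  simp only [lmap_apply]
  have h1 : ContDiff ℝ 1 (fun q : V × ℝ => X.pr N q.1) :=
    ((X.pr N).restrictScalars ℝ).contDiff.comp contDiff_fst
  have h2 : ContDiff ℝ 1 (fun q : V × ℝ => X.x N q.1) :=
    ((X.x N).restrictScalars ℝ).contDiff.comp contDiff_fst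
  have h3 : ContDiff ℝ 1 (fun q : V × ℝ => cE q.2) := cE_contDiff.comp contDiff_snd
  exact (h1.add ((h2.mul (contDiff_const.mul h3)).smul contDiff_const)).add ((h2.mul contDiff_const).smul contDiff_const)

lemma lmap_cont (N : ℕ) (θ : ℝ) (z : V) : Continuous (fun φ : ℝ => lmap X N θ φ z) := by
  have hc : Continuous cE := cE_contDiff.continuous
  simp only [lmap_apply]
  exact (continuous_const.add ((continuous_const.mul (continuous_const.mul hc)).smul continuous_const)).add continuous_const

variable {X P}

set_option maxHeartbeats 1000000 in
lemma Cm_class {N j : ℕ} {κ : ℝ} {C : V → ℂ} (h : ClassC X P (N+1) j κ C) (m : ℕ) :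
    ClassC X P N (j + m) (κ * qq j m) (Cm X N j m C) := by
  have hq := qq_pos j m
  have hκ := h.hκ
  set θ := theta j m with hθ
  have hθ0 := theta_nonneg j m
  have hθ1 := theta_le_one j m
  rw [← hθ] at hθ0 hθ1
  have hln : ∀ φ z, ‖lmap X N θ φ z‖ ≤ ‖z‖ := fun φ z => norm_lmap_le X N hθ0 hθ1 φ z
  have hH : ∀ z ∈ Metric.ball (0:V) P.r, ∀ φ : ℝ, ContDiffAt ℝ 1
      (fun q : V × ℝ => C (lmap X N θ q.2 q.1) * cE (-(m * q.2))) (z, φ) := by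
    intro z hz φ
    have hz' : ‖z‖ < P.r := by simpa using hz
    refine ContDiffAt.mul ?_ ?_
    · exact ContDiffAt.comp (g := C) (f := fun q : V × ℝ => lmap X N θ q.2 q.1) (z, φ)
        (h.c1 _ ((hln φ z).trans_lt hz')) (lmap_contDiff X N θ).contDiffAt
    · exact (cE_contDiff.comp (contDiff_const.mul contDiff_snd).neg).contDiffAt
  have hball : ∀ z : V, ‖z‖ < P.r → z ∈ Metric.ball (0:V) P.r := fun z hz => by simpa using hz
  have hc1 : ∀ z, ‖z‖ < P.r → ContDiffAt ℝ 1 (Cm X N j m C) z := by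
    intro z hz
    have := (P_main Metric.isOpen_ball (H := fun z φ => C (lmap X N θ φ z) * cE (-(m * φ))) hH 0 (2 * Real.pi) (hball z hz)).1
    unfold Cm avg
    exact contDiffAt_const.mul (contDiffAt_const.mul this)
  have hdb : ∀ z, ‖z‖ < P.r → ∀ ξ, dbar (Cm X N j m C) z ξ =
      qq j m * avg (fun φ => dbar C (lmap X N θ φ z) (lmap X N θ φ ξ) * cE (-(m * φ))) := by
    intro z hz ξ
    have h1 := P_dbar Metric.isOpen_ball (H := fun z φ => C (lmap X N θ φ z) * cE (-(m * φ))) hH 0 (2 * Real.pi) (hball z hz) ξ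
    have h2 := (P_main Metric.isOpen_ball (H := fun z φ => C (lmap X N θ φ z) * cE (-(m * φ))) hH 0 (2 * Real.pi) (hball z hz)).1
    have h3 := h2.differentiableAt (by norm_num)
    unfold Cm avg
    rw [dbar_const_mul (by exact h3.const_mul _), dbar_const_mul h3, h1]
    congr 3
    ext φ
    have hd : DifferentiableAt ℝ C (lmap X N θ φ z + 0) := by
      rw [add_zero]; exact (h.c1 _ ((hln φ z).trans_lt hz)).differentiableAt (by norm_num)
    have h4 := dbar_comp (u := C) (z := z) (lmap X N θ φ) 0 hd ξ
    simp only [add_zero] at h4 hd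
    have hd2 : DifferentiableAt ℝ (fun y => C (lmap X N θ φ y)) z :=
      DifferentiableAt.comp z hd ((lmap X N θ φ).restrictScalars ℝ).differentiableAt
    rw [dbar_mul hd2 (by fun_prop), dbar_const, h4]; ring
  have hcont : ∀ z, ‖z‖ < P.r → ∀ ξ, Continuous (fun φ : ℝ => dbar C (lmap X N θ φ z) (lmap X N θ φ ξ)) := by
    intro z hz ξ
    exact cont_dbar_comp (C := C) (γ := fun φ : ℝ => lmap X N θ φ z) (v := fun φ : ℝ => lmap X N θ φ ξ)
      (lmap_cont X N θ z) (lmap_cont X N θ ξ) (fun φ => h.c1 _ ((hln φ z).trans_lt hz))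
  have hw : Continuous (fun φ : ℝ => cE (-(m * φ))) := by fun_prop
  refine ⟨by positivity, hc1, ?_, ?_, ?_, ?_⟩
  · obtain ⟨M, hM⟩ := h.bM
    refine ⟨qq j m * M, fun z hz => ?_⟩
    unfold Cm
    rw [norm_mul, Complex.norm_real, Real.norm_of_nonneg hq.le]
    gcongr
    apply norm_avg_le
    intro φ
    rw [norm_mul, norm_cE, mul_one]
    exact hM _ ((hln φ z).trans_lt hz)
  · intro ρ hρ z hz ξ
    rw [hdb z (hz.trans_lt hρ), norm_mul, Complex.norm_real, Real.norm_of_nonneg hq.le]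
    have hA := P.hA ρ
    calc _ ≤ qq j m * (κ * P.A ρ * ‖ξ‖) := by
          gcongr
          apply norm_avg_le
          intro φ
          rw [norm_mul, norm_cE, mul_one]
          refine (h.b1 ρ hρ _ ((hln φ z).trans hz) _).trans ?_
          have := hln φ ξ
          gcongr
      _ = _ := by ring
  · intro ρ hρ z hz z' hz' ξ
    rw [hdb z (hz.trans_lt hρ), hdb z' (hz'.trans_lt hρ), ← mul_sub,
      ← avg_sub (by exact (hcont z (hz.trans_lt hρ) ξ).mul hw) (by exact (hcont z' (hz'.trans_lt hρ) ξ).mul hw),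
      norm_mul, Complex.norm_real, Real.norm_of_nonneg hq.le]
    have hA := P.hA ρ
    calc _ ≤ qq j m * (κ * P.A ρ * ‖z - z'‖ * ‖ξ‖) := by
          gcongr
          apply norm_avg_le
          intro φ
          rw [← sub_mul, norm_mul, norm_cE, mul_one]
          refine (h.b2 ρ hρ _ ((hln φ z).trans hz) _ ((hln φ z').trans hz') _).trans ?_
          rw [← map_sub]
          have h1 := hln φ ξ
          have h2 := hln φ (z - z')
          gcongr
      _ = _ := by ring
  · intro p a ψ
    unfold Cm
    have hx : ∀ b : ℂ, X.x N (X.pr N p + b • X.e N) = b := by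
      intro b
      rw [map_add, X.x_pr, if_neg (lt_irrefl N), map_smul, X.x_e, if_pos rfl]; simp
    have hp : ∀ b : ℂ, X.pr N (X.pr N p + b • X.e N) = X.pr N p := by
      intro b
      rw [map_add, X.pr_pr N N le_rfl, map_smul, X.pr_e, if_neg (lt_irrefl N)]; simp
    have hpt : ∀ φ, C (lmap X N θ φ (X.pr N p + (cE ψ * a) • X.e N)) =
        cE (j * ψ) * C (lmap X N θ (φ + ψ) (X.pr N p + a • X.e N)) := by
      intro φ
      rw [lmap_apply, lmap_apply, hx, hx, hp, hp]
      have e1 : cE ψ * a * (θ * cE φ) = a * (θ * cE (φ + ψ)) := by rw [cE_add]; ring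
      have e2 : cE ψ * a * ((1 - θ : ℝ) : ℂ) = cE ψ * (a * ((1 - θ : ℝ) : ℂ)) := by ring
      rw [e1, e2]
      have := h.mode (X.pr N p + (a * (θ * cE (φ + ψ))) • X.e N) (a * ((1 - θ : ℝ) : ℂ)) ψ
      have e3 : X.pr (N+1) (X.pr N p + (a * (θ * cE (φ + ψ))) • X.e N) = X.pr N p + (a * (θ * cE (φ + ψ))) • X.e N := by
        rw [map_add, X.pr_pr' N (N+1) (Nat.le_succ N), map_smul, X.pr_e, if_pos (Nat.lt_succ_self N)]
      rwa [e3] at this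
    simp only [← hθ, hpt]
    have e4 : ∀ φ : ℝ, cE (j * ψ) * C (lmap X N θ (φ + ψ) (X.pr N p + a • X.e N)) * cE (-(m * φ)) =
        cE ((j + m : ℕ) * ψ) * ((fun t : ℝ => C (lmap X N θ t (X.pr N p + a • X.e N)) * cE (-(m * t))) (φ + ψ)) := by
      intro φ
      have : cE ((j + m : ℕ) * ψ) * cE (-(m * (φ + ψ))) = cE (j * ψ) * cE (-(m * φ)) := by
        rw [← cE_add, ← cE_add]; congr 1; push_cast; ring
      simp only
      linear_combination (-C (lmap X N θ (φ + ψ) (X.pr N p + a • X.e N))) * this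
    simp only [e4]
    rw [avg_const_mul]
    have e5 := avg_shift (f := fun t : ℝ => C (lmap X N θ t (X.pr N p + a • X.e N)) * cE (-(m * t))) ?_ ψ
    · rw [e5]; ring
    · intro φ
      rw [cE_neg_nat_periodic, lmap_apply, lmap_apply, cE_periodic]

end ClassCsec

structure Tup (P : Par) (ρ1 ρ δ : ℝ) (γ G : ℕ → ℝ) (β : ℝ) : Prop where
  h1 : 0 < ρ1
  h2 : ρ1 < ρ
  h3 : ρ < P.s
  hδ : 0 < δ
  hγ : ∀ i, 1 + δ ≤ γ i
  hG : ∀ i, 1 ≤ G i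
  hGγ : ∀ i (m : ℕ), m ≠ 0 → 2 * (Real.exp 1 * m) ≤ G i * γ i ^ m
  hβ1 : 4 * ρ ^ 3 * P.A ρ ≤ β
  hβ2 : ∀ j, 2 * P.A (max ρ (P.bs j)) * (max ρ (P.bs j) - min ρ (P.bs j)) * ((min ρ (P.bs j)) ^ j)⁻¹ ≤ β * (ρ1 ^ (j + 1))⁻¹

def HB (P : Par) : Prop := ∀ ρ1 ρ : ℝ, 0 < ρ1 → ρ1 < ρ → ρ < P.s → ∃ β, 4 * ρ ^ 3 * P.A ρ ≤ β ∧
  ∀ j, 2 * P.A (max ρ (P.bs j)) * (max ρ (P.bs j) - min ρ (P.bs j)) * ((min ρ (P.bs j)) ^ j)⁻¹ ≤ β * (ρ1 ^ (j + 1))⁻¹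

def C2 (P : Par) (ρ δ : ℝ) : ℝ := P.A ρ * ρ * (1 + δ) * (8 + 4 * ρ / δ)

lemma Tup.C2_nonneg {P : Par} {ρ1 ρ δ : ℝ} {γ G : ℕ → ℝ} {β : ℝ} (t : Tup P ρ1 ρ δ γ G β) : 0 ≤ C2 P ρ δ := by
  have := t.h1.trans t.h2
  have := t.hδ
  have := P.hA ρ
  unfold C2; positivity

lemma Tup.β_nonneg {P : Par} {ρ1 ρ δ : ℝ} {γ G : ℕ → ℝ} {β : ℝ} (t : Tup P ρ1 ρ δ γ G β) : 0 ≤ β := by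
  have := t.h1.trans t.h2
  have := P.hA ρ
  refine le_trans ?_ t.hβ1; positivity

section SNsec
variable {V : Type*} [NormedAddCommGroup V] [NormedSpace ℂ V] (X : Coord V) (P : Par)

def SN (N : ℕ) : Prop := ∀ j κ (C : V → ℂ), ClassC X P N j κ C → ∃ h : V → ℂ, (∀ z, h z = h (X.pr N z)) ∧
  (∀ z, X.nrm N z < P.s → ContDiffAt ℝ 1 h z ∧ ∀ ξ, dbar h z ξ = 0) ∧
  ∀ ρ1 ρ δ γ G β, Tup P ρ1 ρ δ γ G β → ∀ z, X.Lw γ N z < ρ1 →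
    ‖(((ρ - X.nrm N z : ℝ) : ℂ) ^ j)⁻¹ * C (X.pr N z + ((ρ - X.nrm N z : ℝ) : ℂ) • X.e N) - h z‖ ≤
      κ * X.aN G β (C2 P ρ δ) N z * DD j * ((ρ1 - X.Lw γ N z) ^ (j + 1))⁻¹

variable {X P}

lemma SN_zero : SN X P 0 := by
  intro j κ C h
  have hκ := h.hκ
  refine ⟨fun _ => ((P.bs j : ℂ) ^ j)⁻¹ * C (0 + (P.bs j : ℂ) • X.e 0), fun _ => rfl,
    fun z _ => ⟨contDiffAt_const, fun ξ => dbar_const _ _ _⟩, ?_⟩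
  intro ρ1 ρ δ γ G β t z _
  simp only [X.nrm_zero, X.Lw_zero, X.pr_zero, sub_zero, Coord.aN]
  have hρ : 0 < ρ := t.h1.trans t.h2
  have hb := P.hbs j
  have hb' := P.hbs' j
  have hD := one_le_DD j
  have hβ := t.β_nonneg
  have hρ1 := t.h1
  have hmx : max ρ (P.bs j) < P.r := (max_lt_iff.2 ⟨t.h3.trans P.hsr, hb'.trans_lt P.hsr⟩)
  have hmn : 0 < min ρ (P.bs j) := lt_min hρ hb
  have hnorm : ∀ y ∈ Icc (min ρ (P.bs j)) (max ρ (P.bs j)), ‖(0:V) + (y : ℂ) • X.e 0‖ ≤ max ρ (P.bs j) := by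
    intro y hy
    rw [zero_add, norm_smul, Complex.norm_real, Real.norm_of_nonneg (hmn.le.trans hy.1)]
    have := X.norm_e 0
    nlinarith [hy.1, hy.2, norm_nonneg (X.e 0)]
  have hr := radial (C := C) (Q := 0) (e' := X.e 0) (j := j) (K := κ * P.A (max ρ (P.bs j))) hmn (min_le_max)
    (fun y hy => h.c1 _ ((hnorm y hy).trans_lt hmx)) (fun y hy => by
      refine (h.b1 _ hmx _ (hnorm y hy) _).trans ?_
      have := X.norm_e 0
      have := P.hA (max ρ (P.bs j))
      have h5 : 0 ≤ κ * P.A (max ρ (P.bs j)) := by positivity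
      nlinarith)
    (fun y ψ => by
      have := h.mode 0 y ψ
      simpa [X.pr_zero] using this)
  have hfin : 2 * (κ * P.A (max ρ (P.bs j))) * ((min ρ (P.bs j)) ^ j)⁻¹ * (max ρ (P.bs j) - min ρ (P.bs j)) ≤
      κ * β * DD j * (ρ1 ^ (j + 1))⁻¹ := by
    have h6 := t.hβ2 j
    have h7 : 0 ≤ β * (ρ1 ^ (j + 1))⁻¹ := by positivity
    calc _ = κ * (2 * P.A (max ρ (P.bs j)) * (max ρ (P.bs j) - min ρ (P.bs j)) * ((min ρ (P.bs j)) ^ j)⁻¹) := by ring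
      _ ≤ κ * (β * (ρ1 ^ (j + 1))⁻¹) := by gcongr
      _ ≤ κ * (β * (ρ1 ^ (j + 1))⁻¹ * DD j) := mul_le_mul_of_nonneg_left (le_mul_of_one_le_right h7 hD) hκ
      _ = _ := by ring
  refine le_trans ?_ (hr.trans hfin)
  rcases le_total ρ (P.bs j) with hle | hle
  · rw [max_eq_right hle, min_eq_left hle, norm_sub_rev]
  · rw [max_eq_left hle, min_eq_right hle]

lemma ClassC.tv {N j : ℕ} {κ : ℝ} {C : V → ℂ} (h : ClassC X P (N+1) j κ C) {ρ : ℝ} (hρ : ρ < P.r) {z : V}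
    (hz : X.nrm N z < ρ) :
    TVhyp C (X.pr N z) (X.e N) (X.e (N+1)) (ρ - X.nrm N z) (κ * P.A ρ) j := by
  have hκ := h.hκ
  have hA := P.hA ρ
  have hn : ∀ w y : ℂ, ‖w‖ + ‖y‖ ≤ ρ - X.nrm N z → ‖X.pr N z + w • X.e N + y • X.e (N+1)‖ ≤ ρ := by
    intro w y hwy
    have := X.norm_pt2 N z w y
    linarith
  have hn' : ∀ w y : ℂ, ‖w‖ + ‖y‖ ≤ ρ - X.nrm N z → ‖X.pr N z + y • X.e (N+1)‖ ≤ ρ := by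
    intro w y hwy
    have := X.norm_pt2 N z 0 y
    rw [zero_smul, add_zero, norm_zero] at this
    linarith [norm_nonneg w]
  have hK0 : 0 ≤ κ * P.A ρ := by positivity
  have hL : ∀ (i : ℕ) (w y : ℂ), ‖w‖ + ‖y‖ ≤ ρ - X.nrm N z →
      ‖dbar C (X.pr N z + w • X.e N + y • X.e (N+1)) (X.e i) - dbar C (X.pr N z + y • X.e (N+1)) (X.e i)‖ ≤ κ * P.A ρ * ‖w‖ := by
    intro i w y hwy
    refine (h.b2 ρ hρ _ (hn w y hwy) _ (hn' w y hwy) _).trans ?_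
    have e1 : X.pr N z + w • X.e N + y • X.e (N+1) - (X.pr N z + y • X.e (N+1)) = w • X.e N := by abel
    rw [e1, norm_smul]
    have h1 := X.norm_e N
    have h2 := X.norm_e i
    calc _ ≤ κ * P.A ρ * (‖w‖ * 1) * 1 := by gcongr
      _ = _ := by ring
  have hK : ∀ (i : ℕ) (w y : ℂ), ‖w‖ + ‖y‖ ≤ ρ - X.nrm N z →
      ‖dbar C (X.pr N z + w • X.e N + y • X.e (N+1)) (X.e i)‖ ≤ κ * P.A ρ := by
    intro i w y hwy
    refine (h.b1 ρ hρ _ (hn w y hwy) _).trans ?_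
    have h2 := X.norm_e i
    nlinarith
  refine ⟨by linarith, fun w y hwy => h.c1 _ ((hn w y hwy).trans_lt hρ), hK N, hK (N+1), hL N, hL (N+1), ?_⟩
  intro w y ψ
  have := h.mode (X.pr N z + w • X.e N) y ψ
  have e3 : X.pr (N+1) (X.pr N z + w • X.e N) = X.pr N z + w • X.e N := by
    rw [map_add, X.pr_pr' N (N+1) (Nat.le_succ N), map_smul, X.pr_e, if_pos (Nat.lt_succ_self N)]
  rwa [e3] at this

lemma bm_eq_Cm {N j m : ℕ} {C : V → ℂ} (σ : ℝ) (z : V) :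
    bm C (X.pr N z) (X.e N) (X.e (N+1)) σ j m = ((σ : ℂ) ^ (j + m))⁻¹ * Cm X N j m C (X.pr N z + (σ : ℂ) • X.e N) := by
  have hx : X.x N (X.pr N z + (σ : ℂ) • X.e N) = σ := by
    rw [map_add, X.x_pr, if_neg (lt_irrefl N), map_smul, X.x_e, if_pos rfl]; simp
  have hp : X.pr N (X.pr N z + (σ : ℂ) • X.e N) = X.pr N z := by
    rw [map_add, X.pr_pr N N le_rfl, map_smul, X.pr_e, if_neg (lt_irrefl N)]; simp
  unfold bm Cm
  congr 3
  ext φ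
  rw [lmap_apply, hx, hp]
  congr 5
  · push_cast; ring
  · push_cast; ring


lemma geo_shift {δ : ℝ} (hδ : 0 < δ) (a b : ℝ) :
    HasSum (fun m : ℕ => if m = 0 then a else b * ((1 + δ) ^ (m - 1))⁻¹) (a + b * ((1 + δ) / δ)) := by
  have h1 : HasSum (fun m : ℕ => ((1 + δ)⁻¹) ^ m) (1 - (1 + δ)⁻¹)⁻¹ :=
    hasSum_geometric_of_lt_one (by positivity) (inv_lt_one_of_one_lt₀ (by linarith))
  have h2 : (1 - (1 + δ)⁻¹)⁻¹ = (1 + δ) / δ := by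
    have : 1 - (1 + δ)⁻¹ = δ / (1 + δ) := by field_simp; ring
    rw [this, inv_div]
  rw [h2] at h1
  have h3 := h1.mul_left b
  have h4 := (hasSum_nat_add_iff (f := fun m : ℕ => if m = 0 then a else b * ((1 + δ) ^ (m - 1))⁻¹) 1 (g := b * ((1 + δ) / δ))).1 (by
    simpa [inv_pow] using h3)
  simpa [add_comm] using h4

set_option maxHeartbeats 2000000 in
/-- the key one-step estimate -/
lemma step_est {N j : ℕ} {κ : ℝ} {C : V → ℂ} (h : ClassC X P (N+1) j κ C) {ρ1 ρ δ : ℝ} {γ G : ℕ → ℝ} {β : ℝ}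
    (t : Tup P ρ1 ρ δ γ G β) {z : V} (hz : X.Lw γ (N+1) z < ρ1) {M : ℝ} (hM : ∀ z, ‖z‖ < P.r → ‖C z‖ ≤ M)
    (hm : ℕ → ℂ)
    (IH : ∀ m, ‖(((ρ - X.nrm N z : ℝ) : ℂ) ^ (j + m))⁻¹ * Cm X N j m C (X.pr N z + ((ρ - X.nrm N z : ℝ) : ℂ) • X.e N) - hm m‖ ≤
      κ * qq j m * X.aN G β (C2 P ρ δ) N z * DD (j + m) * ((ρ1 - X.Lw γ N z) ^ (j + m + 1))⁻¹) :
    ∃ S, HasSum (fun m => X.x N z ^ m * hm m) S ∧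
    ‖(((ρ - X.nrm (N+1) z : ℝ) : ℂ) ^ j)⁻¹ * C (X.pr (N+1) z + ((ρ - X.nrm (N+1) z : ℝ) : ℂ) • X.e (N+1)) - S‖ ≤
      κ * X.aN G β (C2 P ρ δ) (N+1) z * DD j * ((ρ1 - X.Lw γ (N+1) z) ^ (j + 1))⁻¹ ∧
    ∀ n, ‖∑ m ∈ Finset.range n, X.x N z ^ m * hm m‖ ≤
      κ * X.aN G β (C2 P ρ δ) (N+1) z * DD j * ((ρ1 - X.Lw γ (N+1) z) ^ (j + 1))⁻¹ +
        M * ((ρ1 - X.Lw γ (N+1) z) ^ j)⁻¹ * ((1 + δ) / δ) := by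
  have hκ := h.hκ
  have hδ := t.hδ
  have hρ1 := t.h1
  have hρ := t.h1.trans t.h2
  have hA := P.hA ρ
  have hρr := t.h3.trans P.hsr
  have hM0 : 0 ≤ M := (norm_nonneg _).trans (hM 0 (by simpa using hρ.trans hρr))
  set a := X.aN G β (C2 P ρ δ) N z with ha
  have haβ : β ≤ a := X.le_aN t.hG t.β_nonneg t.C2_nonneg N z
  have ha0 : 0 ≤ a := t.β_nonneg.trans haβ
  set w := X.x N z with hw
  have hnL : X.nrm N z ≤ X.Lw γ N z := X.nrm_le_Lw (fun i => by linarith [t.hγ i]) N z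
  have hn0 := X.nrm_nonneg N z
  have hγ := t.hγ N
  have hG1 := t.hG N
  have hLs := X.Lw_succ γ N z
  rw [← hw] at hLs
  have hns := X.nrm_succ N z
  rw [← hw] at hns
  have has : X.aN G β (C2 P ρ δ) (N+1) z = G N * a + C2 P ρ δ * ‖w‖ := rfl
  have hps : X.pr (N+1) z = X.pr N z + w • X.e N := X.pr_succ N z
  rw [hLs] at hz
  have hns' : ρ - X.nrm (N+1) z = ρ - X.nrm N z - ‖w‖ := by rw [hns]; ring
  rw [has, hps, hLs, hns']
  set L := X.Lw γ N z with hL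
  set σ := ρ - X.nrm N z with hσ
  set y := γ N * ‖w‖ with hy
  have hy0 : 0 ≤ y := by
    have : 0 < γ N := by linarith
    positivity
  have hl' : 0 < ρ1 - (L + y) := by linarith
  have hlσ : ρ1 - L ≤ σ := by have := t.h2; linarith
  have hσρ : σ ≤ ρ := by linarith
  have hσ0 : 0 < σ := by linarith
  have hD := one_le_DD j
  have tv := h.tv hρr (z := z) (by linarith)
  rw [← hσ] at tv
  set l' := ρ1 - (L + y) with hl'd
  have hl'ρ : l' ≤ ρ := by have := t.h2; linarith
  have hMC : ∀ w y : ℂ, ‖w‖ + ‖y‖ ≤ σ → ‖C (X.pr N z + w • X.e N + y • X.e (N+1))‖ ≤ M := by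
    intro w y hwy
    apply hM
    have := X.norm_pt2 N z w y
    linarith
  have hC2 := t.C2_nonneg
  have hl'j : (l' ^ j)⁻¹ = l' * (l' ^ (j+1))⁻¹ := by rw [pow_succ]; field_simp
  have hδ1 : 1 ≤ (1 + δ) / δ := by rw [le_div_iff₀ hδ]; linarith
  simp only [← bm_eq_Cm] at IH
  by_cases hw0 : w = 0
  · have hs : HasSum (fun m => w ^ m * hm m) (hm 0) := by
      have := hasSum_single (f := fun m => w ^ m * hm m) 0 (fun m hm' => by simp [hw0, hm'])
      simpa using this
    have e0 := IH 0
    have eb : bm C (X.pr N z) (X.e N) (X.e (N+1)) σ j 0 = ((σ : ℂ) ^ j)⁻¹ * C (X.pr N z + (σ : ℂ) • X.e (N+1)) := by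
      simp [bm, qq_zero, theta_zero, cE_zero, avg_const]
    rw [eb] at e0
    have hle : κ * qq j 0 * a * DD (j + 0) * ((ρ1 - L) ^ (j + 0 + 1))⁻¹ ≤ κ * (G N * a) * DD j * (l' ^ (j+1))⁻¹ := by
      have : ρ1 - L = l' := by rw [hl'd, hy, hw0]; simp
      rw [qq_zero, this, mul_one]
      simp only [add_zero]
      have : a ≤ G N * a := le_mul_of_one_le_left ha0 hG1
      gcongr
    have e1 := e0.trans hle
    refine ⟨hm 0, hs, ?_, ?_⟩
    · simpa [hw0] using e1
    · intro n
      have e2 : ‖((σ : ℂ) ^ j)⁻¹ * C (X.pr N z + (σ : ℂ) • X.e (N+1))‖ ≤ M * (l' ^ j)⁻¹ * ((1 + δ) / δ) := by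
        rw [norm_mul, norm_inv, norm_pow, Complex.norm_real, Real.norm_of_nonneg hσ0.le]
        have := hMC 0 σ (by simp [abs_of_pos hσ0])
        rw [zero_smul, add_zero] at this
        have h3 : l' ≤ σ := by linarith
        calc _ ≤ (l' ^ j)⁻¹ * M := by gcongr
          _ = M * (l' ^ j)⁻¹ * 1 := by ring
          _ ≤ _ := by gcongr
      have e3 : ‖∑ m ∈ Finset.range n, w ^ m * hm m‖ ≤ ‖hm 0‖ := by
        rcases Nat.eq_zero_or_pos n with rfl | hn
        · simp
        · rw [Finset.sum_eq_single 0]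
          · simp
          · intro m _ hm'; simp [hw0, hm']
          · intro hh; exact absurd (Finset.mem_range.2 hn) hh
      have e4 := norm_sub_norm_le (hm 0) (((σ : ℂ) ^ j)⁻¹ * C (X.pr N z + (σ : ℂ) • X.e (N+1)))
      rw [norm_sub_rev] at e4
      have e5 : ‖w‖ = 0 := by rw [hw0, norm_zero]
      rw [e5, mul_zero, add_zero]
      linarith
  -- main case
  have hw' : 0 < ‖w‖ := norm_pos_iff.2 hw0
  set T := (1 + δ) * ‖w‖ with hT
  have hT0 : 0 < T := by positivity
  have hTy : T ≤ y := by rw [hT, hy]; gcongr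
  have hTσ : T < σ := by linarith
  have hwT : ‖w‖ < T := by rw [hT]; nlinarith
  have hl'T : l' ≤ σ - T := by linarith
  have hσT : 0 < σ - T := by linarith
  set K := κ * P.A ρ with hK
  have hK0 : 0 ≤ K := by positivity
  set Y := ((σ - T) ^ j)⁻¹ with hY
  have hY0 : 0 ≤ Y := by positivity
  have hYl : Y ≤ (l' ^ j)⁻¹ := by rw [hY]; gcongr
  obtain ⟨S0, hS0, hS0b⟩ := tv.sum hwT hTσ
  -- term bounds
  set g1 : ℕ → ℝ := fun m => if m = 0 then 4 * K * T * Y else (4 * K * σ * Y * ‖w‖) * ((1 + δ) ^ (m - 1))⁻¹ with hg1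
  set g2 : ℕ → ℝ := fun m => (κ * (G N * a) * DD j) * (((m + j).choose j : ℝ) * y ^ m * ((ρ1 - L) ^ (j + m + 1))⁻¹) with hg2
  have hs1 : HasSum g1 (4 * K * T * Y + (4 * K * σ * Y * ‖w‖) * ((1 + δ) / δ)) := geo_shift hδ _ _
  have hs2 : HasSum g2 ((κ * (G N * a) * DD j) * (l' ^ (j+1))⁻¹) := by
    have := (negbinom j (l := ρ1 - L) hy0 (by linarith)).mul_left (κ * (G N * a) * DD j)
    have e : ρ1 - L - y = l' := by rw [hl'd]; ring
    rwa [e] at this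
  have hterm : ∀ m, ‖w ^ m * gm C (X.pr N z) (X.e N) (X.e (N+1)) σ j m T - w ^ m * hm m‖ ≤ g1 m + g2 m := by
    intro m
    have hlpos : 0 < ρ1 - L := by linarith
    rw [← mul_sub, norm_mul, norm_pow]
    have hI := IH m
    by_cases hm0 : m = 0
    · subst hm0
      have eb : bm C (X.pr N z) (X.e N) (X.e (N+1)) σ j 0 = ((σ : ℂ) ^ j)⁻¹ * C (X.pr N z + (σ : ℂ) • X.e (N+1)) := by
        simp [bm, qq_zero, theta_zero, cE_zero, avg_const]
      rw [eb] at hI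
      have hd := tv.diff0 hT0.le hTσ
      have e1 : κ * qq j 0 * a * DD (j + 0) * ((ρ1 - L) ^ (j + 0 + 1))⁻¹ ≤ g2 0 := by
        simp only [hg2, qq_zero, add_zero, pow_zero, mul_one, zero_add, Nat.choose_self, Nat.cast_one, one_mul]
        have : a ≤ G N * a := le_mul_of_one_le_left ha0 hG1
        gcongr
      have e2 : g1 0 = 4 * K * T * Y := by simp [hg1]
      rw [e2, pow_zero, one_mul]
      have := norm_sub_le_norm_sub_add_norm_sub (gm C (X.pr N z) (X.e N) (X.e (N+1)) σ j 0 T)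
        (((σ : ℂ) ^ j)⁻¹ * C (X.pr N z + (σ : ℂ) • X.e (N+1))) (hm 0)
      linarith
    · have hd := tv.diffm hm0 hT0 hTσ
      have hq := qq_pos j m
      have tri := norm_sub_le_norm_sub_add_norm_sub (gm C (X.pr N z) (X.e N) (X.e (N+1)) σ j m T)
        (bm C (X.pr N z) (X.e N) (X.e (N+1)) σ j m) (hm m)
      have e2 : g1 m = ‖w‖ ^ m * (4 * K * σ * ((T ^ (m - 1))⁻¹ * Y)) := by
        simp only [hg1, if_neg hm0]
        obtain ⟨k, rfl⟩ := Nat.exists_eq_succ_of_ne_zero hm0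
        simp only [Nat.succ_eq_add_one, Nat.add_sub_cancel]
        rw [hT, mul_pow, pow_succ]
        field_simp
      have hDp := one_le_DD (j + m)
      have e3 : 4 * K * σ * (qq j m * σ * (σ ^ (j + m))⁻¹) ≤ κ * qq j m * a * DD (j + m) * ((ρ1 - L) ^ (j + m + 1))⁻¹ := by
        have i1 : (σ ^ (j + m))⁻¹ = σ * (σ ^ (j+m+1))⁻¹ := by rw [pow_succ σ (j+m)]; field_simp
        have i2 : σ ^ 3 * (σ ^ (j+m+1))⁻¹ ≤ ρ ^ 3 * ((ρ1 - L) ^ (j + m + 1))⁻¹ := by gcongr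
        have i3 : 4 * ρ ^ 3 * P.A ρ ≤ a := t.hβ1.trans haβ
        calc _ = (κ * qq j m) * (4 * P.A ρ * (σ ^ 3 * (σ ^ (j+m+1))⁻¹)) := by rw [i1, hK]; ring
          _ ≤ (κ * qq j m) * (4 * P.A ρ * (ρ ^ 3 * ((ρ1 - L) ^ (j + m + 1))⁻¹)) := by gcongr
          _ = (κ * qq j m) * ((4 * ρ ^ 3 * P.A ρ) * ((ρ1 - L) ^ (j + m + 1))⁻¹) := by ring
          _ ≤ (κ * qq j m) * (a * ((ρ1 - L) ^ (j + m + 1))⁻¹) := by gcongr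
          _ = (κ * qq j m * a) * ((ρ1 - L) ^ (j + m + 1))⁻¹ * 1 := by ring
          _ ≤ (κ * qq j m * a) * ((ρ1 - L) ^ (j + m + 1))⁻¹ * DD (j + m) := by gcongr
          _ = _ := by ring
      have e4 : ‖w‖ ^ m * (2 * (κ * qq j m * a * DD (j + m) * ((ρ1 - L) ^ (j + m + 1))⁻¹)) ≤ g2 m := by
        have i1 := qq_DD j m
        have i2 := DD_le m hm0
        have i3 := t.hGγ N m hm0
        have i4 : 2 * DD m ≤ G N * γ N ^ m := by linarith
        have hD0 : 0 ≤ DD j := by linarith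
        calc _ = (κ * a * (qq j m * DD (j+m))) * (2 * ‖w‖ ^ m * ((ρ1 - L) ^ (j + m + 1))⁻¹) := by ring
          _ = (κ * a * DD j * ((m + j).choose j : ℝ) * ‖w‖ ^ m * ((ρ1 - L) ^ (j + m + 1))⁻¹) * (2 * DD m) := by rw [i1]; ring
          _ ≤ (κ * a * DD j * ((m + j).choose j : ℝ) * ‖w‖ ^ m * ((ρ1 - L) ^ (j + m + 1))⁻¹) * (G N * γ N ^ m) := by gcongr
          _ = _ := by simp only [hg2]; rw [hy, mul_pow]; ring
      have hwm : 0 ≤ ‖w‖ ^ m := by positivity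
      calc _ ≤ ‖w‖ ^ m * (4 * K * σ * ((T ^ (m - 1))⁻¹ * Y) + 2 * (κ * qq j m * a * DD (j + m) * ((ρ1 - L) ^ (j + m + 1))⁻¹)) := by
            apply mul_le_mul_of_nonneg_left _ hwm
            rw [mul_add] at hd
            linarith
        _ ≤ _ := by rw [mul_add, ← e2]; linarith
  have hs12 := hs1.add hs2
  have hdiff : Summable (fun m => w ^ m * gm C (X.pr N z) (X.e N) (X.e (N+1)) σ j m T - w ^ m * hm m) :=
    Summable.of_norm_bounded hs12.summable hterm
  have hSh : HasSum (fun m => w ^ m * hm m) (S0 - ∑' m, (w ^ m * gm C (X.pr N z) (X.e N) (X.e (N+1)) σ j m T - w ^ m * hm m)) := by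
    have := hS0.sub hdiff.hasSum
    simpa using this
  have hE : 4 * K * T * Y + (4 * K * T * Y + (4 * K * σ * Y * ‖w‖) * ((1 + δ) / δ)) + (κ * (G N * a) * DD j) * (l' ^ (j+1))⁻¹ ≤
      κ * (G N * a + C2 P ρ δ * ‖w‖) * DD j * (l' ^ (j+1))⁻¹ := by
    have i1 : 4 * K * T * Y + (4 * K * T * Y + (4 * K * σ * Y * ‖w‖) * ((1 + δ) / δ)) = (κ * P.A ρ * (1 + δ) * ‖w‖ * (8 + 4 * σ / δ)) * Y := by
      rw [hT, hK]; field_simp; ring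
    have i2 : (κ * P.A ρ * (1 + δ) * ‖w‖ * (8 + 4 * σ / δ)) * Y ≤ (κ * P.A ρ * (1 + δ) * ‖w‖ * (8 + 4 * ρ / δ)) * (l' ^ j)⁻¹ := by gcongr
    have i3 : (κ * P.A ρ * (1 + δ) * ‖w‖ * (8 + 4 * ρ / δ)) * (l' ^ j)⁻¹ ≤ (κ * P.A ρ * (1 + δ) * ‖w‖ * (8 + 4 * ρ / δ)) * (ρ * (l' ^ (j+1))⁻¹) := by
      rw [hl'j]; gcongr
    have i4 : (κ * P.A ρ * (1 + δ) * ‖w‖ * (8 + 4 * ρ / δ)) * (ρ * (l' ^ (j+1))⁻¹) = κ * (C2 P ρ δ * ‖w‖) * (l' ^ (j+1))⁻¹ * 1 := by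
      unfold C2; ring
    have i5 : κ * (C2 P ρ δ * ‖w‖) * (l' ^ (j+1))⁻¹ * 1 ≤ κ * (C2 P ρ δ * ‖w‖) * (l' ^ (j+1))⁻¹ * DD j := by gcongr
    rw [i1]
    calc _ ≤ κ * (C2 P ρ δ * ‖w‖) * (l' ^ (j+1))⁻¹ * DD j + (κ * (G N * a) * DD j) * (l' ^ (j+1))⁻¹ := by linarith
      _ = _ := by ring
  have hdn : ∀ n, ‖∑ m ∈ Finset.range n, (w ^ m * gm C (X.pr N z) (X.e N) (X.e (N+1)) σ j m T - w ^ m * hm m)‖ ≤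
      (4 * K * T * Y + (4 * K * σ * Y * ‖w‖) * ((1 + δ) / δ)) + (κ * (G N * a) * DD j) * (l' ^ (j+1))⁻¹ := by
    intro n
    refine (norm_sum_le _ _).trans ((Finset.sum_le_sum fun m _ => hterm m).trans ?_)
    exact sum_le_hasSum _ (fun m _ => (norm_nonneg _).trans (hterm m)) hs12
  refine ⟨_, hSh, ?_, ?_⟩
  · have h1 : ‖∑' m, (w ^ m * gm C (X.pr N z) (X.e N) (X.e (N+1)) σ j m T - w ^ m * hm m)‖ ≤
      (4 * K * T * Y + (4 * K * σ * Y * ‖w‖) * ((1 + δ) / δ)) + (κ * (G N * a) * DD j) * (l' ^ (j+1))⁻¹ :=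
      tsum_of_norm_bounded hs12 hterm
    rw [← sub_add]
    refine (norm_add_le _ _).trans ?_
    linarith
  · intro n
    have h2 := hdn n
    rw [Finset.sum_sub_distrib] at h2
    have h3 : ‖∑ m ∈ Finset.range n, w ^ m * gm C (X.pr N z) (X.e N) (X.e (N+1)) σ j m T‖ ≤ M * (l' ^ j)⁻¹ * ((1 + δ) / δ) := by
      have hg : HasSum (fun m : ℕ => (M * (l' ^ j)⁻¹) * ((1 + δ)⁻¹) ^ m) (M * (l' ^ j)⁻¹ * ((1 + δ) / δ)) := by
        have h1 : HasSum (fun m : ℕ => ((1 + δ)⁻¹) ^ m) (1 - (1 + δ)⁻¹)⁻¹ :=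
          hasSum_geometric_of_lt_one (by positivity) (inv_lt_one_of_one_lt₀ (by linarith))
        have h2 : (1 - (1 + δ)⁻¹)⁻¹ = (1 + δ) / δ := by
          have : 1 - (1 + δ)⁻¹ = δ / (1 + δ) := by field_simp; ring
          rw [this, inv_div]
        rw [h2] at h1
        exact h1.mul_left _
      refine (norm_sum_le _ _).trans ((Finset.sum_le_sum fun m _ => ?_).trans (sum_le_hasSum (Finset.range n) (fun m _ => by positivity) hg))
      rw [norm_mul, norm_pow]
      have := gm_norm_le (C := C) (p := X.pr N z) (e := X.e N) (e' := X.e (N+1)) (σ := σ) (j := j) m hT0 hTσ hMC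
      calc _ ≤ ‖w‖ ^ m * ((T ^ m)⁻¹ * Y * M) := by gcongr
        _ = ((1 + δ)⁻¹) ^ m * (Y * M) := by rw [hT, mul_pow, inv_pow]; field_simp
        _ ≤ ((1 + δ)⁻¹) ^ m * ((l' ^ j)⁻¹ * M) := by gcongr
        _ = _ := by ring
    have h4 := norm_sub_norm_le (∑ m ∈ Finset.range n, w ^ m * hm m) (∑ m ∈ Finset.range n, w ^ m * gm C (X.pr N z) (X.e N) (X.e (N+1)) σ j m T)
    rw [norm_sub_rev] at h4
    have h5 : 0 ≤ 4 * K * T * Y := by positivity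
    linarith

end SNsec

section SN2
variable {V : Type*} [NormedAddCommGroup V] [NormedSpace ℂ V] {X : Coord V} {P : Par}

lemma growth {δ : ℝ} (hδ : 0 < δ) (m : ℕ) : 2 * (Real.exp 1 * m) ≤ (1 + 2 * Real.exp 1 / δ) * (1 + δ) ^ m := by
  have h1 := one_add_mul_le_pow (a := δ) (by linarith) m
  have h2 : (m : ℝ) ≤ (1 + δ) ^ m / δ := by rw [le_div_iff₀ hδ]; linarith
  have h3 : 0 < (1 + δ) ^ m := by positivity
  have h4 := Real.exp_pos 1
  calc 2 * (Real.exp 1 * m) ≤ 2 * (Real.exp 1 * ((1 + δ) ^ m / δ)) := by gcongr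
    _ = (2 * Real.exp 1 / δ) * (1 + δ) ^ m := by ring
    _ ≤ _ := by nlinarith

lemma exists_tup (hHB : HB P) (N : ℕ) {z0 : V} (hz : X.nrm N z0 < P.s) :
    ∃ ρ1 ρ δ γ G β, Tup P ρ1 ρ δ γ G β ∧ X.Lw γ N z0 < ρ1 := by
  have hs := P.hs
  have hn := X.nrm_nonneg N z0
  obtain ⟨δ, hδ, hδs⟩ : ∃ δ : ℝ, 0 < δ ∧ (1 + δ) * X.nrm N z0 < P.s := by
    refine ⟨(P.s - X.nrm N z0) / (2 * P.s), by apply div_pos <;> linarith, ?_⟩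
    have h1 : (P.s - X.nrm N z0) / (2 * P.s) * X.nrm N z0 ≤ (P.s - X.nrm N z0) / 2 := by
      rw [div_mul_eq_mul_div, div_le_div_iff₀ (by positivity) (by positivity)]
      nlinarith
    nlinarith
  obtain ⟨ρ1, h1, h1'⟩ := exists_between hδs
  obtain ⟨ρ, h2, h2'⟩ := exists_between h1'
  have h0 : 0 < ρ1 := lt_of_le_of_lt (by positivity) h1
  obtain ⟨β, hβ1, hβ2⟩ := hHB ρ1 ρ h0 h2 h2'
  refine ⟨ρ1, ρ, δ, fun _ => 1 + δ, fun _ => 1 + 2 * Real.exp 1 / δ, β, ⟨h0, h2, h2', hδ, fun _ => le_rfl, fun _ => ?_, fun _ m _ => growth hδ m, hβ1, hβ2⟩, ?_⟩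
  · have : 0 < 2 * Real.exp 1 / δ := by have := Real.exp_pos 1; positivity
    linarith
  · refine lt_of_le_of_lt (le_of_eq ?_) h1
    unfold Coord.Lw Coord.nrm
    rw [Finset.mul_sum]

lemma x_pow_contDiff (X : Coord V) (N m : ℕ) (z : V) : DifferentiableAt ℂ (fun z => X.x N z ^ m) z := by
  exact (X.x N).differentiableAt.pow m

lemma x_pow_c1 (X : Coord V) (N m : ℕ) (z : V) : ContDiffAt ℝ 1 (fun z => X.x N z ^ m) z :=
  (((X.x N).restrictScalars ℝ).contDiff.pow m).contDiffAt

set_option maxHeartbeats 1000000 in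
lemma SN_succ (hHB : HB P) (N : ℕ) (ih : SN X P N) : SN X P (N+1) := by
  intro j κ C h
  have key : ∀ m, _ := fun m => ih (j + m) _ _ (Cm_class h m)
  choose hm hcyl hreg hest using key
  obtain ⟨M, hM⟩ := h.bM
  have hstep := fun (ρ1 ρ δ : ℝ) (γ G : ℕ → ℝ) (β : ℝ) (t : Tup P ρ1 ρ δ γ G β) (z : V) (hz : X.Lw γ (N+1) z < ρ1) =>
    step_est h t hz hM (fun m => hm m z) (fun m => hest m ρ1 ρ δ γ G β t z (by
      have h1 := X.Lw_succ γ N z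
      have h2 : 0 ≤ γ N * ‖X.x N z‖ := mul_nonneg (by linarith [t.hγ N, t.hδ]) (norm_nonneg _)
      linarith))
  refine ⟨fun z => ∑' m, X.x N z ^ m * hm m z, ?_, ?_, ?_⟩
  · intro z
    simp only
    congr 1
    ext m
    rw [X.x_pr, if_pos (Nat.lt_succ_self N), hcyl m (X.pr (N+1) z), X.pr_pr N (N+1) (Nat.le_succ N), ← hcyl m z]
  · intro z0 hz0
    obtain ⟨ρ1, ρ, δ, γ, G, β, t, hL⟩ := exists_tup hHB (N+1) hz0
    set Bd : V → ℝ := fun z => κ * X.aN G β (C2 P ρ δ) (N+1) z * DD j * ((ρ1 - X.Lw γ (N+1) z) ^ (j + 1))⁻¹ +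
        M * ((ρ1 - X.Lw γ (N+1) z) ^ j)⁻¹ * ((1 + δ) / δ) with hBd
    have hLc := X.continuous_Lw γ (N+1)
    have hBc : ContinuousAt Bd z0 := by
      have hne : ∀ k : ℕ, (ρ1 - X.Lw γ (N+1) z0) ^ k ≠ 0 := fun k => pow_ne_zero _ (by linarith)
      have hi : ∀ k : ℕ, ContinuousAt (fun z => ((ρ1 - X.Lw γ (N+1) z) ^ k)⁻¹) z0 := fun k =>
        ((continuous_const.sub hLc).pow k).continuousAt.inv₀ (hne k)
      have ha := (X.continuous_aN G β (C2 P ρ δ) (N+1)).continuousAt (x := z0)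
      exact (((continuousAt_const.mul ha).mul continuousAt_const).mul (hi _)).add
        ((continuousAt_const.mul (hi _)).mul continuousAt_const)
    have hev : ∀ᶠ z in 𝓝 z0, X.Lw γ (N+1) z < ρ1 ∧ Bd z < Bd z0 + 1 :=
      (hLc.continuousAt.eventually_lt continuousAt_const hL).and (hBc.eventually_lt continuousAt_const (by linarith))
    obtain ⟨r, hr, hball⟩ := Metric.eventually_nhds_iff_ball.1 hev
    have hd1 : ∀ z ∈ Metric.ball z0 r, ∀ m, ContDiffAt ℝ 1 (hm m) z ∧ ∀ ξ, dbar (hm m) z ξ = 0 := by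
      intro z hz m
      apply hreg
      have h1 := X.nrm_le_Lw (γ := γ) (fun i => by linarith [t.hγ i, t.hδ]) (N+1) z
      have h2 := X.nrm_succ N z
      have h3 := (hball z hz).1
      linarith [norm_nonneg (X.x N z), t.h2, t.h3]
    have hc1 : ∀ z ∈ Metric.ball z0 r, ∀ m, ContDiffAt ℝ 1 (fun z => X.x N z ^ m * hm m z) z :=
      fun z hz m => (x_pow_c1 X N m z).mul (hd1 z hz m).1
    have hdb : ∀ z ∈ Metric.ball z0 r, ∀ n ξ, dbar (fun z => ∑ m ∈ Finset.range n, X.x N z ^ m * hm m z) z ξ = 0 := by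
      intro z hz n ξ
      rw [dbar_sum _ (fun m _ => (hc1 z hz m).differentiableAt (by norm_num))]
      apply Finset.sum_eq_zero
      intro m _
      rw [dbar_mul ((x_pow_c1 X N m z).differentiableAt (by norm_num)) ((hd1 z hz m).1.differentiableAt (by norm_num)),
        (hd1 z hz m).2, dbar_holo (x_pow_contDiff X N m z)]
      simp
    have hB0 : 0 ≤ Bd z0 + 1 := by
      obtain ⟨S, _, _, h3⟩ := hstep _ _ _ _ _ _ t z0 hL
      have := (norm_nonneg _).trans (h3 0)
      linarith
    refine LL atTop (un := fun n z => ∑ m ∈ Finset.range n, X.x N z ^ m * hm m z) (f := fun _ _ => 0) hr hB0 (Eventually.of_forall fun n => ⟨?_, ?_, ?_, ?_⟩) ?_ ?_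
    · intro z hz
      exact ContDiffAt.sum (fun m _ => hc1 z hz m)
    · intro z hz
      obtain ⟨S, _, _, h3⟩ := hstep _ _ _ _ _ _ t z (hball z hz).1
      exact (h3 n).trans (hball z hz).2.le
    · intro z hz ξ
      rw [hdb z hz, norm_zero]; positivity
    · intro z hz z' hz' ξ
      rw [hdb z hz, hdb z' hz', sub_zero, norm_zero]; positivity
    · intro z hz
      obtain ⟨S, h1, _, _⟩ := hstep _ _ _ _ _ _ t z (hball z hz).1
      rw [h1.tsum_eq]
      exact h1.tendsto_sum_nat
    · intro ξ
      simp only [hdb z0 (Metric.mem_ball_self hr)]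
      exact tendsto_const_nhds
  · intro ρ1 ρ δ γ G β t z hz
    obtain ⟨S, h1, h2, _⟩ := hstep _ _ _ _ _ _ t z hz
    simp only
    rw [h1.tsum_eq]
    exact h2

theorem SN_all (hHB : HB P) (N : ℕ) : SN X P N := by
  induction N with
  | zero => exact SN_zero
  | succ N ih => exact SN_succ hHB N ih

end SN2

section KKsec
variable {V : Type*} [NormedAddCommGroup V] [NormedSpace ℂ V]

lemma avg_param_cont {Y : Type*} [TopologicalSpace Y] {g : Y → ℝ → ℂ} (h : Continuous (fun p : Y × ℝ => g p.1 p.2)) :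
    Continuous (fun y => avg (g y)) := by
  unfold avg
  exact continuous_const.mul (intervalIntegral.continuous_parametric_intervalIntegral_of_continuous' h 0 (2 * Real.pi))

def KK (e : V) (B : ℝ) (Φ : V → ℂ) (z : V) : ℂ :=
  -2 * ∫ r in (0:ℝ)..B, avg (fun θ => Φ (z + ((r : ℂ) * cE θ) • e) * cE (-θ))

lemma KK_inner_cont {e : V} {Φ : V → ℂ} (hΦ : Continuous Φ) (z : V) :
    Continuous (fun r : ℝ => avg (fun θ => Φ (z + ((r : ℂ) * cE θ) • e) * cE (-θ))) := by
  apply avg_param_cont (g := fun (r θ : ℝ) => Φ (z + ((r : ℂ) * cE θ) • e) * cE (-θ))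
  have hc : Continuous cE := cE_contDiff.continuous
  have h1 : Continuous (fun p : ℝ × ℝ => z + ((p.1 : ℂ) * cE p.2) • e) :=
    continuous_const.add (((Complex.continuous_ofReal.comp continuous_fst).mul (hc.comp continuous_snd)).smul continuous_const)
  exact (hΦ.comp h1).mul (hc.comp continuous_snd.neg)

lemma KK_add {e : V} {B : ℝ} {Φ Ψ : V → ℂ} (hΦ : Continuous Φ) (hΨ : Continuous Ψ) (z : V) :
    KK e B (fun y => Φ y + Ψ y) z = KK e B Φ z + KK e B Ψ z := by
  unfold KK
  have hc : Continuous cE := cE_contDiff.continuous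
  have h1 : ∀ {F : V → ℂ} (_ : Continuous F) (r : ℝ), Continuous (fun θ : ℝ => F (z + ((r : ℂ) * cE θ) • e) * cE (-θ)) := by
    intro F hF r
    have : Continuous (fun θ : ℝ => z + ((r : ℂ) * cE θ) • e) :=
      continuous_const.add ((continuous_const.mul hc).smul continuous_const)
    exact (hF.comp this).mul (hc.comp continuous_neg)
  rw [← mul_add, ← intervalIntegral.integral_add ((KK_inner_cont hΦ z).intervalIntegrable _ _) ((KK_inner_cont hΨ z).intervalIntegrable _ _)]
  congr 2
  ext r
  rw [← avg_add (h1 hΦ r) (h1 hΨ r)]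
  congr 1
  ext θ
  ring

lemma KK_inner_c1 {e : V} {Φ : V → ℂ} (hΦ : ContDiff ℝ 1 Φ) :
    ContDiff ℝ 1 (fun p : V × ℝ => avg (fun θ => Φ (p.1 + ((p.2 : ℂ) * cE θ) • e) * cE (-θ))) := by
  rw [contDiff_iff_contDiffAt]
  intro p
  have h1 : ContDiff ℝ 1 (fun q : (V × ℝ) × ℝ => q.1.1 + ((q.1.2 : ℂ) * cE q.2) • e) :=
    (contDiff_fst.comp contDiff_fst).add (((Complex.ofRealCLM.contDiff.comp (contDiff_snd.comp contDiff_fst)).mul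
      (cE_contDiff.comp contDiff_snd)).smul contDiff_const)
  have h2 : ContDiff ℝ 1 (fun q : (V × ℝ) × ℝ => Φ (q.1.1 + ((q.1.2 : ℂ) * cE q.2) • e) * cE (-q.2)) :=
    (hΦ.comp h1).mul (cE_contDiff.comp contDiff_snd.neg)
  have := (P_main isOpen_univ (H := fun (p : V × ℝ) θ => Φ (p.1 + ((p.2 : ℂ) * cE θ) • e) * cE (-θ))
    (fun z _ φ => h2.contDiffAt) 0 (2 * Real.pi) (mem_univ p)).1
  unfold avg
  exact contDiffAt_const.mul this

lemma KK_c1 {e : V} {B : ℝ} {Φ : V → ℂ} (hΦ : ContDiff ℝ 1 Φ) : ContDiff ℝ 1 (KK e B Φ) := by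
  rw [contDiff_iff_contDiffAt]
  intro z
  have := (P_main isOpen_univ (H := fun (z : V) (r : ℝ) => avg (fun θ => Φ (z + ((r : ℂ) * cE θ) • e) * cE (-θ)))
    (fun z _ φ => (KK_inner_c1 hΦ).contDiffAt) 0 B (mem_univ z)).1
  unfold KK
  exact contDiffAt_const.mul this

lemma KK_dbar {e : V} {B : ℝ} {Φ : V → ℂ} (hΦ : ContDiff ℝ 1 Φ) (z ξ : V) :
    dbar (KK e B Φ) z ξ = KK e B (fun y => dbar Φ y ξ) z := by
  have h0 := (P_main isOpen_univ (H := fun (z : V) (r : ℝ) => avg (fun θ => Φ (z + ((r : ℂ) * cE θ) • e) * cE (-θ)))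
    (fun z _ φ => (KK_inner_c1 hΦ).contDiffAt) 0 B (mem_univ z)).1
  have h1 := P_dbar isOpen_univ (H := fun (z : V) (r : ℝ) => avg (fun θ => Φ (z + ((r : ℂ) * cE θ) • e) * cE (-θ)))
    (fun z _ φ => (KK_inner_c1 hΦ).contDiffAt) 0 B (mem_univ z) ξ
  unfold KK
  rw [dbar_const_mul (h0.differentiableAt (by norm_num)), h1]
  congr 2
  ext r
  have hI : ContDiff ℝ 1 (fun q : V × ℝ => Φ (q.1 + ((r : ℂ) * cE q.2) • e) * cE (-q.2)) := by
    have h1 : ContDiff ℝ 1 (fun q : V × ℝ => q.1 + ((r : ℂ) * cE q.2) • e) :=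
      contDiff_fst.add ((contDiff_const.mul (cE_contDiff.comp contDiff_snd)).smul contDiff_const)
    exact (hΦ.comp h1).mul (cE_contDiff.comp contDiff_snd.neg)
  have h2 := (P_main isOpen_univ (H := fun (z : V) (θ : ℝ) => Φ (z + ((r : ℂ) * cE θ) • e) * cE (-θ))
    (fun z _ φ => hI.contDiffAt) 0 (2 * Real.pi) (mem_univ z)).1
  have h3 := P_dbar isOpen_univ (H := fun (z : V) (θ : ℝ) => Φ (z + ((r : ℂ) * cE θ) • e) * cE (-θ))
    (fun z _ φ => hI.contDiffAt) 0 (2 * Real.pi) (mem_univ z) ξ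
  unfold avg
  rw [dbar_const_mul (h2.differentiableAt (by norm_num)), h3]
  congr 2
  ext θ
  have hd : DifferentiableAt ℝ Φ ((ContinuousLinearMap.id ℂ V) z + ((r : ℂ) * cE θ) • e) :=
    hΦ.contDiffAt.differentiableAt (by norm_num)
  have h4 := dbar_comp (u := Φ) (z := z) (ContinuousLinearMap.id ℂ V) (((r : ℂ) * cE θ) • e) hd ξ
  simp only [ContinuousLinearMap.id_apply] at h4 hd
  have hd2 : DifferentiableAt ℝ (fun y => Φ (y + ((r : ℂ) * cE θ) • e)) z := by
    have : DifferentiableAt ℝ (fun y : V => y + ((r : ℂ) * cE θ) • e) z := by fun_prop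
    exact DifferentiableAt.comp (g := Φ) z hd this
  rw [dbar_mul hd2 (by fun_prop), dbar_const, h4]; ring

lemma continuous_dbar {Φ : V → ℂ} (hΦ : ContDiff ℝ 1 Φ) (ξ : V) : Continuous (fun y => dbar Φ y ξ) := by
  rw [continuous_iff_continuousAt]
  intro z
  exact continuousAt_dbar hΦ.contDiffAt ξ

lemma KK_inv {e : V} {B : ℝ} (hB : 0 < B) {Φ : V → ℂ} (hΦ : ContDiff ℝ 1 Φ) (z : V)
    (h0 : ∀ θ, Φ (z + ((B : ℂ) * cE θ) • e) = 0) : KK e B (fun y => dbar Φ y e) z = Φ z := by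
  have hc : Continuous cE := cE_contDiff.continuous
  have hpt : ∀ (r θ : ℝ), z + ((r : ℂ) * cE θ) • e = z + r • (cE θ • e) := by
    intro r θ; rw [mul_smul, Complex.coe_smul]
  set A : ℝ → ℂ := fun r => avg (fun θ => Φ (z + r • (cE θ • e)) * 1) with hA
  set D : ℝ → ℂ := fun r => avg (fun θ => fderiv ℝ Φ (z + r • (cE θ • e)) (cE θ • e) * 1) with hD
  have hder : ∀ r, HasDerivAt A (D r) r := fun r =>
    avg_hasDerivAt (C := Φ) (p := fun _ => z) (v := fun θ => cE θ • e) contDiff_const (cE_contDiff.smul contDiff_const)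
      (w := fun _ => 1) contDiff_const (U := univ) isOpen_univ (fun t _ φ => hΦ.contDiffAt) (mem_univ r)
  have hDc : Continuous D := by
    apply avg_param_cont (g := fun (r θ : ℝ) => fderiv ℝ Φ (z + r • (cE θ • e)) (cE θ • e) * 1)
    have h1 : Continuous (fun p : ℝ × ℝ => cE p.2 • e) := (hc.comp continuous_snd).smul continuous_const
    have h2 : Continuous (fun p : ℝ × ℝ => z + p.1 • (cE p.2 • e)) := continuous_const.add (continuous_fst.smul h1)
    exact (((hΦ.continuous_fderiv (by norm_num)).comp h2).clm_apply h1).mul continuous_const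
  have hftc := intervalIntegral.integral_eq_sub_of_hasDerivAt (f := A) (f' := D) (a := 0) (b := B) (fun r _ => hder r) (hDc.intervalIntegrable _ _)
  have hA0 : A 0 = Φ z := by simp [hA, avg_const]
  have hAB : A B = 0 := by
    simp only [hA, mul_one]
    have : (fun θ => Φ (z + B • (cE θ • e))) = fun _ => 0 := by
      ext θ; rw [← hpt, h0]
    rw [this, avg_const]
  have hcongr : ∫ r in (0:ℝ)..B, D r = ∫ r in (0:ℝ)..B, 2 * avg (fun θ => dbar Φ (z + ((r : ℂ) * cE θ) • e) e * cE (-θ)) := by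
    apply intervalIntegral.integral_congr_ae
    refine Eventually.of_forall fun r hr => ?_
    rw [uIoc_of_le hB.le] at hr
    have hm := modeA1 (C := Φ) (q := z) (e := e) (t := r) 0 (fun φ => hΦ.contDiffAt)
    simp only [Nat.cast_zero, zero_mul, neg_zero, cE_zero, mul_one, add_zero] at hm
    have hr0 : (r : ℂ) ≠ 0 := by exact_mod_cast hr.1.ne'
    have hm2 := mul_left_cancel₀ hr0 hm
    simp only [hD, mul_one, ← hpt]
    rw [hm2, ← avg_const_mul]
    congr 1
    ext θ
    rw [dbar_smul_dir, conj_cE]; ring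
  rw [hA0, hAB, hcongr, intervalIntegral.integral_const_mul] at hftc
  unfold KK
  linear_combination -hftc

end KKsec

section Cutoff
variable {V : Type*} [NormedAddCommGroup V] [NormedSpace ℂ V]

lemma dbar_dir_c1 {χ : V → ℂ} (h : ContDiff ℝ 2 χ) (ξ : V) : ContDiff ℝ 1 (fun y => dbar χ y ξ) := by
  have h1 : ContDiff ℝ 1 (fderiv ℝ χ) := h.fderiv_right (by norm_num)
  unfold dbar
  exact ((h1.clm_apply contDiff_const).add (contDiff_const.mul (h1.clm_apply contDiff_const))).div_const _

lemma dbar_symm {χ : V → ℂ} (h : ContDiff ℝ 2 χ) (z ξ η : V) :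
    dbar (fun y => dbar χ y ξ) z η = dbar (fun y => dbar χ y η) z ξ := by
  have h1 : ContDiff ℝ 1 (fderiv ℝ χ) := h.fderiv_right (by norm_num)
  have h2 : HasFDerivAt (fderiv ℝ χ) (fderiv ℝ (fderiv ℝ χ) z) z := (h1.contDiffAt.differentiableAt (by norm_num)).hasFDerivAt
  have hs : ∀ a b, fderiv ℝ (fderiv ℝ χ) z a b = fderiv ℝ (fderiv ℝ χ) z b a := by
    have := (h.contDiffAt (x := z)).isSymmSndFDerivAt (by simp)
    exact fun a b => this a b
  have hd : ∀ a v, fderiv ℝ (fun y => dbar χ y a) z v =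
      (fderiv ℝ (fderiv ℝ χ) z v a + Complex.I * fderiv ℝ (fderiv ℝ χ) z v (Complex.I • a)) / 2 := by
    intro a v
    have e1 : ∀ b, HasFDerivAt (fun y => fderiv ℝ χ y b) ((fderiv ℝ (fderiv ℝ χ) z).flip b) z := by
      intro b
      have := h2.clm_apply (hasFDerivAt_const b z)
      simpa using this
    have e2 := ((e1 a).fun_add ((e1 (Complex.I • a)).const_mul Complex.I)).mul_const (2:ℂ)⁻¹
    have e3 : (fun y => dbar χ y a) = fun y => (fderiv ℝ χ y a + Complex.I * fderiv ℝ χ y (Complex.I • a)) * (2:ℂ)⁻¹ := by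
      ext y; simp only [dbar]; ring
    rw [e3, e2.fderiv]
    simp
    ring
  simp only [dbar.eq_1 (fun y => dbar χ y ξ), dbar.eq_1 (fun y => dbar χ y η), hd]
  rw [hs η ξ, hs η (Complex.I • ξ), hs (Complex.I • η) ξ, hs (Complex.I • η) (Complex.I • ξ)]
  ring

lemma cutoff (X : Coord V) (M : ℕ) {R1 R2 : ℝ} (h12 : R1 < R2) : ∃ χ : V → ℂ, ContDiff ℝ 2 χ ∧
    (∀ z, χ z = χ (X.pr M z)) ∧ (∀ z, X.nrm M z ≤ R1 → χ z = 1) ∧ (∀ z, R2 ≤ X.nrm M z → χ z = 0) := by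
  set ε : ℝ := (R2 - R1) / (2 * (M + 1)) with hε
  have hM : (0:ℝ) < 2 * (M + 1) := by positivity
  have hε0 : 0 < ε := div_pos (by linarith) hM
  set φ : V → ℝ := fun z => ∑ i ∈ Finset.range M, Real.sqrt (‖X.x i z‖ ^ 2 + ε ^ 2) with hφ
  have hφc : ContDiff ℝ 2 φ := by
    apply ContDiff.sum
    intro i _
    apply ContDiff.sqrt
    · have h1 : ContDiff ℝ 2 (fun z => X.x i z) := ((X.x i).restrictScalars ℝ).contDiff
      exact (h1.norm_sq ℝ).add contDiff_const
    · intro z; positivity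
  have hφ1 : ∀ z, X.nrm M z ≤ φ z := by
    intro z
    refine Finset.sum_le_sum fun i _ => Real.le_sqrt_of_sq_le ?_
    nlinarith [sq_nonneg ε]
  have hφ2 : ∀ z, φ z ≤ X.nrm M z + M * ε := by
    intro z
    have : φ z ≤ ∑ i ∈ Finset.range M, (‖X.x i z‖ + ε) := by
      refine Finset.sum_le_sum fun i _ => ?_
      rw [Real.sqrt_le_left (by positivity)]
      nlinarith [mul_nonneg (norm_nonneg (X.x i z)) hε0.le]
    refine this.trans (le_of_eq ?_)
    rw [Finset.sum_add_distrib]; simp [Coord.nrm]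
  have hMε : M * ε ≤ (R2 - R1) / 2 := by
    have : (M + 1) * ε = (R2 - R1) / 2 := by rw [hε]; field_simp
    nlinarith
  refine ⟨fun z => (Real.smoothTransition ((R2 - φ z) / ((R2 - R1) / 2)) : ℝ), ?_, ?_, ?_, ?_⟩
  · refine Complex.ofRealCLM.contDiff.comp (Real.smoothTransition.contDiff.comp ?_)
    exact (contDiff_const.sub hφc).div_const _
  · intro z
    have : φ (X.pr M z) = φ z := by
      simp only [hφ]
      refine Finset.sum_congr rfl fun i hi => ?_
      rw [X.x_pr, if_pos (Finset.mem_range.1 hi)]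
    simp only [this]
  · intro z hz
    have := hφ2 z
    simp only
    rw [Real.smoothTransition.one_of_one_le, Complex.ofReal_one]
    rw [le_div_iff₀ (by linarith)]; linarith
  · intro z hz
    have := hφ1 z
    simp only
    rw [Real.smoothTransition.zero_of_nonpos, Complex.ofReal_zero]
    apply div_nonpos_of_nonpos_of_nonneg <;> linarith

end Cutoff

section Exist1
variable {V : Type*} [NormedAddCommGroup V] [NormedSpace ℂ V]

structure Cyl1 (X : Coord V) (N : ℕ) (R : ℝ) (F : V → ℂ) : Prop where
  cyl : ∀ z, F z = F (X.pr N z)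
  c1 : ∀ z, X.nrm N z < R → ContDiffAt ℝ 1 F z

lemma cyl_dbar {X : Coord V} {N : ℕ} {F : V → ℂ} (hc : ∀ z, F z = F (X.pr N z)) {z : V}
    (hd : DifferentiableAt ℝ F (X.pr N z)) (ξ : V) : dbar F z ξ = dbar F (X.pr N z) (X.pr N ξ) := by
  have h1 : F = fun y => F (X.pr N y + 0) := by funext y; rw [add_zero]; exact hc y
  have h2 := dbar_comp (u := F) (z := z) (X.pr N) 0 (by rwa [add_zero]) ξ
  rw [add_zero, ← h1] at h2
  exact h2

lemma cyl_dbar2 {X : Coord V} {N : ℕ} {F : V → ℂ} (hc : ∀ z, F z = F (X.pr N z)) {z : V}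
    (hd : DifferentiableAt ℝ F (X.pr N z)) (ξ : V) : dbar F z ξ = dbar F z (X.pr N ξ) := by
  rw [cyl_dbar hc hd ξ, cyl_dbar hc hd (X.pr N ξ), X.pr_pr N N le_rfl]

lemma cyl_dbar_sum {X : Coord V} {N : ℕ} {F : V → ℂ} (hc : ∀ z, F z = F (X.pr N z)) {z : V}
    (hd : DifferentiableAt ℝ F (X.pr N z)) (ξ : V) :
    dbar F z ξ = ∑ i ∈ Finset.range N, (starRingEnd ℂ) (X.x i ξ) * dbar F z (X.e i) := by
  rw [cyl_dbar2 hc hd ξ, X.pr_apply, dbar_sum_dir]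
  simp only [dbar_smul_dir]

lemma Cyl1.diff {X : Coord V} {N : ℕ} {R : ℝ} {F : V → ℂ} (h : Cyl1 X N R F) {z : V} (hz : X.nrm N z < R) :
    DifferentiableAt ℝ F z := (h.c1 z hz).differentiableAt (by norm_num)

lemma Cyl1.diffpr {X : Coord V} {N : ℕ} {R : ℝ} {F : V → ℂ} (h : Cyl1 X N R F) {z : V} (hz : X.nrm N z < R) :
    DifferentiableAt ℝ F (X.pr N z) := h.diff (by rwa [X.nrm_pr])

lemma cut_c1 {X : Coord V} {M : ℕ} {R2 R : ℝ} (h2 : R2 < R) {ψ F : V → ℂ} (hψ : ContDiff ℝ 1 ψ)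
    (h0 : ∀ z, R2 < X.nrm M z → ψ z = 0) (hF : ∀ z, X.nrm M z < R → ContDiffAt ℝ 1 F z) :
    ContDiff ℝ 1 (fun z => ψ z * F z) := by
  rw [contDiff_iff_contDiffAt]
  intro z
  rcases lt_or_ge (X.nrm M z) R with h | h
  · exact hψ.contDiffAt.mul (hF z h)
  · have : ∀ᶠ y in 𝓝 z, R2 < X.nrm M y :=
      continuousAt_const.eventually_lt (X.continuous_nrm M).continuousAt (lt_of_lt_of_le h2 h)
    refine (contDiffAt_const (c := (0:ℂ))).congr_of_eventuallyEq ?_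
    filter_upwards [this] with y hy
    simp [h0 y hy]

lemma dbar_zero_of_ev {F : V → ℂ} {z : V} {c : ℂ} (h : ∀ᶠ y in 𝓝 z, F y = c) (ξ : V) : dbar F z ξ = 0 := by
  rw [dbar_congr (v := fun _ => c) h, dbar_const]

lemma KK_cyl {X : Coord V} {N : ℕ} {B : ℝ} {Φ : V → ℂ} (hc : ∀ z, Φ z = Φ (X.pr (N+1) z)) (z : V) :
    KK (X.e N) B Φ z = KK (X.e N) B Φ (X.pr (N+1) z) := by
  have : ∀ c : ℂ, Φ (z + c • X.e N) = Φ (X.pr (N+1) z + c • X.e N) := by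
    intro c
    rw [hc, map_add, map_smul, X.pr_e, if_pos (Nat.lt_succ_self N)]
  simp only [KK, this]

set_option maxHeartbeats 2000000 in
lemma E3 (X : Coord V) (N : ℕ) {R1 R2 R : ℝ} (h0 : 0 < R1) (h12 : R1 < R2) (h2 : R2 < R) {F : ℕ → V → ℂ}
    (hF : ∀ i < N+1, Cyl1 X (N+1) R (F i))
    (hcl : ∀ i < N+1, ∀ k < N+1, ∀ z, X.nrm (N+1) z < R → dbar (F i) z (X.e k) = dbar (F k) z (X.e i)) :
    ∃ (v : V → ℂ) (G : ℕ → V → ℂ), ContDiff ℝ 1 v ∧ (∀ z, v z = v (X.pr (N+1) z)) ∧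
      (∀ i < N, ContDiff ℝ 1 (G i) ∧ ∀ z, G i z = G i (X.pr (N+1) z)) ∧
      ∀ z, X.nrm (N+1) z < R1 → dbar v z (X.e N) = F N z ∧ (∀ i < N, dbar v z (X.e i) = F i z - G i z) ∧
        (∀ i < N, dbar (G i) z (X.e N) = 0) ∧ ∀ i < N, ∀ k < N, dbar (G i) z (X.e k) = dbar (G k) z (X.e i) := by
  obtain ⟨χ, hχ, hχc, hχ1, hχ0⟩ := cutoff X (N+1) h12
  have hχ' : ContDiff ℝ 1 χ := hχ.of_le (by norm_num)
  have hdiff : ∀ {u : V → ℂ}, ContDiff ℝ 1 u → ∀ z, DifferentiableAt ℝ u z := fun hu z =>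
    hu.contDiffAt.differentiableAt (by norm_num)
  have hnc := X.continuous_nrm (N+1)
  have hχev : ∀ z, R2 < X.nrm (N+1) z → ∀ᶠ y in 𝓝 z, R2 < X.nrm (N+1) y := fun z hz =>
    continuousAt_const.eventually_lt hnc.continuousAt hz
  have hdχ0 : ∀ z, R2 < X.nrm (N+1) z → ∀ ξ, dbar χ z ξ = 0 := by
    intro z hz ξ
    apply dbar_zero_of_ev (c := 0)
    filter_upwards [hχev z hz] with y hy using hχ0 y hy.le
  have hdχ1 : ∀ z, X.nrm (N+1) z < R1 → ∀ ξ, dbar χ z ξ = 0 := by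
    intro z hz ξ
    apply dbar_zero_of_ev (c := 1)
    filter_upwards [hnc.continuousAt.eventually_lt continuousAt_const hz] with y hy using hχ1 y (le_of_lt hy)
  have hdc : ∀ ξ, ContDiff ℝ 1 (fun y => dbar χ y ξ) := fun ξ => dbar_dir_c1 hχ ξ
  have hFc : ∀ i < N+1, ∀ z, X.nrm (N+1) z < R → ContDiffAt ℝ 1 (F i) z := fun i hi => (hF i hi).c1
  -- χ F_i
  have hcF : ∀ i < N+1, ContDiff ℝ 1 (fun z => χ z * F i z) := fun i hi =>
    cut_c1 h2 hχ' (fun z hz => hχ0 z hz.le) (hFc i hi)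
  set W : ℕ → ℕ → V → ℂ := fun a b z => dbar χ z (X.e a) * F b z - dbar χ z (X.e b) * F a z with hW
  have hWc1 : ∀ a < N+1, ∀ b < N+1, ContDiff ℝ 1 (W a b) := fun a ha b hb =>
    (cut_c1 h2 (hdc _) (fun z hz => hdχ0 z hz _) (hFc b hb)).sub (cut_c1 h2 (hdc _) (fun z hz => hdχ0 z hz _) (hFc a ha))
  have hW0 : ∀ a b z, R2 < X.nrm (N+1) z → W a b z = 0 := by
    intro a b z hz; simp [hW, hdχ0 z hz]
  have hW1 : ∀ a b z, X.nrm (N+1) z < R1 → W a b z = 0 := by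
    intro a b z hz; simp [hW, hdχ1 z hz]
  have hWcyl : ∀ a < N+1, ∀ b < N+1, ∀ z, W a b z = W a b (X.pr (N+1) z) := by
    intro a ha b hb z
    have h1 : ∀ c < N+1, dbar χ z (X.e c) = dbar χ (X.pr (N+1) z) (X.e c) := by
      intro c hc
      rw [cyl_dbar hχc (hdiff hχ' _), X.pr_e, if_pos hc]
    simp only [hW]
    rw [h1 a ha, h1 b hb, ← (hF b hb).cyl z, ← (hF a ha).cyl z]
  -- dbar outside
  have hdW : ∀ a b z ξ, R2 < X.nrm (N+1) z → dbar (W a b) z ξ = 0 := by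
    intro a b z ξ hz
    apply dbar_zero_of_ev (c := 0)
    filter_upwards [hχev z hz] with y hy using hW0 a b y hy
  have hdcF : ∀ a z ξ, R2 < X.nrm (N+1) z → dbar (fun z => χ z * F a z) z ξ = 0 := by
    intro a z ξ hz
    apply dbar_zero_of_ev (c := 0)
    filter_upwards [hχev z hz] with y hy
    rw [hχ0 y hy.le, zero_mul]
  -- identities
  have id1 : ∀ i < N, ∀ z, dbar (fun z => χ z * F i z) z (X.e N) =
      dbar (fun z => χ z * F N z) z (X.e i) + W N i z := by
    intro i hi z
    rcases lt_or_ge (X.nrm (N+1) z) R with h | h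
    · rw [dbar_mul (hdiff hχ' z) ((hF i (by omega)).diff h), dbar_mul (hdiff hχ' z) ((hF N (by omega)).diff h),
        hcl i (by omega) N (by omega) z h]
      simp only [hW]; ring
    · have h' : R2 < X.nrm (N+1) z := lt_of_lt_of_le h2 h
      rw [hdcF _ _ _ h', hdcF _ _ _ h', hW0 _ _ _ h']; ring
  have hdWe : ∀ a < N+1, ∀ b < N+1, ∀ z, X.nrm (N+1) z < R → ∀ ξ, dbar (W a b) z ξ =
      dbar χ z (X.e a) * dbar (F b) z ξ + dbar (fun y => dbar χ y (X.e a)) z ξ * F b z -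
      (dbar χ z (X.e b) * dbar (F a) z ξ + dbar (fun y => dbar χ y (X.e b)) z ξ * F a z) := by
    intro a ha b hb z hz ξ
    have d1 := hdiff (hdc (X.e a)) z
    have d2 := hdiff (hdc (X.e b)) z
    have d3 := (hF a ha).diff hz
    have d4 := (hF b hb).diff hz
    simp only [hW]
    rw [dbar_sub (d1.fun_mul d4) (d2.fun_mul d3), dbar_mul d1 d4, dbar_mul d2 d3]
  have id2 : ∀ i < N, ∀ k < N, ∀ z, dbar (W N k) z (X.e i) = dbar (W N i) z (X.e k) + dbar (W i k) z (X.e N) := by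
    intro i hi k hk z
    rcases lt_or_ge (X.nrm (N+1) z) R with h | h
    · rw [hdWe N (by omega) k (by omega) z h, hdWe N (by omega) i (by omega) z h, hdWe i (by omega) k (by omega) z h]
      rw [dbar_symm hχ z (X.e k) (X.e i), dbar_symm hχ z (X.e i) (X.e N), dbar_symm hχ z (X.e k) (X.e N),
        hcl k (by omega) i (by omega) z h, hcl N (by omega) i (by omega) z h, hcl N (by omega) k (by omega) z h]
      ring
    · have h' : R2 < X.nrm (N+1) z := lt_of_lt_of_le h2 h
      rw [hdW _ _ _ _ h', hdW _ _ _ _ h', hdW _ _ _ _ h']; ring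
  have hR2 : 0 < R2 := h0.trans h12
  have hfar : ∀ z, X.nrm (N+1) z < R1 → ∀ θ, R2 < X.nrm (N+1) (z + (((2 * R2 : ℝ) : ℂ) * cE θ) • X.e N) := by
    intro z hz θ
    rw [X.nrm_succ] at hz ⊢
    have h3 : X.x N (z + (((2 * R2 : ℝ) : ℂ) * cE θ) • X.e N) = X.x N z + ((2 * R2 : ℝ) : ℂ) * cE θ := by
      rw [map_add, map_smul, X.x_e]; simp
    rw [h3]
    have h4 := norm_sub_norm_le (((2 * R2 : ℝ) : ℂ) * cE θ) (-X.x N z)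
    rw [norm_mul, norm_cE, Complex.norm_real, Real.norm_of_nonneg (by positivity), norm_neg, sub_neg_eq_add, add_comm (((2 * R2 : ℝ) : ℂ) * cE θ)] at h4
    linarith [X.nrm_nonneg N z, X.nrm_nonneg N (z + (((2 * R2 : ℝ) : ℂ) * cE θ) • X.e N)]
  have hB : (0:ℝ) < 2 * R2 := by positivity
  refine ⟨KK (X.e N) (2 * R2) (fun z => χ z * F N z), fun i => KK (X.e N) (2 * R2) (W N i), KK_c1 (hcF N (by omega)), ?_, ?_, ?_⟩
  · apply KK_cyl
    intro z
    rw [← hχc z, ← (hF N (by omega)).cyl z]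
  · intro i hi
    exact ⟨KK_c1 (hWc1 N (by omega) i (by omega)), KK_cyl (hWcyl N (by omega) i (by omega))⟩
  intro z hz
  have hχz : χ z = 1 := hχ1 z hz.le
  have hinv1 : ∀ i < N+1, KK (X.e N) (2 * R2) (fun y => dbar (fun z => χ z * F i z) y (X.e N)) z = F i z := by
    intro i hi
    rw [KK_inv hB (hcF i hi) z (fun θ => by rw [hχ0 _ (hfar z hz θ).le, zero_mul]), hχz, one_mul]
  have hinv2 : ∀ a < N+1, ∀ b < N+1, KK (X.e N) (2 * R2) (fun y => dbar (W a b) y (X.e N)) z = 0 := by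
    intro a ha b hb
    rw [KK_inv hB (hWc1 a ha b hb) z (fun θ => hW0 _ _ _ (hfar z hz θ)), hW1 _ _ _ hz]
  refine ⟨?_, ?_, ?_, ?_⟩
  · rw [KK_dbar (hcF N (by omega)), hinv1 N (by omega)]
  · intro i hi
    rw [KK_dbar (hcF N (by omega)), eq_sub_iff_add_eq, ← KK_add (continuous_dbar (hcF N (by omega)) _) (hWc1 N (by omega) i (by omega)).continuous]
    simp only [← id1 i hi]
    exact hinv1 i (by omega)
  · intro i hi
    rw [KK_dbar (hWc1 N (by omega) i (by omega)), hinv2 N (by omega) i (by omega)]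
  · intro i hi k hk
    rw [KK_dbar (hWc1 N (by omega) i (by omega)), KK_dbar (hWc1 N (by omega) k (by omega))]
    simp only [id2 i hi k hk]
    rw [KK_add (continuous_dbar (hWc1 N (by omega) i (by omega)) _) (continuous_dbar (hWc1 i (by omega) k (by omega)) _),
      hinv2 i (by omega) k (by omega), add_zero]

end Exist1

section Exist2
variable {V : Type*} [NormedAddCommGroup V] [NormedSpace ℂ V]

lemma cpt_bound (X : Coord V) (M : ℕ) (ρ : ℝ) {W : Type*} [NormedAddCommGroup W] {D : V → W}
    (hD : ∀ z, X.nrm M z ≤ ρ → ContinuousAt D z) :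
    ∃ K, 0 ≤ K ∧ ∀ z, X.nrm M z ≤ ρ → ‖D (X.pr M z)‖ ≤ K := by
  set L : (Fin M → ℂ) → V := fun a => ∑ i : Fin M, a i • X.e i with hL
  have hLc : Continuous L := by
    apply continuous_finsetSum
    intro i _
    exact (continuous_apply i).smul continuous_const
  set S : Set (Fin M → ℂ) := {a | ∑ i, ‖a i‖ ≤ ρ} with hS
  have hScl : IsClosed S := by
    apply isClosed_le _ continuous_const
    apply continuous_finsetSum
    intro i _
    exact (continuous_apply i).norm
  have hSb : Bornology.IsBounded S := by
    refine (Metric.isBounded_closedBall (x := (0 : Fin M → ℂ)) (r := max ρ 0)).subset ?_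
    intro a ha
    rw [mem_closedBall_zero_iff, pi_norm_le_iff_of_nonneg (le_max_right _ _)]
    intro i
    refine le_trans ?_ (le_trans (show ∑ i, ‖a i‖ ≤ ρ from ha) (le_max_left _ _))
    exact Finset.single_le_sum (f := fun i => ‖a i‖) (fun _ _ => norm_nonneg _) (Finset.mem_univ i)
  have hSc : IsCompact S := Metric.isCompact_of_isClosed_isBounded hScl hSb
  have hx : ∀ a (i : Fin M), X.x i (L a) = a i := by
    intro a i
    simp only [hL, map_sum, map_smul, X.x_e]
    rw [Finset.sum_eq_single i]
    · simp
    · intro k _ hk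
      have : (i : ℕ) ≠ k := fun h => hk (Fin.ext h.symm)
      simp [this]
    · simp
  have hn : ∀ a, X.nrm M (L a) = ∑ i, ‖a i‖ := by
    intro a
    unfold Coord.nrm
    rw [Finset.sum_range]
    simp only [hx]
  have hcont : ContinuousOn (fun a => ‖D (L a)‖) S := by
    intro a ha
    apply ContinuousAt.continuousWithinAt
    have h1 : ContinuousAt D (L a) := hD _ (by rw [hn]; exact ha)
    exact (ContinuousAt.comp (g := D) h1 hLc.continuousAt).norm
  obtain ⟨K, hK⟩ := hSc.bddAbove_image hcont
  refine ⟨max K 0, le_max_right _ _, fun z hz => ?_⟩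
  have h1 : X.pr M z = L (fun i => X.x i z) := by
    rw [X.pr_apply, hL, Finset.sum_range]
  rw [h1]
  refine le_trans (hK (mem_image_of_mem _ ?_)) (le_max_left _ _)
  show ∑ i : Fin M, ‖X.x i z‖ ≤ ρ
  rw [← Finset.sum_range (fun i => ‖X.x i z‖)]
  exact hz

lemma lip_bound (X : Coord V) (M : ℕ) (ρ : ℝ) {G : V → ℂ} (hG : ContDiff ℝ 1 G) (hc : ∀ z, G z = G (X.pr M z)) :
    ∃ K, 0 ≤ K ∧ (∀ z, X.nrm M z ≤ ρ → ‖G z‖ ≤ K) ∧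
      ∀ z z', X.nrm M z ≤ ρ → X.nrm M z' ≤ ρ → ‖G z - G z'‖ ≤ K * ‖z - z'‖ := by
  obtain ⟨K1, h1, hK1⟩ := cpt_bound X M ρ (D := G) (fun z _ => hG.continuous.continuousAt)
  obtain ⟨K2, h2, hK2⟩ := cpt_bound X M ρ (D := fderiv ℝ G) (fun z _ => (hG.continuous_fderiv (by norm_num)).continuousAt)
  refine ⟨max K1 K2, le_max_of_le_left h1, fun z hz => ?_, fun z z' hz hz' => ?_⟩
  · rw [hc]; exact (hK1 z hz).trans (le_max_left _ _)
  · rw [hc z, hc z']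
    set S : Set V := {p | X.pr M p = p ∧ X.nrm M p ≤ ρ} with hS
    have hconv : Convex ℝ S := by
      intro p hp q hq a b ha hb hab
      refine ⟨?_, ?_⟩
      · rw [map_add, ← Complex.coe_smul a, ← Complex.coe_smul b, map_smul, map_smul, hp.1, hq.1]
      · have : X.nrm M (a • p + b • q) ≤ a * X.nrm M p + b * X.nrm M q := by
          unfold Coord.nrm
          rw [Finset.mul_sum, Finset.mul_sum, ← Finset.sum_add_distrib]
          apply Finset.sum_le_sum
          intro i _
          rw [map_add, ← Complex.coe_smul a, ← Complex.coe_smul b, map_smul, map_smul]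
          refine (norm_add_le _ _).trans (le_of_eq ?_)
          rw [norm_smul, norm_smul, Complex.norm_real, Complex.norm_real, Real.norm_of_nonneg ha, Real.norm_of_nonneg hb]
        refine this.trans ?_
        calc a * X.nrm M p + b * X.nrm M q ≤ a * ρ + b * ρ := by
              gcongr
              exacts [hp.2, hq.2]
          _ = ρ := by rw [← add_mul, hab, one_mul]
    have hmem : ∀ z, X.nrm M z ≤ ρ → X.pr M z ∈ S := fun z hz =>
      ⟨X.pr_pr M M le_rfl z, by rwa [X.nrm_pr]⟩
    have h3 := hconv.norm_image_sub_le_of_norm_fderiv_le (𝕜 := ℝ) (f := G) (C := K2)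
      (fun p _ => hG.contDiffAt.differentiableAt (by norm_num)) (fun p hp => by
        have := hK2 p hp.2
        rwa [hp.1] at this) (hmem z' hz') (hmem z hz)
    refine h3.trans ?_
    rw [← map_sub]
    have h4 := (X.norm_pr_le M (z - z')).trans (X.nrm_le M (z - z'))
    have : K2 ≤ max K1 K2 := le_max_right _ _
    gcongr

/-- averaged restriction -/
def Av (X : Coord V) (N m : ℕ) (G : V → ℂ) (w : ℂ) (z : V) : ℂ :=
  avg (fun φ => G (X.pr N z + (w * cE φ) • X.e N) * cE (-(m * φ)))

lemma Av_pt_contDiff (X : Coord V) (N : ℕ) (w : ℂ) :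
    ContDiff ℝ 1 (fun p : V × ℝ => X.pr N p.1 + (w * cE p.2) • X.e N) := by
  have h1 : ContDiff ℝ 1 (fun p : V × ℝ => X.pr N p.1) :=
    ((X.pr N).restrictScalars ℝ).contDiff.comp contDiff_fst
  exact h1.add ((contDiff_const.mul (cE_contDiff.comp contDiff_snd)).smul contDiff_const)

lemma cE_neg_contDiff (m : ℕ) : ContDiff ℝ 1 (fun φ : ℝ => cE (-(m * φ))) :=
  cE_contDiff.comp (contDiff_const.mul contDiff_id).neg

lemma Av_H (X : Coord V) (N m : ℕ) {G : V → ℂ} (hG : ContDiff ℝ 1 G) (w : ℂ) :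
    ContDiff ℝ 1 (fun p : V × ℝ => G (X.pr N p.1 + (w * cE p.2) • X.e N) * cE (-(m * p.2))) :=
  (hG.comp (Av_pt_contDiff X N w)).mul ((cE_neg_contDiff m).comp contDiff_snd)

lemma Av_c1 (X : Coord V) (N m : ℕ) {G : V → ℂ} (hG : ContDiff ℝ 1 G) (w : ℂ) : ContDiff ℝ 1 (Av X N m G w) := by
  rw [contDiff_iff_contDiffAt]
  intro z
  exact contDiffAt_const.mul (P_main (U := univ) isOpen_univ (H := fun z φ => G (X.pr N z + (w * cE φ) • X.e N) * cE (-(m * φ)))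
    (fun z _ φ => (Av_H X N m hG w).contDiffAt) 0 (2 * Real.pi) (mem_univ z)).1

lemma Av_dbar (X : Coord V) (N m : ℕ) {G : V → ℂ} (hG : ContDiff ℝ 1 G) (w : ℂ) (z ξ : V) :
    dbar (Av X N m G w) z ξ = avg (fun φ => dbar G (X.pr N z + (w * cE φ) • X.e N) (X.pr N ξ) * cE (-(m * φ))) := by
  have hP := P_main (U := univ) isOpen_univ (H := fun z φ => G (X.pr N z + (w * cE φ) • X.e N) * cE (-(m * φ)))
    (fun z _ φ => (Av_H X N m hG w).contDiffAt) 0 (2 * Real.pi) (mem_univ z)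
  unfold Av avg
  rw [dbar_const_mul (hP.1.differentiableAt (by norm_num)),
    P_dbar (U := univ) isOpen_univ (H := fun z φ => G (X.pr N z + (w * cE φ) • X.e N) * cE (-(m * φ)))
    (fun z _ φ => (Av_H X N m hG w).contDiffAt) 0 (2 * Real.pi) (mem_univ z)]
  congr 1
  apply intervalIntegral.integral_congr
  intro φ _
  have hd : DifferentiableAt ℝ G (X.pr N z + (w * cE φ) • X.e N) := hG.contDiffAt.differentiableAt (by norm_num)
  have hd2 : DifferentiableAt ℝ (fun y => G (X.pr N y + (w * cE φ) • X.e N)) z := by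
    refine DifferentiableAt.comp (g := G) z hd ?_
    exact (((X.pr N).restrictScalars ℝ).differentiableAt).add_const _
  simp only
  rw [dbar_mul hd2 (differentiableAt_const _), dbar_const, mul_zero, zero_add, dbar_comp (X.pr N) _ hd]

lemma Av_cyl (X : Coord V) (N m : ℕ) (G : V → ℂ) (w : ℂ) (z : V) : Av X N m G w z = Av X N m G w (X.pr N z) := by
  simp only [Av, X.pr_pr N N le_rfl]

lemma norm_Av_le (X : Coord V) (N m : ℕ) {G : V → ℂ} {w : ℂ} {z : V} {ρ A : ℝ}
    (hG : ∀ z, X.nrm (N+1) z ≤ ρ → ‖G z‖ ≤ A) (h : X.nrm N z + ‖w‖ ≤ ρ) : ‖Av X N m G w z‖ ≤ A := by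
  apply norm_avg_le
  intro φ
  rw [norm_mul, norm_cE, mul_one]
  apply hG
  refine (X.nrm_le _ _).trans ((X.norm_pt N z _).trans ?_)
  rwa [norm_mul, norm_cE, mul_one]

lemma Av_lip (X : Coord V) (N m : ℕ) {G : V → ℂ} (hGc : Continuous G) {w w' : ℂ} {z z' : V} {ρ A : ℝ} (hA : 0 ≤ A)
    (hG : ∀ z z', X.nrm (N+1) z ≤ ρ → X.nrm (N+1) z' ≤ ρ → ‖G z - G z'‖ ≤ A * ‖z - z'‖)
    (h : X.nrm N z + ‖w‖ ≤ ρ) (h' : X.nrm N z' + ‖w'‖ ≤ ρ) :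
    ‖Av X N m G w z - Av X N m G w' z'‖ ≤ A * (X.nrm N (z - z') + ‖w - w'‖) := by
  have hc : ∀ (w : ℂ) (z : V), Continuous (fun φ : ℝ => G (X.pr N z + (w * cE φ) • X.e N) * cE (-(m * φ))) := by
    intro w z
    have h1 : Continuous (fun φ : ℝ => X.pr N z + (w * cE φ) • X.e N) :=
      continuous_const.add ((continuous_const.mul cE_continuous).smul continuous_const)
    exact (hGc.comp h1).mul (cE_neg_contDiff m).continuous
  unfold Av
  rw [← avg_sub (hc w z) (hc w' z')]
  apply norm_avg_le
  intro φ
  rw [← sub_mul, norm_mul, norm_cE, mul_one]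
  have hm : ∀ (w : ℂ) (z : V), X.nrm N z + ‖w‖ ≤ ρ → X.nrm (N+1) (X.pr N z + (w * cE φ) • X.e N) ≤ ρ := by
    intro w z h
    refine (X.nrm_le _ _).trans ((X.norm_pt N z _).trans ?_)
    rwa [norm_mul, norm_cE, mul_one]
  refine (hG _ _ (hm w z h) (hm w' z' h')).trans ?_
  gcongr
  have : X.pr N z + (w * cE φ) • X.e N - (X.pr N z' + (w' * cE φ) • X.e N) = X.pr N (z - z') + ((w - w') * cE φ) • X.e N := by
    rw [map_sub, sub_mul, sub_smul]; abel
  rw [this]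
  refine (X.norm_pt N _ _).trans (le_of_eq ?_)
  rw [norm_mul, norm_cE, mul_one]

/-- homogeneity of modes of a holomorphic function, real radii -/
lemma mode_real {G : V → ℂ} {q e : V} {T : ℝ} (m : ℕ) (hC : ContDiff ℝ 1 G)
    (hh : ∀ ζ : ℂ, ‖ζ‖ ≤ T → dbar G (q + ζ • e) e = 0) {a b : ℝ} (ha : 0 ≤ a) (ham : m = 0 ∨ 0 < a) (hab : a ≤ b) (hb : b ≤ T) :
    ((b : ℂ) ^ m)⁻¹ * avg (fun φ => G (q + ((b : ℂ) * cE φ) • e) * cE (-(m * φ))) =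
    ((a : ℂ) ^ m)⁻¹ * avg (fun φ => G (q + ((a : ℂ) * cE φ) • e) * cE (-(m * φ))) := by
  have hpt : ∀ t φ : ℝ, q + ((t : ℂ) * cE φ) • e = q + t • (cE φ • e) := by
    intro t φ; rw [mul_smul, Complex.coe_smul]
  set k : ℝ → ℂ := fun t => avg (fun φ => G (q + ((t : ℂ) * cE φ) • e) * cE (-(m * φ))) with hk
  set k' : ℝ → ℂ := fun t => avg (fun φ => fderiv ℝ G (q + ((t : ℂ) * cE φ) • e) (cE φ • e) * cE (-(m * φ))) with hk'
  have hder : ∀ t, HasDerivAt k (k' t) t := by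
    intro t
    simp only [hk, hk', hpt]
    exact avg_hasDerivAt (C := G) (p := fun _ => q) (v := fun φ => cE φ • e) contDiff_const
      (cE_contDiff.smul contDiff_const) (cE_neg_contDiff m) (U := univ) isOpen_univ
      (fun t _ φ => hC.contDiffAt) (mem_univ t)
  have hode : ∀ t, 0 ≤ t → t ≤ T → t * k' t = m * k t := by
    intro t h0 ht
    have h1 := modeA1 (C := G) (q := q) (e := e) (t := t) m (fun φ => hC.contDiffAt)
    have h2 : ∀ φ, dbar G (q + ((t : ℂ) * cE φ) • e) (cE φ • e) = 0 := by
      intro φ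
      rw [dbar_smul_dir, hh _ (by rw [norm_mul, norm_cE, mul_one, Complex.norm_real, Real.norm_of_nonneg h0]; exact ht), mul_zero]
    simp only [h2, mul_zero, zero_mul, avg_const, zero_add] at h1
    exact h1
  have hne : ∀ t ∈ Icc a b, (t : ℂ) ^ m ≠ 0 := by
    intro t ht
    rcases ham with h | h
    · rw [h]; simp
    · exact pow_ne_zero _ (Complex.ofReal_ne_zero.2 (by linarith [ht.1]))
  have hcp : Continuous (fun t : ℝ => (t : ℂ) ^ m) := (Complex.continuous_ofReal).pow m
  have hcont : ContinuousOn (fun t : ℝ => ((t : ℂ) ^ m)⁻¹ * k t) (Icc a b) := by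
    intro t ht
    apply ContinuousAt.continuousWithinAt
    exact (hcp.continuousAt.inv₀ (hne t ht)).mul (hder t).continuousAt
  have hd : ∀ t ∈ Ioo a b, HasDerivAt (fun t : ℝ => ((t : ℂ) ^ m)⁻¹ * k t) 0 t := by
    intro t ht
    have ht0 : (t : ℂ) ≠ 0 := Complex.ofReal_ne_zero.2 (by linarith [ht.1])
    have hp : HasDerivAt (fun t : ℝ => (t : ℂ) ^ m) ((m : ℂ) * (t : ℂ) ^ (m - 1)) t := by
      have h1 : HasDerivAt (fun t : ℝ => (t : ℂ)) 1 t := Complex.ofRealCLM.hasDerivAt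
      have := h1.fun_pow m
      exact this.congr_deriv (by simp)
    have h1 := (hp.fun_inv (hne t (Ioo_subset_Icc_self ht))).fun_mul (hder t)
    refine h1.congr_deriv ?_
    have h2 := hode t (by linarith [ht.1]) (by linarith [ht.2])
    have h3 : k' t = m * k t / t := by rw [eq_div_iff ht0, mul_comm]; exact h2
    rw [h3]
    rcases Nat.eq_zero_or_pos m with rfl | hm
    · simp
    · obtain ⟨n, rfl⟩ := Nat.exists_eq_succ_of_ne_zero hm.ne'
      simp only [Nat.succ_eq_add_one, Nat.add_sub_cancel]
      field_simp
      ring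
  have h5 := mv_bound hab hcont (f' := fun _ => 0) hd (K := 0) (fun t _ => by simp)
  rw [zero_mul] at h5
  exact sub_eq_zero.1 (norm_le_zero_iff.1 h5)

lemma mode_cplx {G : V → ℂ} {q e : V} {T : ℝ} (m : ℕ) (hC : ContDiff ℝ 1 G)
    (hh : ∀ ζ : ℂ, ‖ζ‖ ≤ T → dbar G (q + ζ • e) e = 0) {η : ℝ} (hη : 0 < η) (hηT : η ≤ T) {w : ℂ} (hw : ‖w‖ ≤ T) :
    w ^ m * (((η : ℂ) ^ m)⁻¹ * avg (fun φ => G (q + ((η : ℂ) * cE φ) • e) * cE (-(m * φ)))) =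
    avg (fun φ => G (q + (w * cE φ) • e) * cE (-(m * φ))) := by
  set k : ℝ → ℂ := fun t => avg (fun φ => G (q + ((t : ℂ) * cE φ) • e) * cE (-(m * φ))) with hk
  have hT0 : 0 ≤ T := hη.le.trans hηT
  by_cases hw0 : w = 0
  · subst hw0
    rcases Nat.eq_zero_or_pos m with rfl | hm
    · have := mode_real 0 hC hh (a := 0) (b := η) le_rfl (Or.inl rfl) hη.le hηT
      rw [pow_zero, one_mul, this]
      simp
    · have h1 : (fun φ : ℝ => G (q + ((0:ℂ) * cE φ) • e) * cE (-(m * φ))) = fun φ : ℝ => G q * cE (-(m * φ)) := by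
        funext φ; simp
      rw [h1, avg_const_mul, avg_cE_neg hm.ne', zero_pow hm.ne']; simp
  · have hn : 0 < ‖w‖ := norm_pos_iff.2 hw0
    have h1 : ((η : ℂ) ^ m)⁻¹ * k η = ((‖w‖ : ℂ) ^ m)⁻¹ * k ‖w‖ := by
      rcases le_total η ‖w‖ with h | h
      · exact (mode_real m hC hh hη.le (Or.inr hη) h hw).symm
      · exact mode_real m hC hh hn.le (Or.inr hn) h hηT
    rw [h1]
    have hwp : w = ‖w‖ * cE w.arg := by
      rw [cE]; exact (Complex.norm_mul_exp_arg_mul_I w).symm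
    have hsh := avg_shift (f := fun φ : ℝ => G (q + ((‖w‖ : ℂ) * cE φ) • e) * cE (-(m * φ)))
      (fun φ => by rw [cE_periodic, cE_neg_nat_periodic]) w.arg
    simp only [hk]
    rw [← hsh, ← mul_assoc, ← avg_const_mul]
    congr 1
    funext φ
    have h3 : (‖w‖ : ℂ) * cE (φ + w.arg) = w * cE φ := by
      rw [cE_add]
      conv_rhs => rw [hwp]
      ring
    have h4 : cE (-(m * (φ + w.arg))) = cE (-(m * φ)) * (cE w.arg ^ m)⁻¹ := by
      rw [← cE_nat, ← cE_neg, ← cE_add]; congr 1; ring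
    have h5 : w ^ m = (‖w‖ : ℂ) ^ m * cE w.arg ^ m := by rw [← mul_pow, ← hwp]
    rw [h3, h4, h5]
    have h6 : (‖w‖ : ℂ) ^ m ≠ 0 := pow_ne_zero _ (Complex.ofReal_ne_zero.2 hn.ne')
    have h7 : cE w.arg ^ m ≠ 0 := pow_ne_zero _ (cE_ne_zero _)
    field_simp

/-- Taylor expansion -/
lemma taylor_hasSum {G : V → ℂ} {q e : V} {T : ℝ} (hC : ContDiff ℝ 1 G)
    (hh : ∀ ζ : ℂ, ‖ζ‖ ≤ T → dbar G (q + ζ • e) e = 0) {η : ℝ} (hη : 0 < η) (hηT : η ≤ T) {w : ℂ} (hw : ‖w‖ < T) :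
    HasSum (fun m : ℕ => w ^ m * (((η : ℂ) ^ m)⁻¹ * avg (fun φ => G (q + ((η : ℂ) * cE φ) • e) * cE (-(m * φ)))))
      (G (q + w • e)) := by
  have hT : 0 < T := hη.trans_le hηT
  have hg : Continuous (fun φ : ℝ => G (q + ((T : ℂ) * cE φ) • e)) :=
    hC.continuous.comp (continuous_const.add ((continuous_const.mul cE_continuous).smul continuous_const))
  have h1 := geom_kernel_hasSum hw hg
  have h2 := discA2 (C := G) (q := q) (e := e) (T := T) (K := 0) hw (fun ζ _ => hC.contDiffAt)
    (fun ζ hζ => by rw [hh ζ hζ, norm_zero])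
  rw [mul_zero] at h2
  refine hasSum_congr' h1 (fun m => ?_) (sub_eq_zero.1 (norm_le_zero_iff.1 h2))
  have h3 := mode_cplx m hC hh hη hηT (w := (T : ℂ)) (by rw [Complex.norm_real, Real.norm_of_nonneg hT.le])
  rw [← h3]
  have h6 : (T : ℂ) ^ m ≠ 0 := pow_ne_zero _ (Complex.ofReal_ne_zero.2 hT.ne')
  field_simp

end Exist2

section Exist3
variable {V : Type*} [NormedAddCommGroup V] [NormedSpace ℂ V]

def ExistN (X : Coord V) (N : ℕ) : Prop := ∀ R : ℝ, 0 < R → ∀ F : ℕ → V → ℂ, (∀ i < N, Cyl1 X N R (F i)) →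
  (∀ i < N, ∀ k < N, ∀ z, X.nrm N z < R → dbar (F i) z (X.e k) = dbar (F k) z (X.e i)) →
  ∀ R', 0 < R' → R' < R → ∃ u, Cyl1 X N R' u ∧ ∀ z, X.nrm N z < R' → ∀ i < N, dbar u z (X.e i) = F i z

lemma x_pt (X : Coord V) (N : ℕ) (z : V) (w : ℂ) : X.x N (X.pr N z + w • X.e N) = w := by
  rw [map_add, map_smul, X.x_pr, X.x_e]; simp

lemma pr_pt (X : Coord V) (N : ℕ) (z : V) (w : ℂ) : X.pr N (X.pr N z + w • X.e N) = X.pr N z := by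
  rw [map_add, map_smul, X.pr_pr N N le_rfl, X.pr_e]; simp

lemma sum_conj_le (X : Coord V) (N : ℕ) {ξ : V} {b : ℕ → ℂ} {A : ℝ} (hA : 0 ≤ A) (hb : ∀ i < N, ‖b i‖ ≤ A) :
    ‖∑ i ∈ Finset.range N, (starRingEnd ℂ) (X.x i ξ) * b i‖ ≤ A * ‖ξ‖ := by
  calc ‖∑ i ∈ Finset.range N, (starRingEnd ℂ) (X.x i ξ) * b i‖ ≤ ∑ i ∈ Finset.range N, ‖X.x i ξ‖ * A := by
        refine (norm_sum_le _ _).trans (Finset.sum_le_sum fun i hi => ?_)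
        rw [norm_mul, RCLike.norm_conj]
        exact mul_le_mul_of_nonneg_left (hb i (Finset.mem_range.1 hi)) (norm_nonneg _)
    _ = A * ∑ i ∈ Finset.range N, ‖X.x i ξ‖ := by rw [← Finset.sum_mul, mul_comm]
    _ ≤ A * ‖ξ‖ := mul_le_mul_of_nonneg_left (X.sum_le N ξ) hA

/-- the parameter record for the constant bound -/
def constPar (r s A : ℝ) (hs : 0 < s) (hsr : s < r) (hA : 0 ≤ A) : Par :=
  ⟨r, s, fun _ => A, fun _ => s, hs, hsr, fun _ => hA, fun _ => hs, fun _ => le_rfl⟩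

lemma constPar_HB (r s A : ℝ) (hs : 0 < s) (hsr : s < r) (hA : 0 ≤ A) : HB (constPar r s A hs hsr hA) := by
  intro ρ1 ρ h1 h2 h3
  simp only [constPar] at h3 ⊢
  refine ⟨4 * ρ ^ 3 * A + 2 * A * s * ρ1, ?_, fun j => ?_⟩
  · have : 0 ≤ 2 * A * s * ρ1 := by positivity
    linarith
  · have hρ : 0 < ρ := h1.trans h2
    rw [max_eq_right h3.le, min_eq_left h3.le, ← div_eq_mul_inv, ← div_eq_mul_inv, div_le_div_iff₀ (by positivity) (by positivity)]
    have h4 : ρ1 ^ j ≤ ρ ^ j := pow_le_pow_left₀ h1.le h2.le j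
    calc 2 * A * (s - ρ) * ρ1 ^ (j+1) ≤ 2 * A * s * ρ1 ^ (j+1) := by
          gcongr
          linarith
      _ = 2 * A * s * ρ1 * ρ1 ^ j := by ring
      _ ≤ (4 * ρ ^ 3 * A + 2 * A * s * ρ1) * ρ ^ j := by
          apply mul_le_mul _ h4 (by positivity) (by positivity)
          have : 0 ≤ 4 * ρ ^ 3 * A := by positivity
          linarith

lemma DD_le_G {P : Par} {ρ1 ρ δ : ℝ} {γ G : ℕ → ℝ} {β : ℝ} (t : Tup P ρ1 ρ δ γ G β) (i m : ℕ) : DD m ≤ G i * γ i ^ m := by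
  rcases Nat.eq_zero_or_pos m with rfl | hm
  · simpa [DD] using t.hG i
  · have h1 := DD_le m hm.ne'
    have h2 := t.hGγ i m hm.ne'
    have : 0 ≤ Real.exp 1 * m := by positivity
    linarith

set_option maxHeartbeats 4000000 in
lemma Gsolve (X : Coord V) (N : ℕ) (ih : ExistN X N) {s r r' η R1 : ℝ} (hs : 0 < s) (hsr : s < r) (hrr : r < r')
    (hη : 0 < η) (hr'R : r' < R1 - η) {G : ℕ → V → ℂ} (hG : ∀ i < N, ContDiff ℝ 1 (G i))
    (hGc : ∀ i < N, ∀ z, G i z = G i (X.pr (N+1) z))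
    (hGh : ∀ i < N, ∀ z, X.nrm (N+1) z < R1 → dbar (G i) z (X.e N) = 0)
    (hGs : ∀ i < N, ∀ k < N, ∀ z, X.nrm (N+1) z < R1 → dbar (G i) z (X.e k) = dbar (G k) z (X.e i)) :
    ∃ S, Cyl1 X (N+1) s S ∧ ∀ z, X.nrm (N+1) z < s → ∀ ξ, dbar S z ξ =
      ∑ i ∈ Finset.range N, (starRingEnd ℂ) (X.x i ξ) * G i z := by
  have hr : 0 < r := hs.trans hsr
  have hηC : (η : ℂ) ≠ 0 := Complex.ofReal_ne_zero.2 hη.ne'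
  -- bounds
  have hK : ∀ i, ∃ K, 0 ≤ K ∧ (i < N → (∀ z, X.nrm (N+1) z ≤ R1 → ‖G i z‖ ≤ K) ∧
      ∀ z z', X.nrm (N+1) z ≤ R1 → X.nrm (N+1) z' ≤ R1 → ‖G i z - G i z'‖ ≤ K * ‖z - z'‖) := by
    intro i
    by_cases hi : i < N
    · obtain ⟨K, h1, h2, h3⟩ := lip_bound X (N+1) R1 (hG i hi) (hGc i hi)
      exact ⟨K, h1, fun _ => ⟨h2, h3⟩⟩
    · exact ⟨0, le_rfl, fun h => absurd h hi⟩
  choose K hK0 hK1 using hK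
  set A0 : ℝ := ∑ i ∈ Finset.range N, K i with hA0
  have hA0n : 0 ≤ A0 := Finset.sum_nonneg fun i _ => hK0 i
  have hKA : ∀ i < N, K i ≤ A0 := fun i hi =>
    Finset.single_le_sum (f := K) (fun i _ => hK0 i) (Finset.mem_range.2 hi)
  have hGb : ∀ i < N, ∀ z, X.nrm (N+1) z ≤ R1 → ‖G i z‖ ≤ A0 := fun i hi z hz =>
    ((hK1 i hi).1 z hz).trans (hKA i hi)
  have hGl : ∀ i < N, ∀ z z', X.nrm (N+1) z ≤ R1 → X.nrm (N+1) z' ≤ R1 → ‖G i z - G i z'‖ ≤ A0 * ‖z - z'‖ :=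
    fun i hi z z' hz hz' => ((hK1 i hi).2 z z' hz hz').trans (mul_le_mul_of_nonneg_right (hKA i hi) (norm_nonneg _))
  have hpt : ∀ (z : V) (w : ℂ), X.nrm (N+1) (X.pr N z + w • X.e N) ≤ X.nrm N z + ‖w‖ := fun z w =>
    (X.nrm_le _ _).trans (X.norm_pt N z w)
  -- coefficients
  set g : ℕ → ℕ → V → ℂ := fun m i z => ((η : ℂ) ^ m)⁻¹ * Av X N m (G i) η z with hg
  have hgw : ∀ m, ∀ i < N, ∀ z (w : ℂ), X.nrm N z < R1 - η → X.nrm N z + ‖w‖ < R1 →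
      w ^ m * g m i z = Av X N m (G i) w z := by
    intro m i hi z w h1 h2
    refine mode_cplx (T := max η ‖w‖) m (hG i hi) ?_ hη (le_max_left _ _) (le_max_right _ _)
    intro ζ hζ
    apply hGh i hi
    refine (hpt z ζ).trans_lt ?_
    rcases le_max_iff.1 hζ with h | h <;> linarith
  have hgsum : ∀ i < N, ∀ z, X.nrm N z < R1 - η → X.nrm (N+1) z < R1 → HasSum (fun m => X.x N z ^ m * g m i z) (G i z) := by
    intro i hi z h1 h2
    rw [X.nrm_succ] at h2
    have h3 : max η ‖X.x N z‖ < R1 - X.nrm N z := max_lt (by linarith) (by linarith)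
    obtain ⟨T, hT1, hT2⟩ := exists_between h3
    have h4 := taylor_hasSum (G := G i) (q := X.pr N z) (e := X.e N) (T := T) (hG i hi) (fun ζ hζ => by
      apply hGh i hi
      refine (hpt z ζ).trans_lt ?_
      linarith) hη ((le_max_left _ _).trans hT1.le) (w := X.x N z) ((le_max_right _ _).trans_lt hT1)
    rw [← X.pr_succ, ← hGc i hi] at h4
    exact h4
  have hcm : ∀ m, ∃ u, Cyl1 X N r' u ∧ ∀ z, X.nrm N z < r' → ∀ i < N, dbar u z (X.e i) = g m i z := by
    intro m
    refine ih (R1 - η) (by linarith) (g m) (fun i hi => ⟨fun z => ?_, fun z _ => ?_⟩) ?_ r' (by linarith) hr'R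
    · simp only [hg]; rw [Av_cyl]
    · exact contDiffAt_const.mul (Av_c1 X N m (hG i hi) η).contDiffAt
    · intro i hi k hk z hz
      simp only [hg]
      rw [dbar_const_mul ((Av_c1 X N m (hG i hi) η).contDiffAt.differentiableAt (by norm_num)),
        dbar_const_mul ((Av_c1 X N m (hG k hk) η).contDiffAt.differentiableAt (by norm_num)),
        Av_dbar X N m (hG i hi), Av_dbar X N m (hG k hk), X.pr_e, X.pr_e, if_pos hi, if_pos hk]
      congr 2
      funext φ
      rw [hGs i hi k hk]
      refine (hpt z _).trans_lt ?_
      rw [norm_mul, norm_cE, Complex.norm_real, Real.norm_of_nonneg hη.le]; linarith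
  choose c hcC hcd using hcm
  have hcds : ∀ m z, X.nrm N z < r' → ∀ ξ, dbar (c m) z ξ = ∑ i ∈ Finset.range N, (starRingEnd ℂ) (X.x i ξ) * g m i z := by
    intro m z hz ξ
    rw [cyl_dbar_sum (hcC m).cyl ((hcC m).diffpr hz)]
    exact Finset.sum_congr rfl fun i hi => by rw [hcd m z hz i (Finset.mem_range.1 hi)]
  have hnr : ∀ z, ‖z‖ < r → X.nrm N z + ‖X.x N z‖ < r := by
    intro z hz; rw [← X.nrm_succ]; exact (X.nrm_le _ _).trans_lt hz
  have hxm : ∀ m z, DifferentiableAt ℝ (fun z => X.x N z ^ m) z := fun m z => (x_pow_c1 X N m z).differentiableAt (by norm_num)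
  -- class C
  have hCd : ∀ m z, ‖z‖ < r → ∀ ξ, dbar (fun z => X.x N z ^ m * c m z) z ξ =
      ∑ i ∈ Finset.range N, (starRingEnd ℂ) (X.x i ξ) * Av X N m (G i) (X.x N z) z := by
    intro m z hz ξ
    have h1 := hnr z hz
    have h2 := norm_nonneg (X.x N z)
    rw [dbar_mul (hxm m z) ((hcC m).diff (by linarith)), dbar_holo (x_pow_contDiff X N m z), hcds m z (by linarith), zero_mul, add_zero, Finset.mul_sum]
    refine Finset.sum_congr rfl fun i hi => ?_
    rw [← hgw m i (Finset.mem_range.1 hi) z (X.x N z) (by linarith) (by linarith)]; ring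
  set P := constPar r s A0 hs hsr hA0n with hP
  have hHB : HB P := constPar_HB r s A0 hs hsr hA0n
  have hCC : ∀ m, ClassC X P N m 1 (fun z => X.x N z ^ m * c m z) := by
    intro m
    refine ⟨zero_le_one, ?_, ?_, ?_, ?_, ?_⟩
    · intro z hz
      have h1 := hnr z hz
      have h2 := norm_nonneg (X.x N z)
      exact (x_pow_c1 X N m z).mul ((hcC m).c1 z (by linarith))
    · obtain ⟨M, hM0, hM⟩ := cpt_bound X N r (D := c m) (fun z hz => ((hcC m).c1 z (by linarith)).continuousAt)
      refine ⟨r ^ m * M, fun z hz => ?_⟩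
      have h1 := hnr z hz
      have h2 := norm_nonneg (X.x N z)
      have h3 := X.nrm_nonneg N z
      rw [norm_mul, norm_pow]
      have h4 : ‖c m z‖ ≤ M := by rw [(hcC m).cyl]; exact hM z (by linarith)
      have h5 : ‖X.x N z‖ ^ m ≤ r ^ m := pow_le_pow_left₀ h2 (by linarith) m
      exact mul_le_mul h5 h4 (norm_nonneg _) (by positivity)
    · intro ρ hρ z hz ξ
      have hz' : ‖z‖ < r := lt_of_le_of_lt hz hρ
      rw [hCd m z hz', one_mul]
      apply sum_conj_le X N hA0n
      intro i hi
      exact norm_Av_le X N m (hGb i hi) (by linarith [hnr z hz'])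
    · intro ρ hρ z hz z' hz' ξ
      have hzr : ‖z‖ < r := lt_of_le_of_lt hz hρ
      have hzr' : ‖z'‖ < r := lt_of_le_of_lt hz' hρ
      rw [hCd m z hzr, hCd m z' hzr', one_mul, ← Finset.sum_sub_distrib]
      simp only [← mul_sub]
      refine (sum_conj_le X N (A := A0 * ‖z - z'‖) (by positivity) ?_)
      intro i hi
      refine (Av_lip X N m (hG i hi).continuous hA0n (hGl i hi) (by linarith [hnr z hzr]) (by linarith [hnr z' hzr'])).trans ?_
      rw [← map_sub, ← X.nrm_succ]
      exact mul_le_mul_of_nonneg_left (X.nrm_le _ _) hA0n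
    · intro p a ψ
      rw [x_pt, x_pt, (hcC m).cyl, pr_pt, (hcC m).cyl (X.pr N p + a • X.e N), pr_pt, cE_nat]
      ring
  have hSN := SN_all (X := X) hHB N
  choose h hhc hhr hhe using fun m => hSN m 1 _ (hCC m)
  -- estimate of terms
  have hterm : ∀ ρ1 ρ δ γ Gt β, Tup P ρ1 ρ δ γ Gt β → ∀ z, X.Lw γ (N+1) z < ρ1 → ∀ m,
      ‖X.x N z ^ m * (c m z - h m z)‖ ≤ X.aN Gt β (C2 P ρ δ) N z * Gt N *
        (((m + 0).choose 0 : ℝ) * (γ N * ‖X.x N z‖) ^ m * ((ρ1 - X.Lw γ N z) ^ (0 + m + 1))⁻¹) := by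
    intro ρ1 ρ δ γ Gt β t z hz m
    have hγ : ∀ i, 1 ≤ γ i := fun i => by linarith [t.hγ i, t.hδ]
    have hL := X.Lw_succ γ N z
    have hx0 : 0 ≤ γ N * ‖X.x N z‖ := mul_nonneg (by linarith [hγ N]) (norm_nonneg _)
    have hLn : X.Lw γ N z < ρ1 := by linarith
    have hn := X.nrm_le_Lw hγ N z
    have h1 := hhe m ρ1 ρ δ γ Gt β t z hLn
    have hσ : 0 < ρ - X.nrm N z := by linarith [t.h2]
    have hσC : (((ρ - X.nrm N z : ℝ) : ℂ)) ≠ 0 := Complex.ofReal_ne_zero.2 hσ.ne'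
    simp only [x_pt] at h1
    rw [(hcC m).cyl, pr_pt, ← (hcC m).cyl, ← mul_assoc, inv_mul_cancel₀ (pow_ne_zero _ hσC), one_mul, one_mul] at h1
    rw [norm_mul, norm_pow]
    have hl : 0 < ρ1 - X.Lw γ N z := by linarith
    have ha : 0 ≤ X.aN Gt β (C2 P ρ δ) N z := t.β_nonneg.trans (X.le_aN t.hG t.β_nonneg t.C2_nonneg N z)
    calc ‖X.x N z‖ ^ m * ‖c m z - h m z‖ ≤ ‖X.x N z‖ ^ m * (X.aN Gt β (C2 P ρ δ) N z * DD m * ((ρ1 - X.Lw γ N z) ^ (m + 1))⁻¹) :=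
          mul_le_mul_of_nonneg_left h1 (by positivity)
      _ ≤ ‖X.x N z‖ ^ m * (X.aN Gt β (C2 P ρ δ) N z * (Gt N * γ N ^ m) * ((ρ1 - X.Lw γ N z) ^ (m + 1))⁻¹) := by
          gcongr
          exact DD_le_G t N m
      _ = _ := by
          simp only [Nat.add_zero, Nat.choose_zero_right, Nat.cast_one, one_mul, Nat.zero_add, mul_pow]
          ring
  have hsumbd : ∀ ρ1 ρ δ γ Gt β, Tup P ρ1 ρ δ γ Gt β → ∀ z, X.Lw γ (N+1) z < ρ1 →
      HasSum (fun m => X.aN Gt β (C2 P ρ δ) N z * Gt N *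
        (((m + 0).choose 0 : ℝ) * (γ N * ‖X.x N z‖) ^ m * ((ρ1 - X.Lw γ N z) ^ (0 + m + 1))⁻¹))
        (X.aN Gt β (C2 P ρ δ) N z * Gt N * ((ρ1 - X.Lw γ (N+1) z) ^ (0+1))⁻¹) := by
    intro ρ1 ρ δ γ Gt β t z hz
    have hL := X.Lw_succ γ N z
    have hx0 : 0 ≤ γ N * ‖X.x N z‖ := mul_nonneg (by linarith [t.hγ N, t.hδ]) (norm_nonneg _)
    have h1 := negbinom 0 (y := γ N * ‖X.x N z‖) (l := ρ1 - X.Lw γ N z) hx0 (by linarith)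
    have h2 : ρ1 - X.Lw γ (N+1) z = ρ1 - X.Lw γ N z - γ N * ‖X.x N z‖ := by rw [hL]; ring
    rw [h2]
    exact h1.mul_left _
  have hsummable : ∀ z, X.nrm (N+1) z < s → Summable (fun m => X.x N z ^ m * (c m z - h m z)) := by
    intro z hz
    obtain ⟨ρ1, ρ, δ, γ, Gt, β, t, hL⟩ := exists_tup hHB (N+1) (z0 := z) hz
    exact Summable.of_norm_bounded (hsumbd _ _ _ _ _ _ t z hL).summable (hterm _ _ _ _ _ _ t z hL)
  refine ⟨fun z => ∑' m, X.x N z ^ m * (c m z - h m z), ?_⟩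
  have hmain : ∀ z0, X.nrm (N+1) z0 < s → ContDiffAt ℝ 1 (fun z => ∑' m, X.x N z ^ m * (c m z - h m z)) z0 ∧
      ∀ ξ, dbar (fun z => ∑' m, X.x N z ^ m * (c m z - h m z)) z0 ξ = ∑ i ∈ Finset.range N, (starRingEnd ℂ) (X.x i ξ) * G i z0 := by
    intro z0 hz0
    obtain ⟨ρ1, ρ, δ, γ, Gt, β, t, hL⟩ := exists_tup hHB (N+1) (z0 := z0) hz0
    have hδ := t.hδ
    have hγ : ∀ i, 1 ≤ γ i := fun i => by linarith [t.hγ i, t.hδ]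
    set Bd : V → ℝ := fun z => X.aN Gt β (C2 P ρ δ) N z * Gt N * ((ρ1 - X.Lw γ (N+1) z) ^ (0+1))⁻¹ with hBd
    have hLc := X.continuous_Lw γ (N+1)
    have hBc : ContinuousAt Bd z0 := by
      have hne : (ρ1 - X.Lw γ (N+1) z0) ^ (0+1) ≠ 0 := pow_ne_zero _ (by linarith)
      exact (((X.continuous_aN Gt β (C2 P ρ δ) N).continuousAt (x := z0)).mul continuousAt_const).mul
        (((continuous_const.sub hLc).pow (0+1)).continuousAt.inv₀ hne)
    have hev : ∀ᶠ z in 𝓝 z0, X.Lw γ (N+1) z < ρ1 ∧ Bd z < Bd z0 + 1 :=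
      (hLc.continuousAt.eventually_lt continuousAt_const hL).and (hBc.eventually_lt continuousAt_const (by linarith))
    obtain ⟨rb, hrb, hball⟩ := Metric.eventually_nhds_iff_ball.1 hev
    have hPs : ρ < s := t.h3
    have hlam : ∀ z ∈ Metric.ball z0 rb, X.nrm N z + ‖((1 + δ : ℝ) : ℂ) * X.x N z‖ < s ∧ X.nrm (N+1) z < s := by
      intro z hz
      have h1 := (hball z hz).1
      have h2 := X.nrm_le_Lw hγ N z
      have h3 := X.nrm_le_Lw hγ (N+1) z
      have h4 := X.Lw_succ γ N z
      have h5 : (1 + δ) * ‖X.x N z‖ ≤ γ N * ‖X.x N z‖ := mul_le_mul_of_nonneg_right (t.hγ N) (norm_nonneg _)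
      rw [norm_mul, Complex.norm_real, Real.norm_of_nonneg (by linarith)]
      constructor <;> linarith [t.h2]
    have hnN : ∀ z ∈ Metric.ball z0 rb, X.nrm N z < s := fun z hz => by
      have := (hlam z hz).2
      rw [X.nrm_succ] at this
      linarith [norm_nonneg (X.x N z)]
    have hcr : ∀ z ∈ Metric.ball z0 rb, ∀ m, ContDiffAt ℝ 1 (fun z => c m z - h m z) z := fun z hz m =>
      ((hcC m).c1 z (by linarith [hnN z hz])).sub (hhr m z (hnN z hz)).1
    have hc1 : ∀ z ∈ Metric.ball z0 rb, ∀ m, ContDiffAt ℝ 1 (fun z => X.x N z ^ m * (c m z - h m z)) z :=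
      fun z hz m => (x_pow_c1 X N m z).mul (hcr z hz m)
    have hdterm : ∀ z ∈ Metric.ball z0 rb, ∀ m ξ, dbar (fun z => X.x N z ^ m * (c m z - h m z)) z ξ =
        ∑ i ∈ Finset.range N, (starRingEnd ℂ) (X.x i ξ) * (X.x N z ^ m * g m i z) := by
      intro z hz m ξ
      have h1 := hnN z hz
      rw [dbar_mul (hxm m z) ((hcr z hz m).differentiableAt (by norm_num)), dbar_holo (x_pow_contDiff X N m z),
        dbar_sub ((hcC m).diff (by linarith)) ((hhr m z h1).1.differentiableAt (by norm_num)), (hhr m z h1).2,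
        hcds m z (by linarith), zero_mul, add_zero, sub_zero, Finset.mul_sum]
      exact Finset.sum_congr rfl fun i hi => by ring
    have hdb : ∀ z ∈ Metric.ball z0 rb, ∀ n ξ, dbar (fun z => ∑ m ∈ Finset.range n, X.x N z ^ m * (c m z - h m z)) z ξ =
        ∑ i ∈ Finset.range N, (starRingEnd ℂ) (X.x i ξ) * ∑ m ∈ Finset.range n, X.x N z ^ m * g m i z := by
      intro z hz n ξ
      rw [dbar_sum _ (fun m _ => (hc1 z hz m).differentiableAt (by norm_num))]
      simp only [hdterm z hz, Finset.mul_sum]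
      rw [Finset.sum_comm]
    have hlC : ((1 + δ : ℝ) : ℂ) ≠ 0 := Complex.ofReal_ne_zero.2 (by linarith)
    have hgl : ∀ z ∈ Metric.ball z0 rb, ∀ m, ∀ i < N, X.x N z ^ m * g m i z =
        ((((1 + δ : ℝ) : ℂ)) ^ m)⁻¹ * Av X N m (G i) (((1 + δ : ℝ) : ℂ) * X.x N z) z := by
      intro z hz m i hi
      have h1 := (hlam z hz).1
      have h2 := hnN z hz
      rw [← hgw m i hi z _ (by linarith) (by linarith), mul_pow]
      field_simp
    have hgeo : ∀ n, ∑ m ∈ Finset.range n, ((1 + δ) ^ m)⁻¹ ≤ (1 + δ) / δ := by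
      intro n
      have h1 : HasSum (fun m : ℕ => ((1 + δ) ^ m)⁻¹) ((1 + δ) / δ) := by
        have h2 := hasSum_geometric_of_lt_one (r := (1 + δ)⁻¹) (by positivity) (inv_lt_one_of_one_lt₀ (by linarith))
        have h3 : (1 - (1 + δ)⁻¹)⁻¹ = (1 + δ) / δ := by
          have h4 : 1 - (1 + δ)⁻¹ = δ / (1 + δ) := by
            rw [eq_div_iff (by positivity), sub_mul, inv_mul_cancel₀ (by positivity)]; ring
          rw [h4, inv_div]
        rw [h3] at h2
        simpa only [inv_pow] using h2
      exact sum_le_hasSum _ (fun _ _ => by positivity) h1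
    have hlnorm : ∀ m : ℕ, ‖((((1 + δ : ℝ) : ℂ)) ^ m)⁻¹‖ = ((1 + δ) ^ m)⁻¹ := by
      intro m
      rw [norm_inv, norm_pow, Complex.norm_real, Real.norm_of_nonneg (by linarith)]
    set A1 : ℝ := (1 + δ) / δ * (A0 * (1 + δ)) with hA1
    have hA1n : 0 ≤ A1 := by positivity
    have hA01 : (1 + δ) / δ * A0 ≤ A1 := by
      rw [hA1]
      have : A0 * 1 ≤ A0 * (1 + δ) := mul_le_mul_of_nonneg_left (by linarith) hA0n
      rw [mul_one] at this
      exact mul_le_mul_of_nonneg_left this (by positivity)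
    have hinner1 : ∀ z ∈ Metric.ball z0 rb, ∀ n, ∀ i < N, ‖∑ m ∈ Finset.range n, X.x N z ^ m * g m i z‖ ≤ A1 := by
      intro z hz n i hi
      refine le_trans ?_ hA01
      calc ‖∑ m ∈ Finset.range n, X.x N z ^ m * g m i z‖ ≤ ∑ m ∈ Finset.range n, ((1 + δ) ^ m)⁻¹ * A0 := by
            refine (norm_sum_le _ _).trans (Finset.sum_le_sum fun m _ => ?_)
            rw [hgl z hz m i hi, norm_mul, hlnorm]
            refine mul_le_mul_of_nonneg_left ?_ (by positivity)
            exact norm_Av_le X N m (hGb i hi) (by linarith [(hlam z hz).1])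
        _ ≤ _ := by rw [← Finset.sum_mul]; exact mul_le_mul_of_nonneg_right (hgeo n) hA0n
    have hinner2 : ∀ z ∈ Metric.ball z0 rb, ∀ z' ∈ Metric.ball z0 rb, ∀ n, ∀ i < N,
        ‖∑ m ∈ Finset.range n, X.x N z ^ m * g m i z - ∑ m ∈ Finset.range n, X.x N z' ^ m * g m i z'‖ ≤ A1 * ‖z - z'‖ := by
      intro z hz z' hz' n i hi
      rw [← Finset.sum_sub_distrib]
      calc ‖∑ m ∈ Finset.range n, (X.x N z ^ m * g m i z - X.x N z' ^ m * g m i z')‖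
          ≤ ∑ m ∈ Finset.range n, ((1 + δ) ^ m)⁻¹ * (A0 * (1 + δ) * ‖z - z'‖) := by
            refine (norm_sum_le _ _).trans (Finset.sum_le_sum fun m _ => ?_)
            rw [hgl z hz m i hi, hgl z' hz' m i hi, ← mul_sub, norm_mul, hlnorm]
            refine mul_le_mul_of_nonneg_left ?_ (by positivity)
            refine (Av_lip X N m (hG i hi).continuous hA0n (hGl i hi) (by linarith [(hlam z hz).1]) (by linarith [(hlam z' hz').1])).trans ?_
            rw [mul_assoc]
            refine mul_le_mul_of_nonneg_left ?_ hA0n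
            rw [← mul_sub, ← map_sub, norm_mul, Complex.norm_real, Real.norm_of_nonneg (by linarith)]
            have h1 := X.nrm_le (N+1) (z - z')
            rw [X.nrm_succ] at h1
            have h2 := X.nrm_nonneg N (z - z')
            have h3 : (1 + δ) * (X.nrm N (z - z') + ‖X.x N (z - z')‖) ≤ (1 + δ) * ‖z - z'‖ :=
              mul_le_mul_of_nonneg_left h1 (by linarith)
            nlinarith
        _ ≤ _ := by
            rw [← Finset.sum_mul, hA1]
            have : (1 + δ) / δ * (A0 * (1 + δ)) * ‖z - z'‖ = (1 + δ) / δ * (A0 * (1 + δ) * ‖z - z'‖) := by ring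
            rw [this]
            exact mul_le_mul_of_nonneg_right (hgeo n) (by positivity)
    have hB0 : 0 ≤ Bd z0 + 1 := by
      have h1 := (hsumbd _ _ _ _ _ _ t z0 hL)
      have h2 : 0 ≤ Bd z0 := h1.nonneg (fun m => (norm_nonneg _).trans (hterm _ _ _ _ _ _ t z0 hL m))
      linarith
    refine LL atTop (un := fun n z => ∑ m ∈ Finset.range n, X.x N z ^ m * (c m z - h m z))
      (f := fun z ξ => ∑ i ∈ Finset.range N, (starRingEnd ℂ) (X.x i ξ) * G i z) (A := max (Bd z0 + 1) A1) hrb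
      (le_max_of_le_left hB0) (Eventually.of_forall fun n => ⟨?_, ?_, ?_, ?_⟩) ?_ ?_
    · intro z hz
      exact ContDiffAt.sum (fun m _ => hc1 z hz m)
    · intro z hz
      refine le_trans ?_ ((hball z hz).2.le.trans (le_max_left _ _))
      refine (norm_sum_le _ _).trans ((Finset.sum_le_sum fun m _ => hterm _ _ _ _ _ _ t z (hball z hz).1 m).trans ?_)
      exact sum_le_hasSum _ (fun m _ => (norm_nonneg _).trans (hterm _ _ _ _ _ _ t z (hball z hz).1 m)) (hsumbd _ _ _ _ _ _ t z (hball z hz).1)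
    · intro z hz ξ
      rw [hdb z hz]
      exact sum_conj_le X N (hA1n.trans (le_max_right _ _)) fun i hi => (hinner1 z hz n i hi).trans (le_max_right _ _)
    · intro z hz z' hz' ξ
      rw [hdb z hz, hdb z' hz', ← Finset.sum_sub_distrib]
      simp only [← mul_sub]
      refine sum_conj_le X N (mul_nonneg (hA1n.trans (le_max_right _ _)) (norm_nonneg _)) fun i hi => (hinner2 z hz z' hz' n i hi).trans ?_
      exact mul_le_mul_of_nonneg_right (le_max_right _ _) (norm_nonneg _)
    · intro z hz
      exact (hsummable z (hlam z hz).2).hasSum.tendsto_sum_nat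
    · intro ξ
      have hm := Metric.mem_ball_self (x := z0) hrb
      simp only [hdb z0 hm]
      refine tendsto_finsetSum _ fun i hi => Tendsto.const_mul _ ?_
      exact (hgsum i (Finset.mem_range.1 hi) z0 (by linarith [hnN z0 hm]) (by linarith)).tendsto_sum_nat
  refine ⟨⟨fun z => ?_, fun z hz => (hmain z hz).1⟩, fun z hz => (hmain z hz).2⟩
  congr 1
  ext m
  rw [X.x_pr, if_pos (Nat.lt_succ_self N), (hcC m).cyl (X.pr (N+1) z), hhc m (X.pr (N+1) z), X.pr_pr N (N+1) (Nat.le_succ N), ← hhc m z, ← (hcC m).cyl z]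

theorem ExistN_all (X : Coord V) (N : ℕ) : ExistN X N := by
  induction N with
  | zero =>
    intro R hR F _ _ R' _ _
    exact ⟨fun _ => 0, ⟨fun _ => rfl, fun _ _ => contDiffAt_const⟩, fun z _ i hi => absurd hi (Nat.not_lt_zero i)⟩
  | succ N ih =>
    intro R hR F hF hcl s hs hsR
    obtain ⟨r, h1, h1'⟩ := exists_between hsR
    obtain ⟨r', h2, h2'⟩ := exists_between h1'
    obtain ⟨R0, h3, h3'⟩ := exists_between h2'
    obtain ⟨R1, h4, h4'⟩ := exists_between h3'
    obtain ⟨R2, h5, h5'⟩ := exists_between h4'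
    obtain ⟨v, G, hv, hvc, hG, hmain⟩ := E3 X N (by linarith) h5 h5' hF hcl
    obtain ⟨S, hS, hSd⟩ := Gsolve X N ih (η := R1 - R0) hs h1 h2 (by linarith) (by linarith) (fun i hi => (hG i hi).1)
      (fun i hi => (hG i hi).2) (fun i hi z hz => (hmain z hz).2.2.1 i hi) (fun i hi k hk z hz => (hmain z hz).2.2.2 i hi k hk)
    refine ⟨fun z => v z + S z, ⟨fun z => ?_, fun z hz => hv.contDiffAt.add (hS.c1 z hz)⟩, fun z hz i hi => ?_⟩
    · rw [← hvc z, ← hS.cyl z]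
    · rw [dbar_add (hv.contDiffAt.differentiableAt (by norm_num)) (hS.diff hz), hSd z hz]
      obtain ⟨k1, k2, _, _⟩ := hmain z (by linarith)
      rcases Nat.lt_succ_iff_lt_or_eq.1 hi with h | rfl
      · rw [k2 i h, Finset.sum_eq_single i]
        · simp [X.x_e]
        · intro b _ hb
          simp [X.x_e, hb]
        · intro hni
          exact absurd (Finset.mem_range.2 h) hni
      · rw [k1, Finset.sum_eq_zero, add_zero]
        intro b hb
        have : b ≠ i := (Finset.mem_range.1 hb).ne
        simp [X.x_e, this]

end Exist3

section Fin1
variable {V : Type*} [NormedAddCommGroup V] [NormedSpace ℂ V]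

def bset (f : V → V → ℂ) (ρ : ℝ) : Set ℝ := {K | 0 ≤ K ∧ (∀ z, ‖z‖ ≤ ρ → ∀ ξ, ‖f z ξ‖ ≤ K * ‖ξ‖) ∧
  ∀ z, ‖z‖ ≤ ρ → ∀ z', ‖z'‖ ≤ ρ → ∀ ξ, ‖f z ξ - f z' ξ‖ ≤ K * ‖z - z'‖ * ‖ξ‖}

def Abd (f : V → V → ℂ) (ρ : ℝ) : ℝ := sInf (bset f ρ)

lemma Abd_nonneg (f : V → V → ℂ) (ρ : ℝ) : 0 ≤ Abd f ρ := Real.sInf_nonneg fun _ h => h.1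

lemma bset_bdd (f : V → V → ℂ) (ρ : ℝ) : BddBelow (bset f ρ) := ⟨0, fun _ h => h.1⟩

lemma le_sInf_mul {S : Set ℝ} (hS : S.Nonempty) {x c : ℝ} (hc : 0 ≤ c) (h : ∀ K ∈ S, x ≤ K * c) : x ≤ sInf S * c := by
  rcases hc.eq_or_lt with h0 | h0
  · obtain ⟨K, hK⟩ := hS
    have := h K hK
    rw [← h0, mul_zero] at this ⊢
    exact this
  · rw [← div_le_iff₀ h0]
    exact le_csInf hS fun K hK => by rw [div_le_iff₀ h0]; exact h K hK

lemma Abd_b1 {f : V → V → ℂ} {ρ : ℝ} (h : (bset f ρ).Nonempty) {z : V} (hz : ‖z‖ ≤ ρ) (ξ : V) : ‖f z ξ‖ ≤ Abd f ρ * ‖ξ‖ :=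
  le_sInf_mul h (norm_nonneg _) fun _ hK => hK.2.1 z hz ξ

lemma Abd_b2 {f : V → V → ℂ} {ρ : ℝ} (h : (bset f ρ).Nonempty) {z z' : V} (hz : ‖z‖ ≤ ρ) (hz' : ‖z'‖ ≤ ρ) (ξ : V) :
    ‖f z ξ - f z' ξ‖ ≤ Abd f ρ * ‖z - z'‖ * ‖ξ‖ := by
  rw [mul_assoc]
  exact le_sInf_mul h (by positivity) fun _ hK => by rw [← mul_assoc]; exact hK.2.2 z hz z' hz' ξ

lemma Abd_mono {f : V → V → ℂ} {ρ ρ' : ℝ} (h : (bset f ρ').Nonempty) (hρ : ρ ≤ ρ') : Abd f ρ ≤ Abd f ρ' := by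
  apply csInf_le_csInf (bset_bdd f ρ) h
  rintro K ⟨h1, h2, h3⟩
  exact ⟨h1, fun z hz => h2 z (hz.trans hρ), fun z hz z' hz' => h3 z (hz.trans hρ) z' (hz'.trans hρ)⟩

lemma bset_nonempty {f : V → V → ℂ} {ρ r : ℝ} (hρ : ρ < r) 
    (hsm : ∀ z, ‖z‖ < r → ∀ (a : ℂ) ξ, f z (a • ξ) = (starRingEnd ℂ) a * f z ξ)
    (hl : LipschitzForm f {z | ‖z‖ < r}) : (bset f ρ).Nonempty := by
  obtain ⟨⟨K1, hK1⟩, ⟨K2, hK2⟩⟩ := hl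
  have hsc : ∀ z, ‖z‖ < r → ∀ ξ, f z ξ = (‖ξ‖ : ℂ) * f z (((‖ξ‖ : ℂ)⁻¹) • ξ) := by
    intro z hz ξ
    by_cases h : ξ = 0
    · subst h
      have := hsm z hz 0 0
      simp at this
      simp [this]
    · have h1 : (‖ξ‖ : ℂ) ≠ 0 := Complex.ofReal_ne_zero.2 (norm_ne_zero_iff.2 h)
      have h2 := hsm z hz (‖ξ‖ : ℂ) (((‖ξ‖ : ℂ)⁻¹) • ξ)
      rw [smul_smul, mul_inv_cancel₀ h1, one_smul, Complex.conj_ofReal] at h2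
      exact h2
  have hun : ∀ ξ : V, ‖((‖ξ‖ : ℂ)⁻¹) • ξ‖ ≤ 1 := by
    intro ξ
    rw [norm_smul, norm_inv, Complex.norm_real, norm_norm]
    exact inv_mul_le_one
  have hnn : ∀ ξ : V, ‖(‖ξ‖ : ℂ)‖ = ‖ξ‖ := fun ξ => by rw [Complex.norm_real, norm_norm]
  refine ⟨max (max K1 K2) 0, le_max_right _ _, ?_, ?_⟩
  · intro z hz ξ
    have hz' : ‖z‖ < r := hz.trans_lt hρ
    rw [hsc z hz' ξ, norm_mul, hnn, mul_comm]
    apply mul_le_mul_of_nonneg_right _ (norm_nonneg _)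
    exact (hK1 ⟨z, hz', _, hun ξ, rfl⟩).trans ((le_max_left _ _).trans (le_max_left _ _))
  · intro z hz z' hz' ξ
    have h1 : ‖z‖ < r := hz.trans_lt hρ
    have h1' : ‖z'‖ < r := hz'.trans_lt hρ
    rw [hsc z h1 ξ, hsc z' h1' ξ, ← mul_sub, norm_mul, hnn, mul_comm]
    apply mul_le_mul_of_nonneg_right _ (norm_nonneg _)
    by_cases h : z = z'
    · subst h; simp
    · have h2 : 0 < ‖z - z'‖ := norm_pos_iff.2 (sub_ne_zero.2 h)
      rw [← div_le_iff₀ h2]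
      exact (hK2 ⟨z, h1, z', h1', h, _, hun ξ, rfl⟩).trans ((le_max_right _ _).trans (le_max_left _ _))

/-- the slowly increasing index -/
lemma exists_index {B : ℕ → ℝ} (hB : ∀ n, 0 ≤ B n) : ∃ (C : ℝ) (i : ℕ → ℕ), 0 ≤ C ∧ (∀ j, B (i j) ≤ C * (j + 1)) ∧
    ∀ n, ∃ J, ∀ j, J ≤ j → n ≤ i j := by
  classical
  refine ⟨B 0 + 1, fun j => Nat.findGreatest (fun i => B i ≤ (B 0 + 1) * (j + 1)) j, by linarith [hB 0], fun j => ?_, fun n => ?_⟩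
  · have : B 0 ≤ (B 0 + 1) * ((j : ℝ) + 1) := by
      have : (0:ℝ) ≤ j := Nat.cast_nonneg j
      nlinarith [hB 0]
    exact Nat.findGreatest_spec (P := fun i => B i ≤ (B 0 + 1) * ((j : ℝ) + 1)) (Nat.zero_le j) this
  · obtain ⟨k, hk⟩ := exists_nat_ge (B n)
    refine ⟨max n k, fun j hj => ?_⟩
    apply Nat.le_findGreatest ((le_max_left _ _).trans hj)
    have h1 : (k : ℝ) ≤ j := Nat.cast_le.2 ((le_max_right _ _).trans hj)
    have : (0:ℝ) ≤ j := Nat.cast_nonneg j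
    nlinarith [hB 0]

lemma HBu {A : ℝ → ℝ} {rr : ℕ → ℝ} (hrr : StrictMono rr) (hpos : ∀ n, 0 < rr n) (hA : ∀ t, 0 ≤ A t)
    (hAm : ∀ n, ∀ t, t ≤ rr n → A t ≤ A (rr n)) {C : ℝ} {i : ℕ → ℕ} (hC : 0 ≤ C)
    (hi : ∀ j, A (rr (i j)) * rr (i j) ≤ C * (j + 1)) (hi2 : ∀ n, ∃ J, ∀ j, J ≤ j → n ≤ i j)
    {ρ1 ρ : ℝ} (h1 : 0 < ρ1) (h2 : ρ1 < ρ) {n0 : ℕ} (hn0 : ρ < rr n0) :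
    ∃ β, 4 * ρ ^ 3 * A ρ ≤ β ∧ ∀ s, ρ < s → ∀ j,
      2 * A (max ρ (min (rr (i j)) s)) * (max ρ (min (rr (i j)) s) - min ρ (min (rr (i j)) s)) *
        ((min ρ (min (rr (i j)) s)) ^ j)⁻¹ ≤ β * (ρ1 ^ (j + 1))⁻¹ := by
  obtain ⟨J, hJ⟩ := hi2 n0
  have hρ : 0 < ρ := h1.trans h2
  set δ : ℝ := ρ / ρ1 - 1 with hδd
  have hδ : 0 < δ := by rw [hδd, sub_pos, lt_div_iff₀ h1]; linarith
  set Gc : ℝ := 1 + 2 * Real.exp 1 / δ with hGc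
  have hGc0 : 0 ≤ Gc := by have := Real.exp_pos 1; positivity
  set K1 : ℝ := 2 * C * Gc * ρ with hK1
  have hK1n : 0 ≤ K1 := by positivity
  set K2 : ℝ := ∑ j ∈ Finset.range J, 2 * A ρ * ρ * (rr (i j) ^ j)⁻¹ * ρ1 ^ (j+1) with hK2
  have hK2t : ∀ j, 0 ≤ 2 * A ρ * ρ * (rr (i j) ^ j)⁻¹ * ρ1 ^ (j+1) := fun j => by
    have := hA ρ
    have := hpos (i j)
    positivity
  have hK2n : 0 ≤ K2 := Finset.sum_nonneg fun j _ => hK2t j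
  have hβ1 : 0 ≤ 4 * ρ ^ 3 * A ρ := by have := hA ρ; positivity
  refine ⟨4 * ρ ^ 3 * A ρ + K1 + K2, by linarith, fun s hs j => ?_⟩
  rw [← div_eq_mul_inv _ (ρ1 ^ (j+1)), le_div_iff₀ (by positivity)]
  rcases le_or_gt ρ (rr (i j)) with h | h
  · set b := min (rr (i j)) s with hb
    have hbρ : ρ ≤ b := le_min h hs.le
    have hbr : b ≤ rr (i j) := min_le_left _ _
    rw [max_eq_right hbρ, min_eq_left hbρ]
    have hAb : A b * b ≤ C * (j + 1) := by
      refine le_trans ?_ (hi j)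
      exact mul_le_mul (hAm _ _ hbr) hbr (by linarith) (hA _)
    have h3 : 2 * A b * (b - ρ) ≤ 2 * (C * (j + 1)) := by
      have : 0 ≤ A b * ρ := mul_nonneg (hA b) hρ.le
      nlinarith
    have h4 := growth hδ (j+1)
    have h5 : 1 + δ = ρ / ρ1 := by rw [hδd]; ring
    rw [h5, div_pow, ← hGc, ← mul_div_assoc, le_div_iff₀ (by positivity)] at h4
    push_cast at h4
    have he : 1 ≤ 2 * Real.exp 1 := by
      have := Real.add_one_le_exp (1:ℝ); linarith
    have h6 : ((j : ℝ) + 1) * ρ1 ^ (j+1) ≤ Gc * ρ ^ (j+1) := by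
      refine le_trans ?_ h4
      have : 0 ≤ ((j : ℝ) + 1) * ρ1 ^ (j+1) := by positivity
      nlinarith
    calc 2 * A b * (b - ρ) * (ρ ^ j)⁻¹ * ρ1 ^ (j+1) ≤ 2 * (C * (j + 1)) * (ρ ^ j)⁻¹ * ρ1 ^ (j+1) := by gcongr
      _ = 2 * C * (ρ ^ j)⁻¹ * (((j : ℝ) + 1) * ρ1 ^ (j+1)) := by ring
      _ ≤ 2 * C * (ρ ^ j)⁻¹ * (Gc * ρ ^ (j+1)) := by gcongr
      _ = K1 := by
        rw [hK1, pow_succ]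
        have : ρ ^ j ≠ 0 := by positivity
        field_simp
      _ ≤ _ := by linarith
  · have hbe : min (rr (i j)) s = rr (i j) := min_eq_left (by linarith)
    rw [hbe, max_eq_left h.le, min_eq_right h.le]
    have hjJ : j < J := by
      by_contra hcon
      have := hrr.monotone (hJ j (not_lt.1 hcon))
      linarith
    have h3 : 2 * A ρ * ρ * (rr (i j) ^ j)⁻¹ * ρ1 ^ (j+1) ≤ K2 :=
      Finset.single_le_sum (f := fun j => 2 * A ρ * ρ * (rr (i j) ^ j)⁻¹ * ρ1 ^ (j+1)) (fun j _ => hK2t j) (Finset.mem_range.2 hjJ)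
    refine le_trans ?_ (h3.trans (by linarith))
    have := hpos (i j)
    have := hA ρ
    gcongr
    linarith

lemma aN_le (X : Coord V) {G0 β c : ℝ} (hG0 : 1 ≤ G0) (hβ : 0 ≤ β) (hc : 0 ≤ c) (M N : ℕ) (z : V) :
    X.aN (fun i => if i < M then G0 else 1) β c N z ≤ G0 ^ (min N M) * (β + c * X.nrm N z) := by
  induction N with
  | zero => simp [Coord.aN, X.nrm_zero]
  | succ N ih =>
    rw [Coord.aN, X.nrm_succ]
    have hx := norm_nonneg (X.x N z)
    have hp : ∀ k, 1 ≤ G0 ^ k := fun k => one_le_pow₀ hG0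
    have hcx : 0 ≤ c * ‖X.x N z‖ := mul_nonneg hc hx
    by_cases h : N < M
    · rw [if_pos h]
      rw [min_eq_left h.le] at ih
      rw [min_eq_left (Nat.succ_le_of_lt h)]
      have h1 : G0 * X.aN (fun i => if i < M then G0 else 1) β c N z ≤ G0 * (G0 ^ N * (β + c * X.nrm N z)) :=
        mul_le_mul_of_nonneg_left ih (by linarith)
      have h2 : c * ‖X.x N z‖ ≤ G0 ^ (N+1) * (c * ‖X.x N z‖) := le_mul_of_one_le_left hcx (hp _)
      calc _ ≤ G0 * (G0 ^ N * (β + c * X.nrm N z)) + G0 ^ (N+1) * (c * ‖X.x N z‖) := add_le_add h1 h2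
        _ = _ := by rw [pow_succ]; ring
    · rw [if_neg h, one_mul]
      have hMN : M ≤ N := not_lt.1 h
      rw [min_eq_right hMN] at ih
      rw [min_eq_right (hMN.trans (Nat.le_succ N))]
      have h2 : c * ‖X.x N z‖ ≤ G0 ^ M * (c * ‖X.x N z‖) := le_mul_of_one_le_left hcx (hp _)
      calc _ ≤ G0 ^ M * (β + c * X.nrm N z) + G0 ^ M * (c * ‖X.x N z‖) := add_le_add ih h2
        _ = _ := by ring

lemma Lw_le (X : Coord V) {δ : ℝ} (hδ : 0 < δ) (M N : ℕ) (z : V) :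
    X.Lw (fun i => if i < M then 1 + δ else 12) N z ≤ (1 + δ) * ‖z‖ + 12 * ‖z - X.pr M z‖ := by
  calc X.Lw (fun i => if i < M then 1 + δ else 12) N z
      ≤ ∑ i ∈ Finset.range N, ((1 + δ) * ‖X.x i z‖ + 12 * ‖X.x i (z - X.pr M z)‖) := by
        unfold Coord.Lw
        apply Finset.sum_le_sum
        intro i _
        have h0 := norm_nonneg (X.x i z)
        show (if i < M then 1 + δ else 12) * ‖X.x i z‖ ≤ _
        rw [map_sub, X.x_pr]
        by_cases h : i < M
        · rw [if_pos h, if_pos h, sub_self, norm_zero]; linarith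
        · rw [if_neg h, if_neg h, sub_zero]; nlinarith
    _ = (1 + δ) * X.nrm N z + 12 * X.nrm N (z - X.pr M z) := by
        rw [Finset.sum_add_distrib, ← Finset.mul_sum, ← Finset.mul_sum]; rfl
    _ ≤ _ := by
        have h1 := X.nrm_le N z
        have h2 := X.nrm_le N (z - X.pr M z)
        have : (1 + δ) * X.nrm N z ≤ (1 + δ) * ‖z‖ := mul_le_mul_of_nonneg_left h1 (by linarith)
        linarith

lemma growth12 (m : ℕ) : 2 * (Real.exp 1 * m) ≤ 1 * (12:ℝ) ^ m := by
  have h1 := one_add_mul_le_pow (a := (11:ℝ)) (by norm_num) m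
  have h2 := Real.exp_one_lt_d9
  have h3 : (0:ℝ) ≤ m := Nat.cast_nonneg m
  have h4 : (1 + 11 : ℝ) = 12 := by norm_num
  rw [h4] at h1
  nlinarith

end Fin1

section Fin2
variable {V : Type*} [NormedAddCommGroup V] [NormedSpace ℂ V]

structure Dat (f : V → V → ℂ) (rr : ℕ → ℝ) : Prop where
  mono : StrictMono rr
  pos : ∀ n, 0 < rr n
  add : ∀ n z, ‖z‖ < rr n → ∀ ξ η, f z (ξ + η) = f z ξ + f z η
  sm : ∀ n z, ‖z‖ < rr n → ∀ (a : ℂ) ξ, f z (a • ξ) = (starRingEnd ℂ) a * f z ξ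
  c1 : ∀ n z, ‖z‖ < rr n → ∀ ξ, ContDiffAt ℝ 1 (fun p : V × V => f p.1 p.2) (z, ξ)
  lip : ∀ n, LipschitzForm f {z | ‖z‖ < rr n}
  cl : ∀ n z, ‖z‖ < rr n → ∀ ξ η, dbar (fun w => f w ξ) z η = dbar (fun w => f w η) z ξ

lemma Dat.sum {f : V → V → ℂ} {rr : ℕ → ℝ} (D : Dat f rr) (X : Coord V) {n : ℕ} {z : V} (hz : ‖z‖ < rr n) (N : ℕ) (ξ : V) :
    f z (X.pr N ξ) = ∑ i ∈ Finset.range N, (starRingEnd ℂ) (X.x i ξ) * f z (X.e i) := by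
  rw [X.pr_apply]
  induction N with
  | zero =>
    have := D.sm n z hz 0 0
    simpa using this
  | succ N ih =>
    rw [Finset.sum_range_succ, Finset.sum_range_succ, D.add n z hz, ih, D.sm n z hz]

lemma Dat.c1' {f : V → V → ℂ} {rr : ℕ → ℝ} (D : Dat f rr) {n : ℕ} {z : V} (hz : ‖z‖ < rr n) (ξ : V) :
    ContDiffAt ℝ 1 (fun w => f w ξ) z := by
  have h1 : ContDiffAt ℝ 1 (fun w : V => (w, ξ)) z := contDiffAt_id.prodMk contDiffAt_const
  exact ContDiffAt.comp (g := fun p : V × V => f p.1 p.2) z (D.c1 n z hz ξ) h1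

lemma Dat.ne {f : V → V → ℂ} {rr : ℕ → ℝ} (D : Dat f rr) {n : ℕ} {ρ : ℝ} (h : ρ < rr n) : (bset f ρ).Nonempty :=
  bset_nonempty h (D.sm n) (D.lip n)

lemma step1 {f : V → V → ℂ} {rr : ℕ → ℝ} (D : Dat f rr) (X : Coord V) (P : ℕ) :
    ∃ u, Cyl1 X P (rr (P+2)) u ∧ ∀ z, X.nrm P z < rr (P+2) → ∀ ξ, dbar u z ξ = f (X.pr P z) (X.pr P ξ) := by
  have hn : ∀ z, X.nrm P z < rr (P+3) → ‖X.pr P z‖ < rr (P+3) := fun z hz => (X.norm_pr_le P z).trans_lt hz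
  obtain ⟨u, hu, hd⟩ := ExistN_all X P (rr (P+3)) (D.pos _) (fun i z => f (X.pr P z) (X.e i))
    (fun i _ => ⟨fun z => by rw [X.pr_pr P P le_rfl], fun z hz => by
      exact ContDiffAt.comp (g := fun w => f w (X.e i)) z (D.c1' (hn z hz) (X.e i))
        ((X.pr P).restrictScalars ℝ).contDiff.contDiffAt⟩)
    (fun i hi k hk z hz => by
      have key : ∀ i k, k < P → dbar (fun z => f (X.pr P z) (X.e i)) z (X.e k) =
          dbar (fun w => f w (X.e i)) (X.pr P z) (X.e k) := by
        intro i k hk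
        have h := dbar_comp (u := fun w => f w (X.e i)) (z := z) (X.pr P) 0
          (by rw [add_zero]; exact (D.c1' (hn z hz) (X.e i)).differentiableAt (by norm_num)) (X.e k)
        simp only [add_zero] at h
        rw [h, X.pr_e, if_pos hk]
      rw [key i k hk, key k i hi]
      exact D.cl _ _ (hn z hz) _ _)
    (rr (P+2)) (D.pos _) (D.mono (Nat.lt_succ_self _))
  refine ⟨u, hu, fun z hz ξ => ?_⟩
  rw [cyl_dbar_sum hu.cyl (hu.diffpr hz), D.sum X (n := P+2) ((X.norm_pr_le P z).trans_lt hz)]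
  exact Finset.sum_congr rfl fun i hi => by rw [hd z hz i (Finset.mem_range.1 hi)]

def mkPar {f : V → V → ℂ} {rr : ℕ → ℝ} (D : Dat f rr) (i : ℕ → ℕ) (P : ℕ) : Par where
  r := rr (P+1)
  s := rr P
  A := Abd f
  bs := fun j => min (rr (i j)) (rr P)
  hs := D.pos P
  hsr := D.mono (Nat.lt_succ_self P)
  hA := Abd_nonneg f
  hbs := fun j => lt_min (D.pos _) (D.pos _)
  hbs' := fun j => min_le_right _ _

lemma dbdd {f : V → V → ℂ} {rr : ℕ → ℝ} (D : Dat f rr) (X : Coord V) (P : ℕ) {ρ : ℝ} {n : ℕ} (hρ : ρ < rr n) :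
    (∀ z, ‖z‖ ≤ ρ → ∀ ξ, ‖f (X.pr P z) (X.pr P ξ)‖ ≤ Abd f ρ * ‖ξ‖) ∧
    ∀ z, ‖z‖ ≤ ρ → ∀ z', ‖z'‖ ≤ ρ → ∀ ξ, ‖f (X.pr P z) (X.pr P ξ) - f (X.pr P z') (X.pr P ξ)‖ ≤
      Abd f ρ * ‖z - z'‖ * ‖ξ‖ := by
  have hp : ∀ z, ‖X.pr P z‖ ≤ ‖z‖ := fun z => (X.norm_pr_le P z).trans (X.nrm_le P z)
  have hA := Abd_nonneg f ρ
  refine ⟨fun z hz ξ => ?_, fun z hz z' hz' ξ => ?_⟩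
  · exact (Abd_b1 (D.ne hρ) ((hp z).trans hz) _).trans (mul_le_mul_of_nonneg_left (hp ξ) hA)
  · refine (Abd_b2 (D.ne hρ) ((hp z).trans hz) ((hp z').trans hz') _).trans ?_
    have h1 : ‖X.pr P z - X.pr P z'‖ ≤ ‖z - z'‖ := by rw [← map_sub]; exact hp _
    have h2 := hp ξ
    gcongr

lemma step2 {f : V → V → ℂ} {rr : ℕ → ℝ} (D : Dat f rr) (X : Coord V) {C : ℝ} {i : ℕ → ℕ} (hC : 0 ≤ C)
    (hi : ∀ j, Abd f (rr (i j)) * rr (i j) ≤ C * (j + 1)) (hi2 : ∀ n, ∃ J, ∀ j, J ≤ j → n ≤ i j) (P : ℕ) :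
    ∃ v : V → ℂ, (∀ z, X.nrm P z < rr P → ContDiffAt ℝ 1 v z ∧ ∀ ξ, dbar v z ξ = f (X.pr P z) (X.pr P ξ)) ∧
      ∀ ρ1 ρ δ γ G β, Tup (mkPar D i P) ρ1 ρ δ γ G β → ∀ z, X.Lw γ P z < ρ1 →
        ‖v z‖ ≤ X.aN G β (C2 (mkPar D i P) ρ δ) P z * (ρ1 - X.Lw γ P z)⁻¹ := by
  obtain ⟨u, hu, hd⟩ := step1 D X P
  have hr1 : rr P < rr (P+1) := D.mono (Nat.lt_succ_self P)
  have hr2 : rr (P+1) < rr (P+2) := D.mono (Nat.lt_succ_self _)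
  have hHB : HB (mkPar D i P) := by
    intro ρ1 ρ h1 h2 h3
    obtain ⟨β, hb1, hb2⟩ := HBu D.mono D.pos (Abd_nonneg f)
      (fun n t ht => Abd_mono (D.ne (D.mono (Nat.lt_succ_self n))) ht) hC hi hi2 h1 h2 h3
    exact ⟨β, hb1, hb2 _ h3⟩
  have hcl : ClassC X (mkPar D i P) P 0 1 u := by
    have hlt : ∀ z : V, ‖z‖ < rr (P+2) → X.nrm P z < rr (P+2) := fun z hz => (X.nrm_le P z).trans_lt hz
    refine ⟨zero_le_one, fun z hz => hu.c1 z (hlt z (lt_trans hz hr2)), ?_, ?_, ?_, ?_⟩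
    · obtain ⟨K, _, hK⟩ := cpt_bound X P (rr (P+1)) (D := u) (fun z hz => (hu.c1 z (hz.trans_lt hr2)).continuousAt)
      refine ⟨K, fun z hz => ?_⟩
      rw [hu.cyl]
      exact hK z ((X.nrm_le P z).trans (le_of_lt hz))
    · intro ρ hρ z hz ξ
      have hρ' : ρ < rr (P+2) := lt_trans hρ hr2
      rw [hd z (hlt z (hz.trans_lt hρ')), one_mul]
      exact (dbdd D X P hρ').1 z hz ξ
    · intro ρ hρ z hz z' hz' ξ
      have hρ' : ρ < rr (P+2) := lt_trans hρ hr2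
      rw [hd z (hlt z (hz.trans_lt hρ')), hd z' (hlt z' (hz'.trans_lt hρ')), one_mul]
      exact (dbdd D X P hρ').2 z hz z' hz' ξ
    · intro p a ψ
      rw [hu.cyl (X.pr P p + (cE ψ * a) • X.e P), hu.cyl (X.pr P p + a • X.e P), pr_pt, pr_pt]
      simp [cE]
  obtain ⟨h, _, hh, hbd⟩ := SN_all hHB P 0 1 u hcl
  refine ⟨fun z => u z - h z, fun z hz => ?_, fun ρ1 ρ δ γ G β t z hz => ?_⟩
  · have hz2 : X.nrm P z < rr (P+2) := hz.trans (hr1.trans hr2)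
    refine ⟨(hu.c1 z hz2).sub (hh z hz).1, fun ξ => ?_⟩
    rw [dbar_sub (hu.diff hz2) ((hh z hz).1.differentiableAt (by norm_num)), (hh z hz).2, hd z hz2, sub_zero]
  · have h1 := hbd ρ1 ρ δ γ G β t z hz
    rw [hu.cyl (X.pr P z + _), pr_pt, ← hu.cyl z] at h1
    simpa [DD] using h1

theorem abs_main {f : V → V → ℂ} {rr : ℕ → ℝ} (D : Dat f rr) (X : Coord V)
    (hpr : ∀ z, Tendsto (fun N => X.pr N z) atTop (𝓝 z)) :
    ∃ u : V → ℂ, ∀ z ∈ {z : V | ∃ n, ‖z‖ < rr n}, ContDiffAt ℝ 1 u z ∧ ∀ ξ, dbar u z ξ = f z ξ := by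
  obtain ⟨C, i, hC, hi, hi2⟩ := exists_index (B := fun n => Abd f (rr n) * rr n)
    (fun n => mul_nonneg (Abd_nonneg f _) (D.pos n).le)
  choose v hv hvb using step2 D X hC hi hi2
  have hle : (Ultrafilter.of (atTop : Filter ℕ) : Filter ℕ) ≤ atTop := Ultrafilter.of_le _
  refine LLultra (Ultrafilter.of atTop) (un := v) ?_ ?_ ?_
  · rw [show {z : V | ∃ n, ‖z‖ < rr n} = ⋃ n, {z : V | ‖z‖ < rr n} by ext; simp]
    exact isOpen_iUnion fun n => isOpen_lt continuous_norm continuous_const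
  · rintro z0 ⟨n0, hn0⟩
    have hnz := norm_nonneg z0
    have hrn := D.pos n0
    obtain ⟨δ, hδ, hδs⟩ : ∃ δ : ℝ, (0 < δ ∧ δ ≤ 11) ∧ (1 + δ) * ‖z0‖ < rr n0 := by
      refine ⟨(rr n0 - ‖z0‖) / (2 * rr n0), ⟨by apply div_pos <;> linarith, ?_⟩, ?_⟩
      · rw [div_le_iff₀ (by positivity)]; linarith
      have h1 : (rr n0 - ‖z0‖) / (2 * rr n0) * ‖z0‖ ≤ (rr n0 - ‖z0‖) / 2 := by
        rw [div_mul_eq_mul_div, div_le_div_iff₀ (by positivity) (by positivity)]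
        nlinarith
      nlinarith
    obtain ⟨hδ, hδ11⟩ := hδ
    obtain ⟨M, hM⟩ : ∃ M, (1 + δ) * ‖z0‖ + 12 * ‖z0 - X.pr M z0‖ < rr n0 := by
      have h1 : Tendsto (fun M => (1 + δ) * ‖z0‖ + 12 * ‖z0 - X.pr M z0‖) atTop (𝓝 ((1 + δ) * ‖z0‖ + 12 * ‖z0 - z0‖)) :=
        (((tendsto_const_nhds.sub (hpr z0)).norm).const_mul 12).const_add _
      rw [sub_self, norm_zero, mul_zero, add_zero] at h1
      exact (h1.eventually (gt_mem_nhds hδs)).exists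
    obtain ⟨τ1, hτ0, hτ⟩ := exists_between hM
    obtain ⟨ρ1, hτρ, hρ1⟩ := exists_between hτ
    obtain ⟨ρ, hρρ, hρ⟩ := exists_between hρ1
    have hτpos : 0 < τ1 := lt_of_le_of_lt (by positivity) hτ0
    have hρ1pos : 0 < ρ1 := hτpos.trans hτρ
    obtain ⟨β, hb1, hb2⟩ := HBu D.mono D.pos (Abd_nonneg f)
      (fun n t ht => Abd_mono (D.ne (D.mono (Nat.lt_succ_self n))) ht) hC hi hi2 hρ1pos hρρ hρ
    have hβ0 : 0 ≤ β := le_trans (by have := Abd_nonneg f ρ; have : 0 < ρ := hρ1pos.trans hρρ; positivity) hb1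
    have hcont : Continuous (fun z => (1 + δ) * ‖z‖ + 12 * ‖z - X.pr M z‖) := by
      have := (X.pr M).continuous
      fun_prop
    obtain ⟨r, hr, hball⟩ := Metric.isOpen_iff.1 (isOpen_lt hcont continuous_const) z0 hτ0
    set c := Abd f ρ * ρ * (1 + δ) * (8 + 4 * ρ / δ) with hc
    have hρpos : 0 < ρ := hρ1pos.trans hρρ
    have hA := Abd_nonneg f ρ
    have hc0 : 0 ≤ c := by positivity
    set G0 : ℝ := 1 + 2 * Real.exp 1 / δ with hG0
    have hG1 : 1 ≤ G0 := by
      have : 0 < 2 * Real.exp 1 / δ := by have := Real.exp_pos 1; positivity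
      linarith
    set K := G0 ^ M * (β + c * ρ) * (ρ1 - τ1)⁻¹ with hK
    have hnorm : ∀ z ∈ Metric.ball z0 r, ‖z‖ < ρ := by
      intro z hz
      have h1 : (1 + δ) * ‖z‖ + 12 * ‖z - X.pr M z‖ < τ1 := hball hz
      have h2 := norm_nonneg z
      have h3 := norm_nonneg (z - X.pr M z)
      nlinarith
    refine ⟨r, max K (Abd f ρ), hr, hle ?_⟩
    filter_upwards [eventually_ge_atTop n0] with P hP
    have hρP : ρ < rr P := hρ.trans_le (D.mono.monotone hP)
    have hnrm : ∀ z ∈ Metric.ball z0 r, X.nrm P z < rr P := fun z hz =>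
      (X.nrm_le P z).trans_lt ((hnorm z hz).trans hρP)
    refine ⟨fun z hz => (hv P z (hnrm z hz)).1, fun z hz => ?_, fun z hz ξ => ?_, fun z hz z' hz' ξ => ?_⟩
    · have hτz : (1 + δ) * ‖z‖ + 12 * ‖z - X.pr M z‖ < τ1 := hball hz
      have hLw := (Lw_le X hδ M P z).trans_lt hτz
      have t : Tup (mkPar D i P) ρ1 ρ δ (fun i => if i < M then 1 + δ else 12) (fun i => if i < M then G0 else 1) β := by
        refine ⟨hρ1pos, hρρ, hρP, hδ, fun i => ?_, fun i => ?_, fun i m _ => ?_, hb1, hb2 _ hρP⟩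
        · show 1 + δ ≤ (if i < M then 1 + δ else 12)
          split_ifs
          · exact le_rfl
          · linarith
        · show 1 ≤ (if i < M then G0 else 1)
          split_ifs
          · exact hG1
          · exact le_rfl
        · show _ ≤ (if i < M then G0 else 1) * (if i < M then 1 + δ else 12) ^ m
          split_ifs
          · exact growth hδ m
          · exact growth12 m
      refine le_trans (hvb P ρ1 ρ δ _ _ β t z (hLw.trans hτρ)) (le_trans ?_ (le_max_left _ _))
      have h1 := aN_le X hG1 hβ0 hc0 M P z
      have h2 : X.nrm P z ≤ ρ := (X.nrm_le P z).trans (hnorm z hz).le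
      have h3 : G0 ^ (min P M) ≤ G0 ^ M := pow_le_pow_right₀ hG1 (min_le_right _ _)
      have h4 : (0:ℝ) ≤ G0 ^ (min P M) := by positivity
      have h5 := X.nrm_nonneg P z
      have h6 : G0 ^ (min P M) * (β + c * X.nrm P z) ≤ G0 ^ M * (β + c * ρ) := by gcongr
      have h7 : (ρ1 - X.Lw (fun i => if i < M then 1 + δ else 12) P z)⁻¹ ≤ (ρ1 - τ1)⁻¹ :=
        inv_anti₀ (by linarith) (by linarith)
      have h8 : 0 ≤ (ρ1 - X.Lw (fun i => if i < M then 1 + δ else 12) P z)⁻¹ := inv_nonneg.2 (by linarith)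
      refine mul_le_mul (h1.trans h6) h7 h8 (by positivity)
    · rw [(hv P z (hnrm z hz)).2]
      refine ((dbdd D X P hρ).1 z (hnorm z hz).le ξ).trans ?_
      gcongr
      exact le_max_right _ _
    · rw [(hv P z (hnrm z hz)).2, (hv P z' (hnrm z' hz')).2]
      refine ((dbdd D X P hρ).2 z (hnorm z hz).le z' (hnorm z' hz').le ξ).trans ?_
      gcongr
      exact le_max_right _ _
  · rintro z ⟨n, hn⟩ ξ
    have h1 : Tendsto (fun P => f (X.pr P z) (X.pr P ξ)) atTop (𝓝 (f z ξ)) :=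
      ((D.c1 n z hn ξ).continuousAt.tendsto).comp ((hpr z).prodMk_nhds (hpr ξ))
    refine (h1.mono_left hle).congr' (hle ?_)
    filter_upwards [eventually_ge_atTop n] with P hP
    exact ((hv P z ((X.nrm_le P z).trans_lt (hn.trans_le (D.mono.monotone hP)))).2 ξ).symm

end Fin2

section Fin3

def l1x (i : ℕ) : L1 →L[ℂ] ℂ :=
  LinearMap.mkContinuous ⟨⟨fun z : L1 => z i, fun _ _ => rfl⟩, fun _ _ => rfl⟩ 1
    (fun z => by rw [one_mul]; exact lp.norm_apply_le_norm one_ne_zero z i)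

lemma l1x_apply (i : ℕ) (z : L1) : l1x i z = z i := rfl

def L1coord : Coord L1 where
  e := fun i => lp.single 1 i (1:ℂ)
  x := l1x
  x_e := fun i k => by
    rw [l1x_apply, lp.single_apply]
    simp [Pi.single_apply]
  norm_e := fun i => by
    rw [lp.norm_single one_pos]; simp
  sum_le := fun N z => by
    have h := lp.sum_rpow_le_norm_rpow (p := 1) (by norm_num) z (Finset.range N)
    simpa [l1x_apply] using h

lemma L1_tendsto (z : L1) : Tendsto (fun N => L1coord.pr N z) atTop (𝓝 z) := by
  have h := (lp.hasSum_single (p := 1) (by norm_num) z).tendsto_sum_nat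
  refine h.congr fun N => ?_
  rw [L1coord.pr_apply]
  refine Finset.sum_congr rfl fun i _ => ?_
  show (lp.single 1 i (z i) : L1) = (z i : ℂ) • (lp.single (E := fun _ : ℕ => ℂ) 1 i (1:ℂ) : L1)
  rw [← lp.single_smul]; simp

end Fin3

end Helpers

/-- Let `0 < R ≤ ∞` and let `f` be a `(0,1)`-form of class `C¹` on the ball
`B(R) ⊆ l¹` which is Lipschitz continuous on every ball `B(r)` with `0 < r < R`. If `f` is
`∂̄`-closed, then there is a continuously (real Fréchet) differentiable `u : B(R) → ℂ` with
`∂̄u = f` on `B(R)`. -/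
theorem statement0 (R : ℝ≥0∞) (hR : 0 < R) (f : L1 → L1 → ℂ)
    (hform : IsForm01 1 {z : L1 | (‖z‖₊ : ℝ≥0∞) < R} f)
    (hlip : ∀ r : ℝ, 0 < r → ENNReal.ofReal r < R →
      LipschitzForm f {z : L1 | ‖z‖ < r})
    (hclosed : DbarClosed {z : L1 | (‖z‖₊ : ℝ≥0∞) < R} f) :
    ∃ u : L1 → ℂ,
      ContDiffOn ℝ 1 u {z : L1 | (‖z‖₊ : ℝ≥0∞) < R} ∧
      ∀ z : L1, (‖z‖₊ : ℝ≥0∞) < R → ∀ ξ : L1, dbar u z ξ = f z ξ := by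
  obtain ⟨a, ha1, ha2, ha3⟩ := exists_seq_strictMono_tendsto' hR
  have hfin : ∀ n, a n ≠ ∞ := fun n => ((ha2 n).2.trans_le le_top).ne
  have hiff : ∀ (n : ℕ) (z : L1), ‖z‖ < (a n).toReal ↔ (‖z‖₊ : ℝ≥0∞) < a n := by
    intro n z
    rw [← ENNReal.toReal_lt_toReal ENNReal.coe_ne_top (hfin n)]
    simp
  have hin : ∀ (n : ℕ) (z : L1), ‖z‖ < (a n).toReal → (‖z‖₊ : ℝ≥0∞) < R := fun n z h =>
    ((hiff n z).1 h).trans (ha2 n).2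
  have hop : IsOpen {z : L1 | (‖z‖₊ : ℝ≥0∞) < R} :=
    isOpen_lt (ENNReal.continuous_coe.comp continuous_nnnorm) continuous_const
  have D : Dat f (fun n => (a n).toReal) := by
    refine ⟨fun n m h => ?_, fun n => ?_, fun n z hz => hform.1 z (hin n z hz), fun n z hz => hform.2.1 z (hin n z hz),
      fun n z hz ξ => ?_, fun n => ?_, fun n z hz => hclosed z (hin n z hz)⟩
    · exact (ENNReal.toReal_lt_toReal (hfin n) (hfin m)).2 (ha1 h)
    · exact ENNReal.toReal_pos (ha2 n).1.ne' (hfin n)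
    · have h := hform.2.2
      exact h.contDiffAt ((hop.prod isOpen_univ).mem_nhds ⟨hin n z hz, mem_univ _⟩)
    · exact hlip _ (ENNReal.toReal_pos (ha2 n).1.ne' (hfin n)) (by rw [ENNReal.ofReal_toReal (hfin n)]; exact (ha2 n).2)
  obtain ⟨u, hu⟩ := abs_main D L1coord L1_tendsto
  have hmem : ∀ z : L1, (‖z‖₊ : ℝ≥0∞) < R → z ∈ {z : L1 | ∃ n, ‖z‖ < (a n).toReal} := by
    intro z hz
    obtain ⟨n, hn⟩ := (ha3.eventually (lt_mem_nhds hz)).exists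
    exact ⟨n, (hiff n z).2 hn⟩
  exact ⟨u, fun z hz => (hu z (hmem z hz)).1.contDiffWithinAt, fun z hz ξ => (hu z (hmem z hz)).2 ξ⟩
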